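/- Let G be a finite EPPO-group with abelian Sylow 2-subgroups and a nontrivial normal q-subgroup for some prime q. Then G is solvable. -/

import Mathlib

/-- A group is an EPPO-group if every element has prime power order. -/
def IsEPPOGroup (G : Type*) [Group G] : Prop :=
  ∀ g : G, ∃ (p n : ℕ), p.Prime ∧ orderOf g = p ^ n

set_option linter.all false

namespace EP

universe u
open Subgroup

theorem eppo_sub {G : Type*} [Group G] (hG : IsEPPOGroup G) (H : Subgroup G) : IsEPPOGroup H := by
  intro g
  obtain ⟨p, n, hp, h⟩ := hG g
  exact ⟨p, n, hp, by rw [← h, Subgroup.orderOf_coe]⟩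

theorem eppo_surj {G G' : Type*} [Group G] [Group G'] (hG : IsEPPOGroup G) (f : G →* G')
    (hf : Function.Surjective f) : IsEPPOGroup G' := by
  intro g
  obtain ⟨x, rfl⟩ := hf g
  obtain ⟨p, n, hp, h⟩ := hG x
  have := orderOf_map_dvd f x
  rw [h, Nat.dvd_prime_pow hp] at this
  obtain ⟨m, _, hm⟩ := this
  exact ⟨p, m, hp, hm⟩

/-- elements commuting with a nontrivial `p`-element are `p`-elements -/
theorem eppo_comm {G : Type*} [Group G] (hG : IsEPPOGroup G) {p : ℕ} (hp : p.Prime)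
    {x y : G} (hx : x ≠ 1) {k : ℕ} (hxk : x ^ p ^ k = 1) (hxy : Commute x y) :
    ∃ m : ℕ, y ^ p ^ m = 1 := by
  obtain ⟨s, n, hs, hy⟩ := hG y
  by_cases hsp : s = p
  · exact ⟨n, by rw [← hsp, ← hy, pow_orderOf_eq_one]⟩
  obtain ⟨a, ha, hxa⟩ := (Nat.dvd_prime_pow hp).1 (orderOf_dvd_of_pow_eq_one hxk)
  have hcop : (orderOf x).Coprime (orderOf y) := by
    rw [hxa, hy]
    exact Nat.Coprime.pow _ _ ((Nat.coprime_primes hp hs).2 (fun h => hsp h.symm))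
  have hxy' := hxy.orderOf_mul_eq_mul_orderOf_of_coprime hcop
  obtain ⟨l, b, hl, hlb⟩ := hG (x * y)
  have ha0 : a ≠ 0 := by
    rintro rfl
    rw [pow_zero, orderOf_eq_one_iff] at hxa
    exact hx hxa
  rw [hlb, hxa, hy] at hxy'
  have hpl : p = l := by
    have : p ∣ l ^ b := by
      rw [hxy']
      exact Dvd.dvd.mul_right (dvd_pow_self p ha0) _
    exact (Nat.prime_dvd_prime_iff_eq hp hl).1 (hp.dvd_of_dvd_pow this)
  have hn : n = 0 := by
    by_contra hn
    have : s ∣ l ^ b := by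
      rw [hxy']
      exact Dvd.dvd.mul_left (dvd_pow_self s hn) _
    exact hsp (((Nat.prime_dvd_prime_iff_eq hs hl).1 (hs.dvd_of_dvd_pow this)).trans hpl.symm)
  refine ⟨0, ?_⟩
  rw [hn, pow_zero, orderOf_eq_one_iff] at hy
  simp [hy]

theorem pp_one {G : Type*} [Group G] {p r : ℕ} (hp : p.Prime) (hr : r.Prime) (hpr : p ≠ r)
    {x : G} {a b : ℕ} (h1 : x ^ p ^ a = 1) (h2 : x ^ r ^ b = 1) : x = 1 := by
  have : (p ^ a).Coprime (r ^ b) := Nat.Coprime.pow _ _ ((Nat.coprime_primes hp hr).2 hpr)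
  have h := Nat.dvd_gcd (orderOf_dvd_of_pow_eq_one h1) (orderOf_dvd_of_pow_eq_one h2)
  rw [this.gcd_eq_one, Nat.dvd_one, orderOf_eq_one_iff] at h
  exact h

theorem isPGroup_sub_iff {G : Type*} [Group G] {p : ℕ} {H : Subgroup G} :
    IsPGroup p H ↔ ∀ x ∈ H, ∃ k : ℕ, x ^ p ^ k = 1 := by
  constructor
  · intro h x hx
    obtain ⟨k, hk⟩ := h ⟨x, hx⟩
    exact ⟨k, by simpa [Subtype.ext_iff] using hk⟩
  · rintro h ⟨x, hx⟩
    obtain ⟨k, hk⟩ := h x hx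
    exact ⟨k, by simpa [Subtype.ext_iff] using hk⟩

theorem centralizer_pgroup {G : Type*} [Group G] (hG : IsEPPOGroup G) {p : ℕ} (hp : p.Prime)
    {N : Subgroup G} (hN : N ≠ ⊥) (hNp : IsPGroup p N) :
    IsPGroup p (Subgroup.centralizer (N : Set G)) := by
  rw [isPGroup_sub_iff]
  intro y hy
  obtain ⟨x, hx, hx1⟩ := (Subgroup.bot_or_exists_ne_one N).resolve_left hN
  obtain ⟨k, hk⟩ := isPGroup_sub_iff.1 hNp x hx
  exact eppo_comm hG hp hx1 hk (Subgroup.mem_centralizer_iff.1 hy x hx)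

theorem noCr2_aux {G A : Type*} [Group G] [CommGroup A] (φ : G →* MulAut A) {r : ℕ}
    (hr : r.Prime) (hfix : ∀ g : G, g ≠ 1 → g ^ r = 1 → ∀ v : A, φ g v = v → v = 1)
    {x y : G} (hx : x ^ r = 1) (hy : y ^ r = 1) (hxy : Commute x y) (hy1 : y ≠ 1)
    (hne : ∀ i : ℕ, x * y ^ i ≠ 1) (v : A) : v ^ r = 1 := by
  have key : ∀ g : G, g ≠ 1 → g ^ r = 1 → ∀ v : A, ∏ j ∈ Finset.range r, φ (g ^ j) v = 1 := by
    intro g hg hgr v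
    apply hfix g hg hgr
    rw [map_prod]
    have h1 := Finset.prod_range_succ (fun j => φ (g ^ j) v) r
    have h2 := Finset.prod_range_succ' (fun j => φ (g ^ j) v) r
    rw [h1] at h2
    simp only [hgr, pow_zero] at h2
    have h3 := mul_right_cancel h2
    rw [h3]
    refine Finset.prod_congr rfl fun j _ => ?_
    rw [pow_succ', map_mul]
    rfl
  have h1 : ∏ i ∈ Finset.range r, ∏ j ∈ Finset.range r, φ ((x * y ^ i) ^ j) v = 1 := by
    refine Finset.prod_eq_one fun i _ => key _ (hne i) ?_ v
    rw [(hxy.pow_right i).mul_pow, hx, one_mul, ← pow_mul, mul_comm, pow_mul, hy, one_pow]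
  rw [Finset.prod_comm] at h1
  obtain ⟨s, rfl⟩ : ∃ s, r = s + 1 := ⟨r - 1, by have := hr.pos; omega⟩
  rw [Finset.prod_range_succ' _ s] at h1
  rw [Finset.prod_eq_one] at h1
  · simpa using h1
  · intro j hj
    rw [Finset.mem_range] at hj
    have hyj : y ^ (j + 1) ≠ 1 := by
      intro h
      have := orderOf_eq_prime hy hy1 (hp := ⟨hr⟩)
      have h2 := orderOf_dvd_of_pow_eq_one h
      rw [this] at h2
      have := Nat.le_of_dvd (by omega) h2
      omega
    have h3 := key (y ^ (j + 1)) hyj (by rw [← pow_mul, mul_comm, pow_mul, hy, one_pow]) v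
    have h4 := congrArg (φ (x ^ (j + 1))) h3
    rw [map_prod, map_one] at h4
    rw [← h4]
    refine Finset.prod_congr rfl fun i _ => ?_
    rw [(hxy.pow_right i).mul_pow, map_mul, ← pow_mul, ← pow_mul, mul_comm i]
    rfl

theorem noCr2 {G : Type*} [Group G] [Finite G] (hG : IsEPPOGroup G) {q r : ℕ} (hq : q.Prime)
    (hr : r.Prime) (hqr : q ≠ r) (N : Subgroup G) [N.Normal] (hN : N ≠ ⊥) (hNq : IsPGroup q N)
    {x y : G} (hx : x ^ r = 1) (hy : y ^ r = 1) (hxy : Commute x y) (hy1 : y ≠ 1) :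
    ∃ i : ℕ, x * y ^ i = 1 := by
  by_contra! hne
  have : Fact q.Prime := ⟨hq⟩
  have : Nontrivial N := (Subgroup.nontrivial_iff_ne_bot N).2 hN
  have := hNq.center_nontrivial
  let Z : Subgroup N := Subgroup.center N
  let M : Subgroup G := Z.map N.subtype
  have hMN : M ≤ N := Subgroup.map_subtype_le Z
  have : M.Normal := inferInstance
  let φ : G →* MulAut M := MulAut.conjNormal
  have hcomm : ∀ a b : M, a * b = b * a := by
    rintro ⟨_, a, ha, rfl⟩ ⟨_, b, hb, rfl⟩
    have := Subgroup.mem_center_iff.1 ha b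
    ext
    simpa [Subtype.ext_iff] using this.symm
  let : CommGroup M := { (inferInstance : Group M) with mul_comm := hcomm }
  have hMq : ∀ v : M, ∃ k : ℕ, v ^ q ^ k = 1 := by
    intro v
    obtain ⟨k, hk⟩ := isPGroup_sub_iff.1 hNq v.1 (hMN v.2)
    exact ⟨k, Subtype.ext (by simpa using hk)⟩
  have hall := noCr2_aux φ hr (fun g hg hgr v hv => by
    by_contra hv1
    obtain ⟨k, hk⟩ := hMq v
    have hcm : Commute v.1 g := by
      have h := congrArg Subtype.val hv
      have h' : g * v.1 * g⁻¹ = v.1 := h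
      rw [mul_inv_eq_iff_eq_mul] at h'
      exact h'.symm
    obtain ⟨m, hm⟩ := eppo_comm hG hq (x := v.1) (y := g) (k := k)
      (fun h => hv1 (Subtype.ext h)) (by simpa [Subtype.ext_iff] using hk) hcm
    exact hg (pp_one hq hr hqr hm (by rwa [pow_one] : g ^ r ^ 1 = 1))) hx hy hxy hy1 hne
  obtain ⟨z, hz⟩ := exists_ne (1 : Z)
  have hz' := hall ⟨z.1.1, ⟨z.1, z.2, rfl⟩⟩
  obtain ⟨k, hk⟩ := hMq ⟨z.1.1, ⟨z.1, z.2, rfl⟩⟩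
  have := pp_one (b := 1) hq hr hqr hk (by rwa [pow_one])
  exact hz (Subtype.ext (Subtype.ext (congrArg (fun a : M => a.1) this : z.1.1 = 1)))

theorem class2_pow {G : Type*} [Group G] {x y c : G} (hc : ∀ g, Commute c g)
    (h : y * x = x * y * c) (n : ℕ) : (x * y) ^ n = x ^ n * y ^ n * c ^ (n * (n - 1) / 2) := by
  have h1 : ∀ n : ℕ, y ^ n * x = x * y ^ n * c ^ n := by
    intro n
    induction n with
    | zero => simp
    | succ n ih =>
      rw [pow_succ, mul_assoc, h, ← mul_assoc, ← mul_assoc, ih, mul_assoc (x * y ^ n),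
        ((hc y).pow_left n).eq]
      simp [mul_assoc, pow_succ]
  induction n with
  | zero => simp
  | succ n ih =>
    have e : (n + 1) * (n + 1 - 1) / 2 = n * (n - 1) / 2 + n := by
      have := Nat.triangle_succ n
      exact this
    rw [pow_succ, ih, e, pow_add c]
    have h2 : c ^ (n * (n - 1) / 2) * (x * y) = x * y * c ^ (n * (n - 1) / 2) :=
      ((hc (x * y)).pow_left _).eq
    rw [mul_assoc, h2]
    calc x ^ n * y ^ n * (x * y * c ^ (n * (n - 1) / 2))
        = x ^ n * (y ^ n * x) * y * c ^ (n * (n - 1) / 2) := by simp only [mul_assoc]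
      _ = x ^ n * (x * y ^ n) * (c ^ n * y) * c ^ (n * (n - 1) / 2) := by
          rw [h1]; simp only [mul_assoc]
      _ = x ^ n * (x * y ^ n) * y * (c ^ n * c ^ (n * (n - 1) / 2)) := by
          rw [((hc y).pow_left n).eq]; simp only [mul_assoc]
      _ = x ^ (n + 1) * y ^ (n + 1) * (c ^ (n * (n - 1) / 2) * c ^ n) := by
          rw [← pow_add, ← pow_add, add_comm n (n * (n - 1) / 2), pow_succ x, pow_succ y]
          simp only [mul_assoc]

theorem cyclic_of_noCr2 {r : ℕ} (hr : r.Prime) (hr2 : r ≠ 2) (n : ℕ) :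
    ∀ (R : Type u) [Group R] [Finite R], Nat.card R = n → IsPGroup r R →
      (∀ x y : R, x ^ r = 1 → y ^ r = 1 → Commute x y → y ≠ 1 → ∃ i : ℕ, x * y ^ i = 1) →
      IsCyclic R := by
  induction n using Nat.strong_induction_on with
  | _ n ih =>
  intro R _ _ hn hR h
  have : Fact r.Prime := ⟨hr⟩
  rcases subsingleton_or_nontrivial R with hs | hnt
  · infer_instance
  have := hR.center_nontrivial
  obtain ⟨z0, hz0⟩ : ∃ z : Subgroup.center R, orderOf z = r := by
    refine exists_prime_orderOf_dvd_card' r ?_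
    obtain ⟨k, hk, hk'⟩ := (hR.to_subgroup (Subgroup.center R)).nontrivial_iff_card.1 inferInstance
    rw [hk']
    exact dvd_pow_self r hk.ne'
  obtain ⟨z, hzc⟩ := z0
  have hzr : z ^ r = 1 := by
    have := pow_orderOf_eq_one (⟨z, hzc⟩ : Subgroup.center R)
    rw [hz0] at this
    simpa [Subtype.ext_iff] using this
  have hz1 : z ≠ 1 := by
    rintro rfl
    have : orderOf (1 : Subgroup.center R) = r := hz0
    rw [orderOf_one] at this
    exact hr.one_lt.ne this
  have hzc' : ∀ g, Commute z g := fun g => (Subgroup.mem_center_iff.1 hzc g).symm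
  let Z : Subgroup R := zpowers z
  have hZle : Z ≤ Subgroup.center R := by
    rw [zpowers_le]; exact hzc
  have : Z.Normal := ⟨fun n hn g => by
    rw [Subgroup.mem_center_iff.1 (hZle hn) g, mul_inv_cancel_right]; exact hn⟩
  -- order r elements are in Z
  have hin : ∀ x : R, x ^ r = 1 → x ∈ Z := by
    intro x hx
    obtain ⟨i, hi⟩ := h x z hx hzr (hzc' x).symm hz1
    rw [mul_eq_one_iff_eq_inv] at hi
    rw [hi]
    exact inv_mem (pow_mem (mem_zpowers z) i)
  have hcyc : IsCyclic (R ⧸ Z) := by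
    refine ih (Nat.card (R ⧸ Z)) ?_ (R ⧸ Z) rfl (hR.to_quotient Z) ?_
    · rw [← hn, Subgroup.card_eq_card_quotient_mul_card_subgroup Z]
      have : 1 < Nat.card Z := by
        rw [Nat.card_zpowers, orderOf_eq_prime hzr hz1]
        exact hr.one_lt
      have h0 : 0 < Nat.card (R ⧸ Z) := Nat.card_pos
      nlinarith
    · intro X Y
      obtain ⟨x, rfl⟩ := QuotientGroup.mk_surjective X
      obtain ⟨y, rfl⟩ := QuotientGroup.mk_surjective Y
      intro hx hy hxy hy1
      rw [← QuotientGroup.mk_pow, QuotientGroup.eq_one_iff] at hx hy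
      rw [Ne, QuotientGroup.eq_one_iff] at hy1
      have hyr : y ^ r ≠ 1 := fun hh => hy1 (hin y hh)
      -- commutators
      have hcm : (x * y)⁻¹ * (y * x) ∈ Z := by
        rw [← QuotientGroup.eq]
        exact hxy
      -- x ^ r = (y^r)^(-i)
      have hrr : ∀ w ∈ Z, w ^ r = 1 := by
        intro w hw
        obtain ⟨m, rfl⟩ := mem_zpowers_iff.1 hw
        rw [← zpow_natCast, ← zpow_mul, mul_comm, zpow_mul, zpow_natCast, hzr, one_zpow]
      obtain ⟨i, hi⟩ := h (x ^ r) (y ^ r) (hrr _ hx) (hrr _ hy)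
        (Subgroup.mem_center_iff.1 (hZle hy) _) hyr
      refine ⟨i, ?_⟩
      rw [← QuotientGroup.mk_pow, ← QuotientGroup.mk_mul, QuotientGroup.eq_one_iff]
      apply hin
      have hcen : ∀ w ∈ Z, ∀ g, Commute w g := fun w hw g =>
        (Subgroup.mem_center_iff.1 (hZle hw) g).symm
      have hcm2 : (x * y ^ i)⁻¹ * (y ^ i * x) ∈ Z := by
        rw [← QuotientGroup.eq]
        exact (hxy.pow_right i).eq
      rw [class2_pow (c := (x * y ^ i)⁻¹ * (y ^ i * x)) (hcen _ hcm2) (by group)]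
      rw [← pow_mul, mul_comm i r, pow_mul, hi, one_mul]
      have hodd : Odd r := hr.odd_of_ne_two hr2
      obtain ⟨s, hs⟩ := hodd
      have : r * (r - 1) / 2 = r * s := by
        rw [hs, show (2 * s + 1) * (2 * s + 1 - 1) = 2 * ((2 * s + 1) * s) by
          simp; ring, Nat.mul_div_cancel_left _ (by norm_num)]
      rw [this, pow_mul, hrr _ hcm2, one_pow]
  obtain ⟨g0, hg0⟩ := hcyc.exists_generator
  obtain ⟨g, rfl⟩ := QuotientGroup.mk_surjective g0
  have hgen : ∀ x : R, ∃ m : ℤ, x * g ^ m ∈ Z := by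
    intro x
    obtain ⟨m, hm⟩ := mem_zpowers_iff.1 (hg0 (QuotientGroup.mk x))
    refine ⟨-m, ?_⟩
    rw [← QuotientGroup.eq_one_iff, QuotientGroup.mk_mul, QuotientGroup.mk_zpow, zpow_neg, hm,
      mul_inv_cancel]
  by_cases hg1 : g = 1
  · refine ⟨z, fun x => ?_⟩
    obtain ⟨m, hm⟩ := hgen x
    rw [hg1, one_zpow, mul_one] at hm
    exact hm
  · refine ⟨g, fun x => ?_⟩
    have hzg : z ∈ zpowers g := by
      have hnt : Nontrivial (zpowers g) := by
        rw [Subgroup.nontrivial_iff_ne_bot, Ne, zpowers_eq_bot]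
        exact hg1
      obtain ⟨w, hw⟩ : ∃ w : zpowers g, orderOf w = r := by
        refine exists_prime_orderOf_dvd_card' r ?_
        obtain ⟨k, hk, hk'⟩ := (hR.to_subgroup (zpowers g)).nontrivial_iff_card.1 hnt
        rw [hk']
        exact dvd_pow_self r hk.ne'
      have hwr : w.1 ^ r = 1 := by
        have := pow_orderOf_eq_one w
        rw [hw] at this
        simpa [Subtype.ext_iff] using this
      have hw1 : w.1 ≠ 1 := by
        intro hh
        have : w = 1 := Subtype.ext hh
        rw [this, orderOf_one] at hw
        exact hr.one_lt.ne hw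
      obtain ⟨i, hi⟩ := h z w.1 hzr hwr (hzc' _) hw1
      rw [mul_eq_one_iff_eq_inv] at hi
      rw [hi]
      exact inv_mem (pow_mem w.2 i)
    obtain ⟨m, hm⟩ := hgen x
    have h1 : x * g ^ m ∈ zpowers g := (zpowers_le.2 hzg) hm
    exact (Subgroup.mul_mem_cancel_right _ (zpow_mem (mem_zpowers g) m)).1 h1

theorem cyclic_sylow {G : Type*} [Group G] [Finite G] (hG : IsEPPOGroup G) {q r : ℕ}
    (hq : q.Prime) (hr : r.Prime) (hqr : q ≠ r) (hr2 : r ≠ 2) (N : Subgroup G) [N.Normal]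
    (hN : N ≠ ⊥) (hNq : IsPGroup q N) (R : Subgroup G) (hR : IsPGroup r R) : IsCyclic R := by
  refine cyclic_of_noCr2 hr hr2 _ R rfl hR ?_
  intro x y hx hy hxy hy1
  obtain ⟨i, hi⟩ := noCr2 hG hq hr hqr N hN hNq (x := x.1) (y := y.1)
    (by simpa [Subtype.ext_iff] using hx) (by simpa [Subtype.ext_iff] using hy)
    (congrArg Subtype.val hxy.eq)
    (fun h => hy1 (Subtype.ext h))
  exact ⟨i, by simpa [Subtype.ext_iff] using hi⟩

end EP

namespace EP

universe u
open Subgroup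

/-- the working hypothesis of the odd order part -/
def Hyp (q : ℕ) (H : Type*) [Group H] : Prop :=
  Odd (Nat.card H) ∧ IsEPPOGroup H ∧
    ∀ r : ℕ, r.Prime → r ≠ q → ∀ R : Subgroup H, IsPGroup r R → IsCyclic R

theorem Hyp.sub {q : ℕ} {H : Type*} [Group H] [Finite H] (h : Hyp q H) (K : Subgroup H) :
    Hyp q K := by
  refine ⟨?_, eppo_sub h.2.1 K, ?_⟩
  · exact Odd.of_dvd_nat h.1 K.card_subgroup_dvd_card
  · intro r hr hrq R hR
    have h1 : IsPGroup r (R.map K.subtype) := hR.map _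
    have := h.2.2 r hr hrq _ h1
    exact isCyclic_of_surjective _
      (Subgroup.equivMapOfInjective R K.subtype K.subtype_injective).symm.surjective

theorem Hyp.quot {q : ℕ} {H : Type*} [Group H] [Finite H] (h : Hyp q H) (K : Subgroup H)
    [K.Normal] : Hyp q (H ⧸ K) := by
  refine ⟨?_, eppo_surj h.2.1 _ (QuotientGroup.mk'_surjective K), ?_⟩
  · exact Odd.of_dvd_nat h.1 (Subgroup.card_quotient_dvd_card K)
  · intro r hr hrq R hR
    have : Fact r.Prime := ⟨hr⟩
    obtain ⟨P, hP⟩ := hR.exists_le_sylow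
    obtain ⟨S, hS⟩ := Sylow.mapSurjective_surjective (QuotientGroup.mk'_surjective K) r P
    have h1 := h.2.2 r hr hrq S S.2
    have h2 : IsCyclic P := by
      rw [← hS]
      exact isCyclic_of_surjective _ ((QuotientGroup.mk' K).subgroupMap_surjective S)
    exact isCyclic_of_injective (Subgroup.inclusion hP) (Subgroup.inclusion_injective hP)

theorem solvable_of_pgroup {p : ℕ} (hp : p.Prime) {G : Type*} [Group G] [Finite G]
    (h : IsPGroup p G) : Group.IsSolvable G := by
  have : Fact p.Prime := ⟨hp⟩
  have := h.isNilpotent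
  infer_instance

theorem main_red {G : Type u} [Group G] [Finite G]
    (thm : ∀ (q : ℕ), q.Prime → ∀ (H : Type u) [Group H] [Finite H], Hyp q H → Group.IsSolvable H)
    (hG : IsEPPOGroup G)
    (habel : ∀ P : Sylow 2 G, ∀ x y : (P : Subgroup G), x * y = y * x)
    {q : ℕ} (hq : q.Prime) (Q : Subgroup G) [Q.Normal] (hQ : Q ≠ ⊥)
    (hQq : IsPGroup q Q) : Group.IsSolvable G := by
  have : Fact q.Prime := ⟨hq⟩
  have : Fact (Nat.Prime 2) := ⟨Nat.prime_two⟩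
  have hCq := centralizer_pgroup hG hq hQ hQq
  have hCs : Group.IsSolvable (centralizer (Q : Set G)) := solvable_of_pgroup hq hCq
  by_cases h2 : q = 2
  · subst h2
    rw [Group.isSolvable_iff_subgroup_quotient (centralizer (Q : Set G))]
    refine ⟨hCs, ?_⟩
    have : IsZGroup (G ⧸ centralizer (Q : Set G)) := by
      rw [isZGroup_iff]
      intro p hp P
      have : Fact p.Prime := ⟨hp⟩
      obtain ⟨S, hS⟩ := Sylow.mapSurjective_surjective
        (QuotientGroup.mk'_surjective (centralizer (Q : Set G))) p P
      by_cases hp2 : p = 2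
      · subst hp2
        have hQS : Q ≤ S := by
          obtain ⟨T, hT⟩ := hQq.exists_le_sylow
          obtain ⟨g, rfl⟩ := MulAction.exists_smul_eq G T S
          intro x hx
          have : g⁻¹ * x * g ∈ Q := by
            simpa using Subgroup.Normal.conj_mem ‹Q.Normal› x hx g⁻¹
          rw [Sylow.coe_subgroup_smul, Subgroup.mem_pointwise_smul_iff_inv_smul_mem]
          simpa using hT this
        have hSC : (S : Subgroup G) ≤ centralizer (Q : Set G) := by
          intro s hs
          rw [mem_centralizer_iff]
          intro x hx
          exact congrArg Subtype.val (habel S ⟨x, hQS hx⟩ ⟨s, hs⟩)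
        have : (P : Subgroup (G ⧸ centralizer (Q : Set G))) = ⊥ := by
          rw [← hS, Sylow.coe_mapSurjective, Subgroup.map_eq_bot_iff, QuotientGroup.ker_mk']
          exact hSC
        rw [this]
        infer_instance
      · have := cyclic_sylow hG hq hp (Ne.symm hp2) hp2 Q hQ hQq S S.2
        rw [← hS]
        exact isCyclic_of_surjective _ ((QuotientGroup.mk' (centralizer (Q : Set G))).subgroupMap_surjective S)
    infer_instance
  by_cases hev : 2 ∣ Nat.card G
  · obtain ⟨t, ht⟩ := exists_prime_orderOf_dvd_card' 2 hev
    have ht1 : t ≠ 1 := by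
      rintro rfl
      simp at ht
    have ht2 : t ^ 2 = 1 := by rw [← ht, pow_orderOf_eq_one]
    have hnoc : ∀ x ∈ Q, Commute x t → x = 1 := by
      intro x hx hxt
      by_contra hx1
      obtain ⟨k, hk⟩ := isPGroup_sub_iff.1 hQq x hx
      obtain ⟨m, hm⟩ := eppo_comm hG hq hx1 hk hxt
      exact ht1 (pp_one (b := 1) hq Nat.prime_two h2 hm (by simpa using ht2))
    let φ : Q →* Q := (MulAut.conjNormal t : MulAut Q).toMonoidHom
    have hφ : MonoidHom.FixedPointFree φ := by
      intro x hx
      have h : t * x.1 * t⁻¹ = x.1 := congrArg Subtype.val hx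
      refine Subtype.ext (hnoc x.1 x.2 ?_)
      rw [mul_inv_eq_iff_eq_mul] at h
      exact h.symm
    have hinv : Function.Involutive φ := by
      intro x
      apply Subtype.ext
      change t * (t * x.1 * t⁻¹) * t⁻¹ = x.1
      have : t * t = 1 := by rw [← pow_two, ht2]
      have h' : t⁻¹ * t⁻¹ = 1 := by rw [← mul_inv_rev, this, inv_one]
      calc t * (t * x.1 * t⁻¹) * t⁻¹ = (t * t) * x.1 * (t⁻¹ * t⁻¹) := by simp only [mul_assoc]
        _ = x.1 := by rw [this, h']; simp
    have hi := hφ.coe_eq_inv_of_involutive hinv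
    have hi' : ∀ x ∈ Q, t * x * t⁻¹ = x⁻¹ := by
      intro x hx
      have := congrFun hi ⟨x, hx⟩
      exact congrArg Subtype.val this
    rw [Group.isSolvable_iff_subgroup_quotient (centralizer (Q : Set G))]
    refine ⟨hCs, ?_⟩
    refine solvable_of_pgroup Nat.prime_two ?_
    intro g
    obtain ⟨g, rfl⟩ := QuotientGroup.mk_surjective g
    have hE := eppo_surj hG _ (QuotientGroup.mk'_surjective (centralizer (Q : Set G)))
    refine eppo_comm hE Nat.prime_two (x := QuotientGroup.mk t) (k := 1) ?_ ?_ ?_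
    · rw [Ne, QuotientGroup.eq_one_iff]
      intro hc
      obtain ⟨x, hx, hx1⟩ := (Subgroup.bot_or_exists_ne_one Q).resolve_left hQ
      exact hx1 (hnoc x hx (mem_centralizer_iff.1 hc x hx))
    · rw [← QuotientGroup.mk_pow, pow_one, ht2]; rfl
    · change (QuotientGroup.mk t * QuotientGroup.mk g : G ⧸ centralizer (Q : Set G)) = _
      rw [← QuotientGroup.mk_mul, ← QuotientGroup.mk_mul, QuotientGroup.eq, mem_centralizer_iff]
      intro x hx
      have hx' : ∀ g : G, g * x * g⁻¹ ∈ Q := fun g => Subgroup.Normal.conj_mem ‹Q.Normal› x hx g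
      have a1 : (t * g) * x * (t * g)⁻¹ = (g * x * g⁻¹)⁻¹ := by
        rw [← hi' _ (hx' g)]; group
      have a2 : (g * t) * x * (g * t)⁻¹ = (g * x * g⁻¹)⁻¹ := by
        have : (g * t) * x * (g * t)⁻¹ = g * (t * x * t⁻¹) * g⁻¹ := by group
        rw [this, hi' x hx]; group
      have a3 := a1.trans a2.symm
      have : ((t * g)⁻¹ * (g * t)) * x * ((t * g)⁻¹ * (g * t))⁻¹ = x := by
        calc _ = (t * g)⁻¹ * ((g * t) * x * (g * t)⁻¹) * (t * g) := by group
          _ = x := by rw [← a3]; group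
      rw [mul_inv_eq_iff_eq_mul] at this
      exact this.symm
  · refine thm q hq G ⟨?_, hG, ?_⟩
    · exact Nat.not_even_iff_odd.1 (fun h => hev h.two_dvd)
    · intro r hr hrq R hR
      by_cases hr2 : r = 2
      · subst hr2
        have : (R : Subgroup G) = ⊥ := by
          obtain ⟨k, hk⟩ := hR.exists_card_eq
          rcases Nat.eq_zero_or_pos k with rfl | hk0
          · exact Subgroup.card_eq_one.1 (by simpa using hk)
          · exact absurd ((dvd_pow_self 2 hk0.ne').trans (hk ▸ R.card_subgroup_dvd_card)) hev
        rw [this]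
        infer_instance
      · exact cyclic_sylow hG hq hr (Ne.symm hrq) hr2 Q hQ hQq R hR

end EP

namespace EP

universe u
open Subgroup

theorem exists_abelian_normal (X : Type*) [Group X] [Group.IsSolvable X] [Nontrivial X] :
    ∃ A : Subgroup X, A.Normal ∧ A ≠ ⊥ ∧ ∀ a ∈ A, ∀ b ∈ A, a * b = b * a := by
  classical
  have h : ∃ n, derivedSeries X n = ⊥ := Group.IsSolvable.solvable
  have h0 : Nat.find h ≠ 0 := by
    intro h0
    have := Nat.find_spec h
    rw [h0, derivedSeries_zero] at this
    exact top_ne_bot this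
  obtain ⟨m, hm⟩ := Nat.exists_eq_succ_of_ne_zero h0
  refine ⟨derivedSeries X m, inferInstance, Nat.find_min h (by omega), ?_⟩
  have hs := Nat.find_spec h
  rw [hm, derivedSeries_succ, commutator_eq_bot_iff_le_centralizer] at hs
  intro a ha b hb
  exact (mem_centralizer_iff.1 (hs ha) b hb).symm

theorem exists_abelian_normal_pgroup (X : Type*) [Group X] [Group.IsSolvable X] [Nontrivial X]
    (hX : IsEPPOGroup X) :
    ∃ A : Subgroup X, A.Normal ∧ A ≠ ⊥ ∧ (∀ a ∈ A, ∀ b ∈ A, a * b = b * a) ∧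
      ∃ r : ℕ, r.Prime ∧ IsPGroup r A := by
  obtain ⟨A, hA, hA1, hab⟩ := exists_abelian_normal X
  refine ⟨A, hA, hA1, hab, ?_⟩
  obtain ⟨x, hx, hx1⟩ := (Subgroup.bot_or_exists_ne_one A).resolve_left hA1
  obtain ⟨r, n, hr, hn⟩ := hX x
  refine ⟨r, hr, isPGroup_sub_iff.2 fun y hy => ?_⟩
  exact eppo_comm hX hr hx1 (k := n) (by rw [← hn, pow_orderOf_eq_one]) (hab x hx y hy)

theorem ring_quad {R : Type*} [Ring R] {u P : R} {n : ℕ} (hn : n ≠ 0)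
    (hP : P ^ n = 1)
    (h2 : ∀ a : R, 2 * a = 0 → a = 0) (hn' : ∀ a : R, (n : R) * a = 0 → a = 0)
    (hc1 : Commute ((1 + u) * P * (1 - u)) P) (hc2 : Commute ((1 - u) * P * (1 + u)) P) :
    Commute u P := by
  set a := u * P - P * u with ha
  have h1 : Commute (2 * a) P := by
    have : 2 * a = (1 + u) * P * (1 - u) - (1 - u) * P * (1 + u) := by
      rw [ha]; noncomm_ring
    rw [this]
    exact hc1.sub_left hc2
  have h3 : Commute a P := by
    have : 2 * (a * P - P * a) = 0 := by
      have := h1.eq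
      rw [mul_sub, ← mul_assoc, this, ← mul_assoc, mul_two, two_mul]
      noncomm_ring
    exact sub_eq_zero.1 (h2 _ this)
  have h4 : ∀ m : ℕ, u * P ^ (m + 1) - P ^ (m + 1) * u = (m + 1 : ℕ) * (P ^ m * a) := by
    intro m
    induction m with
    | zero => simp [ha]
    | succ m ih =>
      have e : u * P ^ (m + 1 + 1) - P ^ (m + 1 + 1) * u =
          (u * P ^ (m + 1) - P ^ (m + 1) * u) * P + P ^ (m + 1) * a := by
        rw [ha, pow_succ P (m + 1)]; noncomm_ring
      rw [e, ih, mul_assoc, mul_assoc, h3.eq, ← mul_assoc (P ^ m), ← pow_succ]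
      push_cast
      noncomm_ring
  obtain ⟨m, rfl⟩ := Nat.exists_eq_succ_of_ne_zero hn
  have h5 := h4 m
  have hP' : P ^ (m + 1) = 1 := hP
  rw [hP', mul_one, one_mul, sub_self] at h5
  have h6 := hn' _ h5.symm
  have h7 : a = 0 := by
    have : P ^ (m + 1) * a = 0 := by rw [pow_succ', mul_assoc, h6, mul_zero]
    rwa [hP', one_mul] at this
  exact sub_eq_zero.1 h7

theorem quad_comm {L W : Type*} [Group L] [CommGroup W] (φ : L →* MulAut W) {q : ℕ}
    (hq2 : Nat.Coprime 2 q) (hW : ∀ w : W, ∃ k : ℕ, w ^ q ^ k = 1) (x ρ : L) {n : ℕ}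
    (hn : n ≠ 0) (hnq : Nat.Coprime n q) (hρ : φ ρ ^ n = 1)
    (hc1 : Commute (φ (x * ρ * x⁻¹)) (φ ρ)) (hc2 : Commute (φ (x⁻¹ * ρ * x)) (φ ρ))
    (hquad : ∀ w : W, φ x (φ x w * w⁻¹) = φ x w * w⁻¹) : Commute (φ x) (φ ρ) := by
  let E : MulAut W →* AddMonoid.End (Additive W) :=
    { toFun := fun g => MonoidHom.toAdditive g.toMonoidHom
      map_one' := rfl
      map_mul' := fun _ _ => rfl }
  have hE : ∀ (g : MulAut W) (v : W), E g (Additive.ofMul v) = Additive.ofMul (g v) :=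
    fun _ _ => rfl
  have hinj : Function.Injective E := by
    intro g h hgh
    ext v
    have := congrArg (fun f => f (Additive.ofMul v)) hgh
    exact this
  have hkill : ∀ m : ℕ, Nat.Coprime m q → ∀ a : AddMonoid.End (Additive W),
      (m : AddMonoid.End (Additive W)) * a = 0 → a = 0 := by
    intro m hm a h
    ext v
    have h1 : m • (a v) = 0 := by
      have := congrArg (fun f => f v) h
      simpa using this
    obtain ⟨k, hk⟩ := hW (a v).toMul
    have h2 : (q ^ k) • (a v) = 0 := hk
    have h3 := Nat.dvd_gcd (addOrderOf_dvd_of_nsmul_eq_zero h1)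
      (addOrderOf_dvd_of_nsmul_eq_zero h2)
    rw [(Nat.Coprime.pow_right k hm).gcd_eq_one, Nat.dvd_one, AddMonoid.addOrderOf_eq_one_iff] at h3
    simpa using h3
  set u : AddMonoid.End (Additive W) := E (φ x) - 1 with hu
  have hX : E (φ x) = 1 + u := by rw [hu]; abel
  have huu : u * u = 0 := by
    ext v
    have h := hquad v.toMul
    have h' : E (φ x) (u v) = u v := by
      have : u v = Additive.ofMul (φ x v.toMul * v.toMul⁻¹) := by
        rw [hu, ofMul_mul, ofMul_inv, ← sub_eq_add_neg]
        rfl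
      rw [this, hE, h]
    change u (u v) = 0
    conv_lhs => rw [hu]
    change E (φ x) (u v) - u v = 0
    rw [h', sub_self]
  have hXi : E (φ x⁻¹) = 1 - u := by
    have h1 : E (φ x⁻¹) * E (φ x) = 1 := by
      rw [← map_mul, ← map_mul, inv_mul_cancel, map_one, map_one]
    have h2 : E (φ x) * (1 - u) = 1 := by
      rw [hX]
      have : (1 + u) * (1 - u) = 1 - u * u := by rw [add_mul, one_mul, mul_sub, mul_one]; abel
      rw [this, huu, sub_zero]
    calc E (φ x⁻¹) = E (φ x⁻¹) * (E (φ x) * (1 - u)) := by rw [h2, mul_one]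
      _ = 1 - u := by rw [← mul_assoc, h1, one_mul]
  have hP : E (φ ρ) ^ n = 1 := by rw [← map_pow, hρ, map_one]
  have h1 : Commute ((1 + u) * E (φ ρ) * (1 - u)) (E (φ ρ)) := by
    rw [← hX, ← hXi, ← map_mul, ← map_mul, ← map_mul, ← map_mul]
    exact hc1.map E
  have h2 : Commute ((1 - u) * E (φ ρ) * (1 + u)) (E (φ ρ)) := by
    rw [← hX, ← hXi, ← map_mul, ← map_mul, ← map_mul, ← map_mul]
    exact hc2.map E
  have := ring_quad hn hP (fun a ha => hkill 2 hq2 a (by exact_mod_cast ha)) (hkill n hnq) h1 h2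
  apply hinj
  rw [map_mul, map_mul, hX, add_mul, mul_add, this.eq, one_mul, mul_one]

/-- stability lemma -/
theorem stability {L : Type*} [Group L] [Finite L] (hL : IsEPPOGroup L) [Group.IsSolvable L]
    {q : ℕ} (hq : q.Prime) (hq2 : q ≠ 2) (K W : Subgroup L) [K.Normal] [W.Normal]
    (hK : IsPGroup q K) (hKmax : ∀ M : Subgroup L, M.Normal → IsPGroup q M → M ≤ K)
    (hWK : W ≤ K) (hW : W ≠ ⊥) (hKW : ∀ k ∈ K, ∀ w ∈ W, k * w = w * k)
    {x : L} (hx : ∃ k : ℕ, x ^ q ^ k = 1)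
    (hquad : ∀ w ∈ W, Commute x (x * w * x⁻¹ * w⁻¹)) : x ∈ K := by
  have : Fact q.Prime := ⟨hq⟩
  by_contra hxK
  have hWq : IsPGroup q W := hK.to_le hWK
  have hC : centralizer (W : Set L) ≤ K :=
    hKmax _ inferInstance (centralizer_pgroup hL hq hW hWq)
  have hKC : K ≤ centralizer (W : Set L) := fun k hk =>
    mem_centralizer_iff.2 fun w hw => (hKW k hk w hw).symm
  have hX : IsEPPOGroup (L ⧸ K) := eppo_surj hL _ (QuotientGroup.mk'_surjective K)
  have : Nontrivial (L ⧸ K) :=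
    ⟨QuotientGroup.mk x, 1, by rwa [Ne, QuotientGroup.eq_one_iff]⟩
  obtain ⟨A, hA, hA1, hAab, r, hr, hAr⟩ := exists_abelian_normal_pgroup (L ⧸ K) hX
  have hrq : r ≠ q := by
    rintro rfl
    have h1 : IsPGroup r (A.comap (QuotientGroup.mk' K)) := by
      refine hAr.comap_of_ker_isPGroup _ ?_
      rw [QuotientGroup.ker_mk']
      exact hK
    have h2 := hKmax _ (hA.comap _) h1
    apply hA1
    rw [eq_bot_iff]
    intro a ha
    obtain ⟨a, rfl⟩ := QuotientGroup.mk_surjective a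
    rw [mem_bot, QuotientGroup.eq_one_iff]
    exact h2 ha
  obtain ⟨a, ha, ha1⟩ := (Subgroup.bot_or_exists_ne_one A).resolve_left hA1
  obtain ⟨ρ, rfl⟩ := QuotientGroup.mk_surjective a
  obtain ⟨k, hk⟩ := isPGroup_sub_iff.1 hAr _ ha
  have hcomm : ∀ a b : W, a * b = b * a := fun a b =>
    Subtype.ext (hKW a.1 (hWK a.2) b.1 b.2)
  let _ : CommGroup W := { (inferInstance : Group W) with mul_comm := hcomm }
  let φ : L →* MulAut W := MulAut.conjNormal
  have hφK : ∀ g ∈ K, φ g = 1 := by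
    intro g hg
    ext w
    change g * w.1 * g⁻¹ = w.1
    rw [hKW g hg w.1 w.2, mul_inv_cancel_right]
  have hφcomm : ∀ g h : L, Commute (QuotientGroup.mk g : L ⧸ K) (QuotientGroup.mk h) →
      Commute (φ g) (φ h) := by
    intro g h hgh
    have h1 : (g * h)⁻¹ * (h * g) ∈ K := QuotientGroup.eq.1 hgh
    have h2 := hφK _ h1
    rw [map_mul, map_inv, inv_mul_eq_one, map_mul, map_mul] at h2
    exact h2
  have hres := quad_comm φ (q := q) ((Nat.coprime_primes Nat.prime_two hq).2 (Ne.symm hq2))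
    (fun w => by
      obtain ⟨k, hk⟩ := isPGroup_sub_iff.1 hWq w.1 w.2
      exact ⟨k, Subtype.ext (by simpa using hk)⟩) x ρ (n := r ^ k)
    (pow_ne_zero _ hr.ne_zero) (Nat.Coprime.pow_left _ ((Nat.coprime_primes hr hq).2 hrq))
    (by
      rw [← map_pow]
      apply hφK
      rw [← QuotientGroup.eq_one_iff, QuotientGroup.mk_pow]
      exact hk)
    (hφcomm _ _ (hAab _ (by simpa using hA.conj_mem _ ha (QuotientGroup.mk x)) _ ha))
    (hφcomm _ _ (hAab _ (by simpa using hA.conj_mem _ ha (QuotientGroup.mk x)⁻¹) _ ha))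
    (fun w => by
      apply Subtype.ext
      change x * (x * w.1 * x⁻¹ * w.1⁻¹) * x⁻¹ = x * w.1 * x⁻¹ * w.1⁻¹
      rw [(hquad w.1 w.2).eq, mul_inv_cancel_right])
  -- x commutes with ρ modulo K
  have h3 : (ρ * x)⁻¹ * (x * ρ) ∈ K := by
    apply hC
    rw [mem_centralizer_iff]
    intro w hw
    have h4 : φ ((ρ * x)⁻¹ * (x * ρ)) = 1 := by
      rw [map_mul, map_inv, inv_mul_eq_one, map_mul, map_mul]
      exact hres.eq.symm
    have h5 := congrArg (fun f : MulAut W => (f ⟨w, hw⟩).1) h4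
    have h6 : ((ρ * x)⁻¹ * (x * ρ)) * w * ((ρ * x)⁻¹ * (x * ρ))⁻¹ = w := h5
    rw [mul_inv_eq_iff_eq_mul] at h6
    exact h6.symm
  have h4 : Commute (QuotientGroup.mk ρ : L ⧸ K) (QuotientGroup.mk x) := QuotientGroup.eq.2 h3
  obtain ⟨m, hm⟩ := eppo_comm hX hr ha1 hk h4
  obtain ⟨l, hl⟩ := hx
  have h5 : (QuotientGroup.mk x : L ⧸ K) ^ q ^ l = 1 := by
    rw [← QuotientGroup.mk_pow, hl]; rfl
  have h6 := pp_one hr hq hrq hm h5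
  rw [QuotientGroup.eq_one_iff] at h6
  exact hxK h6

end EP

namespace EP

universe u
open Subgroup

/-- members of the defining family of the Glauberman–Solomon type subgroup -/
def Mem {G : Type*} [Group G] (S A : Subgroup G) : Prop :=
  A ≤ S ∧ (∀ s ∈ S, ∀ a ∈ A, s * a * s⁻¹ ∈ A) ∧ (∀ a ∈ A, ∀ b ∈ A, Commute a b) ∧
    ∀ x ∈ S, (∀ a ∈ A, Commute x (x * a * x⁻¹ * a⁻¹)) → ∀ a ∈ A, Commute x a

/-- the Glauberman–Solomon type subgroup -/
def DD {G : Type*} [Group G] (S : Subgroup G) : Subgroup G := sSup {A | Mem S A}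

theorem Mem.le_DD {G : Type*} [Group G] {S A : Subgroup G} (h : Mem S A) : A ≤ DD S :=
  le_sSup h

/-- an element of an abelian subgroup normalised by `a` acts quadratically on `a` -/
theorem quad_of_norm {G : Type*} [Group G] {A : Subgroup G} (hab : ∀ a ∈ A, ∀ b ∈ A, Commute a b)
    {x a : G} (hx : x ∈ A) (ha : a * x * a⁻¹ ∈ A) : Commute x (x * a * x⁻¹ * a⁻¹) := by
  have : x * a * x⁻¹ * a⁻¹ = x * (a * x * a⁻¹)⁻¹ := by group
  rw [this]
  exact (Commute.refl x).mul_right (hab _ hx _ (inv_mem ha))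

theorem Mem.commute {G : Type*} [Group G] {S A B : Subgroup G} (hA : Mem S A) (hB : Mem S B)
    {a b : G} (ha : a ∈ A) (hb : b ∈ B) : Commute a b :=
  hB.2.2.2 a (hA.1 ha) (fun c hc => quad_of_norm hA.2.2.1 ha (hA.2.1 c (hB.1 hc) a ha)) b hb

theorem commute_sSup {G : Type*} [Group G] {F : Set (Subgroup G)} {x : G}
    (h : ∀ A ∈ F, ∀ a ∈ A, Commute x a) {a : G} (ha : a ∈ sSup F) : Commute x a := by
  have : sSup F ≤ centralizer {x} := by
    refine sSup_le fun A hA a ha => ?_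
    rw [mem_centralizer_singleton_iff]
    exact (h A hA a ha).symm.eq
  have h2 := this ha
  rw [mem_centralizer_singleton_iff] at h2
  exact (show Commute a x from h2).symm

theorem conj_sSup {G : Type*} [Group G] {F : Set (Subgroup G)} {s : G}
    (h : ∀ A ∈ F, ∀ a ∈ A, s * a * s⁻¹ ∈ sSup F) {a : G} (ha : a ∈ sSup F) :
    s * a * s⁻¹ ∈ sSup F := by
  have : sSup F ≤ (sSup F).comap (MulAut.conj s).toMonoidHom := by
    refine sSup_le fun A hA a ha => ?_
    exact h A hA a ha
  exact this ha

theorem DD_mem {G : Type*} [Group G] (S : Subgroup G) : Mem S (DD S) := by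
  refine ⟨sSup_le fun A hA => hA.1, ?_, ?_, ?_⟩
  · intro s hs a ha
    exact conj_sSup (fun A hA a ha => (le_sSup hA : A ≤ _) (hA.2.1 s hs a ha)) ha
  · intro a ha b hb
    refine commute_sSup (fun B hB b hb => ?_) hb
    exact (commute_sSup (fun A hA a ha => (Mem.commute hA hB ha hb).symm) ha).symm
  · intro x hx hquad a ha
    refine commute_sSup (fun A hA a ha => ?_) ha
    exact hA.2.2.2 x hx (fun a ha => hquad a ((le_sSup hA : A ≤ _) ha)) a ha

theorem center_mem {G : Type*} [Group G] (S : Subgroup G) :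
    Mem S (S ⊓ centralizer (S : Set G)) := by
  have hc : ∀ x ∈ S, ∀ a ∈ S ⊓ centralizer (S : Set G), Commute x a := fun x hx a ha =>
    mem_centralizer_iff.1 ha.2 x hx
  refine ⟨inf_le_left, ?_, ?_, fun x hx _ a ha => hc x hx a ha⟩
  · intro s hs a ha
    rw [(hc s hs a ha).eq, mul_inv_cancel_right]
    exact ha
  · intro a ha b hb
    exact hc a ha.1 b hb

theorem center_ne_bot {G : Type*} [Group G] [Finite G] {q : ℕ} (hq : q.Prime) {S : Subgroup G}
    (hS : IsPGroup q S) (h : S ≠ ⊥) : S ⊓ centralizer (S : Set G) ≠ ⊥ := by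
  have : Fact q.Prime := ⟨hq⟩
  have : Nontrivial S := (Subgroup.nontrivial_iff_ne_bot S).2 h
  have := hS.center_nontrivial
  obtain ⟨z, hz⟩ := exists_ne (1 : Subgroup.center S)
  intro hb
  have : z.1.1 ∈ S ⊓ centralizer (S : Set G) := by
    refine ⟨z.1.2, mem_centralizer_iff.2 fun s hs => ?_⟩
    exact congrArg Subtype.val (mem_center_iff.1 z.2 ⟨s, hs⟩)
  rw [hb, mem_bot] at this
  exact hz (Subtype.ext (Subtype.ext this))

theorem DD_ne_bot {G : Type*} [Group G] [Finite G] {q : ℕ} (hq : q.Prime) {S : Subgroup G}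
    (hS : IsPGroup q S) (h : S ≠ ⊥) : DD S ≠ ⊥ := by
  intro hb
  have := (center_mem S).le_DD
  rw [hb, le_bot_iff] at this
  exact center_ne_bot hq hS h this

theorem Mem.map {G G' : Type*} [Group G] [Group G'] (f : G →* G') (hf : Function.Injective f)
    {S A : Subgroup G} (h : Mem S A) : Mem (S.map f) (A.map f) := by
  refine ⟨Subgroup.map_mono h.1, ?_, ?_, ?_⟩
  · rintro _ ⟨s, hs, rfl⟩ _ ⟨a, ha, rfl⟩
    exact ⟨s * a * s⁻¹, h.2.1 s hs a ha, by simp⟩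
  · rintro _ ⟨s, hs, rfl⟩ _ ⟨a, ha, rfl⟩
    exact (h.2.2.1 s hs a ha).map f
  · rintro _ ⟨x, hx, rfl⟩ hquad _ ⟨a, ha, rfl⟩
    refine (h.2.2.2 x hx (fun a ha => ?_) a ha).map f
    have := hquad (f a) ⟨a, ha, rfl⟩
    rw [← map_inv, ← map_inv, ← map_mul, ← map_mul, ← map_mul] at this
    exact hf (by rw [map_mul, map_mul f _ x]; exact this)

theorem Mem.comap {G G' : Type*} [Group G] [Group G'] (f : G →* G') (hf : Function.Injective f)
    {S A : Subgroup G} (h : Mem (S.map f) (A.map f)) : Mem S A := by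
  have hm : ∀ {B : Subgroup G} {x : G}, f x ∈ B.map f ↔ x ∈ B := fun {B x} =>
    Subgroup.mem_map_iff_mem hf
  refine ⟨?_, ?_, ?_, ?_⟩
  · intro a ha
    exact hm.1 (h.1 (hm.2 ha))
  · intro s hs a ha
    have := h.2.1 _ (hm.2 hs) _ (hm.2 ha)
    rw [← map_inv, ← map_mul, ← map_mul] at this
    exact hm.1 this
  · intro a ha b hb
    have := (h.2.2.1 _ (hm.2 ha) _ (hm.2 hb)).eq
    rw [← map_mul, ← map_mul] at this
    exact hf this
  · intro x hx hquad a ha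
    have := h.2.2.2 _ (hm.2 hx) ?_ _ (hm.2 ha)
    · have := this.eq
      rw [← map_mul, ← map_mul] at this
      exact hf this
    · rintro _ ⟨a, ha, rfl⟩
      have := (hquad a ha).map f
      simpa using this

theorem DD_map {G G' : Type*} [Group G] [Group G'] (f : G →* G') (hf : Function.Injective f)
    (S : Subgroup G) : DD (S.map f) = (DD S).map f := by
  apply le_antisymm
  · refine sSup_le fun A hA => ?_
    have hAr : A = (A.comap f).map f := by
      rw [Subgroup.map_comap_eq_self]
      exact hA.1.trans (Subgroup.map_le_range f S)
    have hA' : Mem (S.map f) A := hA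
    rw [hAr] at hA' ⊢
    exact Subgroup.map_mono (Mem.comap f hf hA').le_DD
  · exact ((DD_mem S).map f hf).le_DD

/-- Theorem N, in a group `L`. -/
theorem DD_normal {L : Type*} [Group L] [Finite L] (hL : IsEPPOGroup L) [Group.IsSolvable L]
    {q : ℕ} (hq : q.Prime) (hq2 : q ≠ 2) (A : Subgroup L) [A.Normal] (hA : A ≠ ⊥)
    (hAq : IsPGroup q A) (T : Sylow q L) : (DD (T : Subgroup L)).Normal := by
  have : Fact q.Prime := ⟨hq⟩
  set K := (T : Subgroup L).normalCore with hKdef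
  have hKT : K ≤ T := Subgroup.normalCore_le _
  have hKn : K.Normal := inferInstance
  have hK : IsPGroup q K := T.2.to_le hKT
  have hKmax : ∀ M : Subgroup L, M.Normal → IsPGroup q M → M ≤ K := fun M hM hMq =>
    Subgroup.normal_le_normalCore.2 (hMq.le_sylow_of_normal T)
  have hK1 : K ≠ ⊥ := fun h => hA (le_bot_iff.1 (h ▸ hKmax A ‹_› hAq))
  set D := DD (T : Subgroup L) with hD
  have hDm : Mem (T : Subgroup L) D := DD_mem _
  have hTq : ∀ x ∈ (T : Subgroup L), ∃ k : ℕ, x ^ q ^ k = 1 := isPGroup_sub_iff.1 T.2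
  have hZn : (K ⊓ centralizer (K : Set L)).Normal := inferInstance
  have hDK : D ≤ K := by
    intro d hd
    refine stability hL hq hq2 K (K ⊓ centralizer (K : Set L)) hK hKmax inf_le_left
      (center_ne_bot hq hK hK1) (fun k hk w hw => mem_centralizer_iff.1 hw.2 k hk)
      (hTq d (hDm.1 hd)) ?_
    intro w hw
    exact quad_of_norm hDm.2.2.1 hd (hDm.2.1 w (hKT hw.1) d hd)
  -- D commutes with its conjugates
  have hcc : ∀ l : L, ∀ d ∈ D, ∀ e ∈ D, Commute (l * e * l⁻¹) d := by
    intro l d hd e he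
    refine hDm.2.2.2 _ (hKT (hKn.conj_mem e (hDK he) l)) ?_ d hd
    intro d hd
    have h1 : l⁻¹ * d * l ∈ (T : Subgroup L) := by
      have := hKn.conj_mem d (hDK hd) l⁻¹
      rw [inv_inv] at this
      exact hKT this
    have h2 : Commute e (e * (l⁻¹ * d * l) * e⁻¹ * (l⁻¹ * d * l)⁻¹) :=
      quad_of_norm hDm.2.2.1 he (hDm.2.1 _ h1 e he)
    have h3 := h2.map (MulAut.conj l).toMonoidHom
    have e1 : (MulAut.conj l).toMonoidHom e = l * e * l⁻¹ := rfl
    have e2 : (MulAut.conj l).toMonoidHom (e * (l⁻¹ * d * l) * e⁻¹ * (l⁻¹ * d * l)⁻¹) =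
        (l * e * l⁻¹) * d * (l * e * l⁻¹)⁻¹ * d⁻¹ := by
      change l * (e * (l⁻¹ * d * l) * e⁻¹ * (l⁻¹ * d * l)⁻¹) * l⁻¹ = _
      group
    rw [e1, e2] at h3
    exact h3
  set B := normalClosure (D : Set L) with hB
  have hDB : D ≤ B := le_normalClosure
  have hBK : B ≤ K := normalClosure_le_normal hDK
  have hBc : ∀ x : L, (∀ l : L, ∀ d ∈ D, Commute x (l * d * l⁻¹)) → ∀ b ∈ B, Commute x b := by
    intro x hx b hb
    have : B ≤ centralizer {x} := by
      rw [hB, normalClosure, closure_le]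
      intro y hy
      obtain ⟨d, hd, hdy⟩ := Group.mem_conjugatesOfSet_iff.1 hy
      obtain ⟨l, rfl⟩ := isConj_iff.1 hdy
      rw [SetLike.mem_coe, mem_centralizer_singleton_iff]
      exact (hx l d hd).symm.eq
    have h2 := this hb
    rw [mem_centralizer_singleton_iff] at h2
    exact (show Commute b x from h2).symm
  have hBab : ∀ a ∈ B, ∀ b ∈ B, Commute a b := by
    intro a ha b hb
    refine hBc a (fun l d hd => ?_) b hb
    refine (hBc _ (fun m e he => ?_) a ha).symm
    have h1 := (hcc (m⁻¹ * l) e he d hd).map (MulAut.conj m).toMonoidHom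
    have e1 : (MulAut.conj m).toMonoidHom (m⁻¹ * l * d * (m⁻¹ * l)⁻¹) = l * d * l⁻¹ := by
      change m * (m⁻¹ * l * d * (m⁻¹ * l)⁻¹) * m⁻¹ = _
      group
    rw [e1] at h1
    exact h1
  have hBm : Mem (T : Subgroup L) B := by
    refine ⟨hBK.trans hKT, fun s _ a ha => normalClosure_normal.conj_mem a ha s, hBab, ?_⟩
    intro x hx hquad
    have hxK : x ∈ K := by
      have hn : (B ⊓ (K ⊓ centralizer (K : Set L))).Normal := inferInstance
      refine stability hL hq hq2 K (B ⊓ (K ⊓ centralizer (K : Set L))) hK hKmax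
        (inf_le_right.trans inf_le_left) ?_
        (fun k hk w hw => mem_centralizer_iff.1 hw.2.2 k hk) (hTq x hx)
        (fun w hw => hquad w hw.1)
      intro hbot
      have hT1 : (T : Subgroup L) ≠ ⊥ := fun h => hK1 (le_bot_iff.1 (h ▸ hKT))
      apply center_ne_bot hq T.2 hT1
      rw [← le_bot_iff, ← hbot]
      intro z hz
      have hzD : z ∈ D := (center_mem (T : Subgroup L)).le_DD hz
      exact ⟨hDB hzD, hDK hzD, mem_centralizer_iff.2 fun k hk =>
        mem_centralizer_iff.1 hz.2 k (hKT hk)⟩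
    refine hBc x fun l d hd => ?_
    have h1 : l⁻¹ * x * l ∈ (T : Subgroup L) := by
      have := hKn.conj_mem x hxK l⁻¹
      rw [inv_inv] at this
      exact hKT this
    have h2 := hDm.2.2.2 _ h1 ?_ d hd
    · have h3 := h2.map (MulAut.conj l).toMonoidHom
      have e1 : (MulAut.conj l).toMonoidHom (l⁻¹ * x * l) = x := by
        change l * (l⁻¹ * x * l) * l⁻¹ = _
        group
      rw [e1] at h3
      exact h3
    · intro a ha
      have h4 := hquad (l * a * l⁻¹) (normalClosure_normal.conj_mem a (hDB ha) l)
      have h5 := h4.map (MulAut.conj l⁻¹).toMonoidHom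
      have e1 : (MulAut.conj l⁻¹).toMonoidHom x = l⁻¹ * x * l := by
        change l⁻¹ * x * l⁻¹⁻¹ = _
        group
      have e2 : (MulAut.conj l⁻¹).toMonoidHom (x * (l * a * l⁻¹) * x⁻¹ * (l * a * l⁻¹)⁻¹) =
          (l⁻¹ * x * l) * a * (l⁻¹ * x * l)⁻¹ * a⁻¹ := by
        change l⁻¹ * (x * (l * a * l⁻¹) * x⁻¹ * (l * a * l⁻¹)⁻¹) * l⁻¹⁻¹ = _
        group
      rw [e1, e2] at h5
      exact h5
  have : D = B := le_antisymm hDB hBm.le_DD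
  rw [this]
  exact normalClosure_normal

end EP

namespace EP

universe u
open Subgroup
open scoped commutatorElement

theorem normalizer_of_conj {H : Type*} [Group H] [Finite H] {S : Subgroup H} {g : H}
    (h : ∀ s ∈ S, g * s * g⁻¹ ∈ S) : g ∈ normalizer (S : Set H) := by
  rw [mem_normalizer_iff_map_conj_eq]
  refine Subgroup.eq_of_le_of_card_ge ?_ ?_
  · rintro _ ⟨s, hs, rfl⟩
    exact h s hs
  · rw [Subgroup.card_map_of_injective (MulAut.conj g).injective]

theorem map_conj_of_norm {H : Type*} [Group H] {S : Subgroup H} {g : H}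
    (h : g ∈ normalizer (S : Set H)) : S.map (MulAut.conj g).toMonoidHom = S :=
  mem_normalizer_iff_map_conj_eq.1 h

theorem DD_conj {H : Type*} [Group H] (S : Subgroup H) (g : H) :
    DD (S.map (MulAut.conj g).toMonoidHom) = (DD S).map (MulAut.conj g).toMonoidHom :=
  DD_map _ (MulAut.conj g).injective S

theorem norm_le_norm_DD {H : Type*} [Group H] (S : Subgroup H) :
    normalizer (S : Set H) ≤ normalizer (DD S : Set H) := by
  intro g hg
  rw [mem_normalizer_iff_map_conj_eq]
  have := DD_conj S g
  rw [map_conj_of_norm hg] at this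
  exact this.symm

section
variable {H : Type*} [Group H] [Finite H] {q : ℕ}

theorem thmN (hE : IsEPPOGroup H) (hq : q.Prime) (hq2 : q ≠ 2)
    (hs : ∀ A : Subgroup H, A ≠ ⊥ → IsPGroup q A → Group.IsSolvable (normalizer (A : Set H)))
    {A : Subgroup H} (hA : A ≠ ⊥) (hAq : IsPGroup q A) (T : Sylow q (normalizer (A : Set H))) :
    normalizer (A : Set H) ≤
      normalizer (DD ((T : Subgroup _).map (normalizer (A : Set H)).subtype) : Set H) := by
  have := hs A hA hAq
  have hle : A ≤ normalizer (A : Set H) := le_normalizer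
  have hn : (DD (T : Subgroup (normalizer (A : Set H)))).Normal := by
    refine DD_normal (eppo_sub hE _) hq hq2 (A.subgroupOf (normalizer (A : Set H))) ?_ ?_ T
    · intro h
      rw [subgroupOf_eq_bot, disjoint_iff, inf_eq_left.2 hle] at h
      exact hA h
    · exact hAq.comap_subtype
  intro l hl
  rw [DD_map _ (Subgroup.subtype_injective _)]
  apply normalizer_of_conj
  rintro _ ⟨d, hd, rfl⟩
  exact ⟨_, hn.conj_mem d hd ⟨l, hl⟩, rfl⟩

theorem exists_normalizer_grow (hq : q.Prime) {S T : Subgroup H} (hS : IsPGroup q S) (hTS : T < S) :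
    T < S ⊓ normalizer (T : Set H) := by
  have : Fact q.Prime := ⟨hq⟩
  have := hS.isNilpotent
  have hnc := Group.normalizerCondition_of_isNilpotent (G := S)
  have h1 : T.subgroupOf S < ⊤ := by
    rw [lt_top_iff_ne_top, Ne, subgroupOf_eq_top]
    exact not_le_of_gt hTS
  obtain ⟨hle, hne⟩ := (SetLike.lt_iff_le_and_exists.1 (hnc _ h1))
  obtain ⟨x, hx, hxT⟩ := hne
  refine lt_of_le_of_ne (le_inf hTS.le le_normalizer) ?_
  intro heq
  apply hxT
  rw [mem_subgroupOf, heq]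
  refine ⟨x.2, ?_⟩
  rw [mem_normalizer_iff] at hx
  apply normalizer_of_conj
  intro s hs
  exact (hx ⟨s, hTS.le hs⟩).1 hs

theorem card_lt_of_lt {S T : Subgroup H} (h : T < S) : Nat.card T < Nat.card S := by
  by_contra hc
  exact h.ne (Subgroup.eq_of_le_of_card_ge h.le (not_lt.1 hc))

/-- extend a `q`-subgroup of `L` to Sylow subgroups of `L` and of `H`. -/
theorem extend_sylow (L P : Subgroup H) (hP : IsPGroup q P) (hPL : P ≤ L) :
    ∃ (T : Sylow q L) (S : Sylow q H), P ≤ (T : Subgroup L).map L.subtype ∧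
      (T : Subgroup L).map L.subtype ≤ S := by
  have h1 : IsPGroup q (P.subgroupOf L) := hP.comap_subtype
  obtain ⟨T, hT⟩ := h1.exists_le_sylow
  obtain ⟨S, hS⟩ := (T.2.map L.subtype).exists_le_sylow
  refine ⟨T, S, ?_, hS⟩
  intro x hx
  exact ⟨⟨x, hPL hx⟩, hT (by rwa [mem_subgroupOf]), rfl⟩

theorem sub_lemma (hE : IsEPPOGroup H) (hq : q.Prime) (hq2 : q ≠ 2)
    (hs : ∀ A : Subgroup H, A ≠ ⊥ → IsPGroup q A → Group.IsSolvable (normalizer (A : Set H)))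
    (c : ℕ) (hc1 : 0 < c)
    (hc : ∀ S S' : Sylow q H, c < Nat.card (S ⊓ S' : Subgroup H) →
      DD (S : Subgroup H) = DD (S' : Subgroup H)) (n : ℕ) :
    ∀ (A : Subgroup H), A ≠ ⊥ → IsPGroup q A → ∀ (T : Sylow q (normalizer (A : Set H)))
      (S : Sylow q H), (T : Subgroup _).map (normalizer (A : Set H)).subtype ≤ S →
      c < Nat.card ((T : Subgroup _).map (normalizer (A : Set H)).subtype) →
      Nat.card H - Nat.card ((T : Subgroup _).map (normalizer (A : Set H)).subtype) = n →
      normalizer (A : Set H) ≤ normalizer (DD (S : Subgroup H) : Set H) := by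
  induction n using Nat.strong_induction_on with
  | _ n ih =>
  intro A hA hAq T S hTS hcT hn
  have hN := thmN hE hq hq2 hs hA hAq T
  set T0 := (T : Subgroup _).map (normalizer (A : Set H)).subtype with hT0
  have hT0q : IsPGroup q T0 := T.2.map _
  rcases eq_or_lt_of_le hTS with heq | hlt
  · rw [← heq]; exact hN
  · have hT01 : T0 ≠ ⊥ := by
      intro h
      rw [h, Subgroup.card_bot] at hcT
      omega
    have hg := exists_normalizer_grow hq S.2 hlt
    have hNq : IsPGroup q ((S : Subgroup H) ⊓ normalizer (T0 : Set H) : Subgroup H) :=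
      S.2.to_le inf_le_left
    obtain ⟨T', S', h1, h2⟩ := extend_sylow (normalizer (DD T0 : Set H))
      ((S : Subgroup H) ⊓ normalizer (T0 : Set H)) hNq (inf_le_right.trans (norm_le_norm_DD T0))
    have hcard := card_lt_of_lt hg
    have hcard1 := Subgroup.card_le_of_le h1
    have hcard2 := Subgroup.card_le_card_group
      ((T' : Subgroup _).map (normalizer (DD T0 : Set H)).subtype)
    have h3 := ih _ (by omega) (DD T0) (DD_ne_bot hq hT0q hT01) (hT0q.to_le (DD_mem T0).1) T' S' h2
      (by omega) rfl
    have h4 : DD (S : Subgroup H) = DD (S' : Subgroup H) := by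
      apply hc
      have := Subgroup.card_le_of_le
        (le_inf (inf_le_left : (S : Subgroup H) ⊓ normalizer (T0 : Set H) ≤ S) (h1.trans h2))
      omega
    rw [h4]
    exact hN.trans h3

theorem fusion (hE : IsEPPOGroup H) (hq : q.Prime) (hq2 : q ≠ 2)
    (hs : ∀ A : Subgroup H, A ≠ ⊥ → IsPGroup q A → Group.IsSolvable (normalizer (A : Set H)))
    (n : ℕ) : ∀ S S' : Sylow q H, (S ⊓ S' : Subgroup H) ≠ ⊥ →
      Nat.card H - Nat.card (S ⊓ S' : Subgroup H) = n →
      DD (S : Subgroup H) = DD (S' : Subgroup H) := by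
  have : Fact q.Prime := ⟨hq⟩
  induction n using Nat.strong_induction_on with
  | _ n ih =>
  intro S S' hne hn
  set P0 : Subgroup H := (S : Subgroup H) ⊓ S' with hP0
  have hP0q : IsPGroup q P0 := S.2.to_le inf_le_left
  have hc : ∀ S S' : Sylow q H, Nat.card P0 < Nat.card (S ⊓ S' : Subgroup H) →
      DD (S : Subgroup H) = DD (S' : Subgroup H) := by
    intro S1 S1' hlt
    have := Subgroup.card_le_card_group (S1 ⊓ S1' : Subgroup H)
    refine ih _ (by omega) S1 S1' ?_ rfl
    intro h
    rw [h, Subgroup.card_bot] at hlt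
    have : 0 < Nat.card P0 := Nat.card_pos
    omega
  rcases eq_or_lt_of_le (inf_le_left : P0 ≤ S) with heq | hlt
  · have h1 : (S : Subgroup H) ≤ S' := by rw [← heq]; exact inf_le_right
    have h2 := S.3 S'.2 h1
    rw [h2]
  rcases eq_or_lt_of_le (inf_le_right : P0 ≤ S') with heq | hlt'
  · have h1 : (S' : Subgroup H) ≤ S := by rw [← heq]; exact inf_le_left
    have h2 := S'.3 S.2 h1
    rw [h2]
  have g1 : P0 < (S : Subgroup H) ⊓ normalizer (P0 : Set H) := exists_normalizer_grow hq S.2 hlt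
  have g2 : P0 < (S' : Subgroup H) ⊓ normalizer (P0 : Set H) := exists_normalizer_grow hq S'.2 hlt'
  have c1 := card_lt_of_lt g1
  have c2 := card_lt_of_lt g2
  obtain ⟨T, S1, a1, a2⟩ := extend_sylow (q := q) (normalizer (P0 : Set H))
    ((S : Subgroup H) ⊓ normalizer (P0 : Set H)) (S.2.to_le inf_le_left) inf_le_right
  obtain ⟨T', S2, b1, b2⟩ := extend_sylow (q := q) (normalizer (P0 : Set H))
    ((S' : Subgroup H) ⊓ normalizer (P0 : Set H)) (S'.2.to_le inf_le_left) inf_le_right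
  obtain ⟨l, hl⟩ := MulAction.exists_smul_eq (normalizer (P0 : Set H)) T T'
  have e1 : DD (S : Subgroup H) = DD (S1 : Subgroup H) := by
    apply hc
    have := Subgroup.card_le_of_le
        (le_inf (inf_le_left : (S : Subgroup H) ⊓ normalizer (P0 : Set H) ≤ S) (a1.trans a2))
    omega
  have hsub := sub_lemma hE hq hq2 hs (Nat.card P0) Nat.card_pos hc _ P0 hne hP0q T S1 a2
    (by have := Subgroup.card_le_of_le a1; omega) rfl
  have e2 : DD ((l.1 • S1 : Sylow q H) : Subgroup H) = DD (S1 : Subgroup H) := by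
    have h1 : ((l.1 • S1 : Sylow q H) : Subgroup H) =
      (S1 : Subgroup H).map (MulAut.conj l.1).toMonoidHom := rfl
    rw [h1, DD_conj, map_conj_of_norm (hsub l.2)]
  have e3 : DD (S' : Subgroup H) = DD ((l.1 • S1 : Sylow q H) : Subgroup H) := by
    apply hc
    have hle : (S' : Subgroup H) ⊓ normalizer (P0 : Set H) ≤ (l.1 • S1 : Sylow q H) := by
      refine b1.trans ?_
      rw [← hl]
      rintro _ ⟨x, hx, rfl⟩
      obtain ⟨y, hy, rfl⟩ := (show x ∈ (T : Subgroup _).map (MulAut.conj l).toMonoidHom from hx)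
      exact ⟨y.1, a2 ⟨y, hy, rfl⟩, rfl⟩
    have := Subgroup.card_le_of_le
      (le_inf (inf_le_left : (S' : Subgroup H) ⊓ normalizer (P0 : Set H) ≤ S') hle)
    omega
  rw [e1, e3, e2]

/-- focal subgroup argument -/
theorem le_comm_of_control [Fact q.Prime] (hperf : commutator H = ⊤) (Q : Sylow q H)
    (M : Subgroup H) (hQM : (Q : Subgroup H) ≤ M)
    (hM : ∀ x ∈ (Q : Subgroup H), x ≠ 1 → ∀ g : H, g * x * g⁻¹ ∈ (Q : Subgroup H) → g ∈ M) :
    (Q : Subgroup H) ≤ ⁅M, M⁆ := by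
  have h := Subgroup.commutator_inf_eq_focalSubgroup Q
  rw [hperf, top_inf_eq] at h
  conv_lhs => rw [h]
  rw [focalSubgroup_def, closure_le]
  rintro g ⟨hg, x, hx, u, rfl⟩
  by_cases hx1 : x = 1
  · subst hx1
    rw [commutatorElement_one_left]
    exact one_mem _
  · refine commutator_mem_commutator (hQM hx) (hM x⁻¹ (inv_mem hx) (inv_ne_one.2 hx1) u ?_)
    have : u * x⁻¹ * u⁻¹ = x⁻¹ * ⁅x, u⁆ := by rw [commutatorElement_def]; group
    rw [this]
    exact mul_mem (inv_mem hx) hg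

theorem ne_of_focal [Fact q.Prime] (hperf : commutator H = ⊤) (Q : Sylow q H)
    (hQ : (Q : Subgroup H) ≠ ⊥)
    (hM : ∀ x ∈ (Q : Subgroup H), x ≠ 1 → ∀ g : H, g * x * g⁻¹ ∈ (Q : Subgroup H) →
      g ∈ normalizer (Q : Set H)) :
    normalizer (Q : Set H) ≠ (Q : Subgroup H) := by
  intro heq
  have h := le_comm_of_control hperf Q _ le_normalizer hM
  rw [show normalizer ((Q : Subgroup H) : Set H) = (Q : Subgroup H) from heq] at h
  have hsol : Group.IsSolvable (Q : Subgroup H) := solvable_of_pgroup (Fact.out) Q.2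
  have : Nontrivial (Q : Subgroup H) := (Subgroup.nontrivial_iff_ne_bot _).2 hQ
  have h1 := Group.IsSolvable.commutator_lt_top_of_nontrivial (Q : Subgroup H)
  have h2 : commutator (Q : Subgroup H) = ⊤ := by
    rw [eq_top_iff]
    intro x _
    have := h x.2
    rw [← Subgroup.map_subtype_commutator] at this
    obtain ⟨y, hy, hyx⟩ := this
    have : y = x := Subtype.ext hyx
    rwa [← this]
  exact h1.ne h2

end

end EP

namespace EP

universe u
open Subgroup
open scoped commutatorElement

theorem comm_le_cent {X : Type*} [Group X] (A : Subgroup X) [A.Normal] (hA : IsCyclic A) :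
    commutator X ≤ centralizer (A : Set X) := by
  have key : ∀ x : X, ∃ m : ℤ, ∀ a ∈ A, x * a * x⁻¹ = a ^ m := by
    intro x
    obtain ⟨m, hm⟩ := MonoidHom.map_cyclic (MulAut.conjNormal (H := A) x).toMonoidHom
    refine ⟨m, fun a ha => ?_⟩
    have := congrArg Subtype.val (hm ⟨a, ha⟩)
    simpa using this
  have key2 : ∀ x y : X, ∀ a ∈ A, (x * y) * a * (x * y)⁻¹ = (y * x) * a * (y * x)⁻¹ := by
    intro x y a ha
    obtain ⟨m, hm⟩ := key x
    obtain ⟨n, hn⟩ := key y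
    have h1 : (x * y) * a * (x * y)⁻¹ = x * (y * a * y⁻¹) * x⁻¹ := by group
    have h2 : (y * x) * a * (y * x)⁻¹ = y * (x * a * x⁻¹) * y⁻¹ := by group
    rw [h1, h2, hn a ha, hm a ha, hm _ (zpow_mem ha n), hn _ (zpow_mem ha m), ← zpow_mul,
      ← zpow_mul, mul_comm]
  rw [commutator_def, commutator_le]
  intro x _ y _
  rw [mem_centralizer_iff]
  intro a ha
  have ha' : y⁻¹ * x⁻¹ * a * (y⁻¹ * x⁻¹)⁻¹ ∈ A := Normal.conj_mem inferInstance a ha _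
  have h := key2 x y _ ha'
  have h3 : x * y * (y⁻¹ * x⁻¹ * a * (y⁻¹ * x⁻¹)⁻¹) * (x * y)⁻¹ = a := by group
  have h4 : y * x * (y⁻¹ * x⁻¹ * a * (y⁻¹ * x⁻¹)⁻¹) * (y * x)⁻¹ = ⁅y, x⁆ * a * ⁅y, x⁆⁻¹ := by
    rw [commutatorElement_def]; group
  rw [h3, h4] at h
  have h5 : ⁅x, y⁆ = ⁅y, x⁆⁻¹ := (commutatorElement_inv y x).symm
  rw [h5]
  have h6 : a * ⁅y, x⁆ = ⁅y, x⁆ * a := by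
    conv_lhs => rw [h]
    group
  calc a * ⁅y, x⁆⁻¹ = ⁅y, x⁆⁻¹ * (⁅y, x⁆ * a) * ⁅y, x⁆⁻¹ := by group
    _ = ⁅y, x⁆⁻¹ * (a * ⁅y, x⁆) * ⁅y, x⁆⁻¹ := by rw [h6]
    _ = _ := by group

theorem normal_of_le_comm {q : ℕ} (hq : q.Prime) {L : Type*} [Group L] [Finite L] (h : Hyp q L)
    [Group.IsSolvable L] (Q : Sylow q L) (hQ : (Q : Subgroup L) ≤ commutator L) :
    (Q : Subgroup L).Normal := by
  have : Fact q.Prime := ⟨hq⟩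
  have hKQ : (Q : Subgroup L).normalCore ≤ Q := normalCore_le _
  suffices (Q : Subgroup L) ≤ (Q : Subgroup L).normalCore by
    rw [le_antisymm this hKQ]; infer_instance
  by_cases htop : (Q : Subgroup L).normalCore = ⊤
  · rw [htop]; exact le_top
  have hN : Nontrivial (L ⧸ (Q : Subgroup L).normalCore) := by
    by_contra hc
    rw [not_nontrivial_iff_subsingleton] at hc
    exact htop (QuotientGroup.subsingleton_iff.1 hc)
  have hE : Hyp q (L ⧸ (Q : Subgroup L).normalCore) := h.quot _
  obtain ⟨A, hAn, hA1, hAc, r, hr, hAr⟩ := exists_abelian_normal_pgroup _ hE.2.1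
  by_cases hrq : r = q
  · subst hrq
    exfalso
    have h1 : IsPGroup r (A.comap (QuotientGroup.mk' (Q : Subgroup L).normalCore)) := by
      apply hAr.comap_of_ker_isPGroup
      rw [QuotientGroup.ker_mk']
      exact Q.2.to_le hKQ
    have h2 : A.comap (QuotientGroup.mk' (Q : Subgroup L).normalCore) ≤ (Q : Subgroup L) :=
      le_sup_right.trans (Q.3 (Q.2.to_sup_of_normal_right h1) le_sup_left).le
    have h3 : A.comap (QuotientGroup.mk' (Q : Subgroup L).normalCore) ≤ (Q : Subgroup L).normalCore :=
      (normal_le_normalCore).2 h2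
    apply hA1
    rw [eq_bot_iff, ← map_comap_eq_self_of_surjective (QuotientGroup.mk'_surjective _) A,
      map_le_iff_le_comap]
    intro x hx
    simpa using h3 hx
  · have hcyc := hE.2.2 r hr hrq A hAr
    have hC := comm_le_cent A hcyc
    have hCr := centralizer_pgroup hE.2.1 hr hA1 hAr
    intro x hx
    have hx1 : (QuotientGroup.mk' (Q : Subgroup L).normalCore) x ∈ centralizer (A : Set _) := by
      apply hC
      have := Subgroup.mem_map_of_mem (QuotientGroup.mk' (Q : Subgroup L).normalCore) (hQ hx)
      rw [_root_.commutator_def, map_commutator] at this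
      exact commutator_mono le_top le_top this
    obtain ⟨a, ha⟩ := isPGroup_sub_iff.1 hCr _ hx1
    obtain ⟨b, hb⟩ := isPGroup_sub_iff.1 Q.2 _ hx
    have := pp_one hr hq hrq ha (b := b) (by rw [← map_pow, hb, map_one])
    simpa using this

section
variable {H : Type u} [Group H] [Finite H] {q : ℕ}

/-- the local facts -/
structure Loc (H : Type*) [Group H] {p : ℕ} (A : Sylow p H) : Prop where
  ti : ∀ x ∈ (A : Subgroup H), x ≠ 1 → ∀ g : H, g * x * g⁻¹ ∈ (A : Subgroup H) →
    g ∈ normalizer (A : Set H)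
  cen : ∀ x ∈ (A : Subgroup H), x ≠ 1 → ∀ g : H, g * x = x * g → g ∈ (A : Subgroup H)
  ne : normalizer (A : Set H) ≠ (A : Subgroup H)

theorem norm_sol (hprop : ∀ K : Subgroup H, K ≠ ⊤ → Group.IsSolvable K)
    (hsimple : ∀ K : Subgroup H, K.Normal → K = ⊥ ∨ K = ⊤)
    (hns : ¬ Group.IsSolvable H) (hq : q.Prime) (A : Subgroup H) (hA : A ≠ ⊥) (hAq : IsPGroup q A) :
    Group.IsSolvable (normalizer (A : Set H)) := by
  apply hprop
  intro htop
  have hn : A.Normal := normalizer_eq_top_iff.1 htop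
  rcases hsimple A hn with h | h
  · exact hA h
  · apply hns
    have := solvable_of_pgroup hq hAq
    rw [h] at this
    exact Group.isSolvable_of_surjective (f := (topEquiv (G := H)).toMonoidHom) topEquiv.surjective

theorem cen_of_ti (hE : IsEPPOGroup H) [Fact q.Prime] (A : Sylow q H)
    (hti : ∀ x ∈ (A : Subgroup H), x ≠ 1 → ∀ g : H, g * x * g⁻¹ ∈ (A : Subgroup H) →
    g ∈ normalizer (A : Set H)) : ∀ x ∈ (A : Subgroup H), x ≠ 1 → ∀ g : H, g * x = x * g →
    g ∈ (A : Subgroup H) := by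
  intro x hx hx1 g hg
  have hn : g ∈ normalizer (A : Set H) := hti x hx hx1 g (by rw [hg]; simpa using hx)
  obtain ⟨k, hk⟩ := isPGroup_sub_iff.1 A.2 x hx
  obtain ⟨m, hm⟩ := eppo_comm hE Fact.out hx1 hk (show Commute x g from hg.symm)
  have hz : IsPGroup q (zpowers g) := by
    rw [isPGroup_sub_iff]
    rintro _ ⟨i, rfl⟩
    refine ⟨m, ?_⟩
    simp only
    rw [← zpow_natCast, ← zpow_mul, mul_comm, zpow_mul, zpow_natCast, hm, one_zpow]
  have h1 := hz.inf_normalizer_sylow A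
  have h2 : g ∈ zpowers g ⊓ normalizer (A : Set H) := ⟨mem_zpowers g, hn⟩
  exact (h1 ▸ h2).2

theorem loc_all (h : Hyp q H) (hq : q.Prime) (hperf : commutator H = ⊤)
    (hprop : ∀ K : Subgroup H, K ≠ ⊤ → Group.IsSolvable K)
    (hsimple : ∀ K : Subgroup H, K.Normal → K = ⊥ ∨ K = ⊤)
    (hns : ¬ Group.IsSolvable H) {p : ℕ} [Fact p.Prime] (A : Sylow p H)
    (hA : (A : Subgroup H) ≠ ⊥) : Loc H A := by
  have hp : p.Prime := Fact.out
  suffices hti : ∀ x ∈ (A : Subgroup H), x ≠ 1 → ∀ g : H, g * x * g⁻¹ ∈ (A : Subgroup H) →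
      g ∈ normalizer (A : Set H) from
    ⟨hti, cen_of_ti h.2.1 A hti, ne_of_focal hperf A hA hti⟩
  by_cases hpq : p = q
  · subst hpq
    have hp2 : p ≠ 2 := by
      rintro rfl
      have hd : 2 ∣ Nat.card (A : Subgroup H) := by
        obtain ⟨n, hn⟩ := IsPGroup.iff_card.1 A.2
        rw [hn]
        refine dvd_pow_self _ ?_
        rintro rfl
        exact hA (Subgroup.eq_bot_of_card_eq _ (by simpa using hn))
      have := h.1
      rw [← Nat.not_even_iff_odd] at this
      exact this (even_iff_two_dvd.2 (hd.trans (Subgroup.card_subgroup_dvd_card _)))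
    set M := normalizer (DD (A : Subgroup H) : Set H) with hMdef
    have hs := fun B hB hBq => norm_sol hprop hsimple hns hq B hB hBq
    have hDq : IsPGroup p (DD (A : Subgroup H)) := A.2.to_le (DD_mem _).1
    have hMs : Group.IsSolvable M := hs _ (DD_ne_bot hq A.2 hA) hDq
    have hAM : (A : Subgroup H) ≤ M := le_normalizer.trans (norm_le_norm_DD _)
    have hM : ∀ x ∈ (A : Subgroup H), x ≠ 1 → ∀ g : H, g * x * g⁻¹ ∈ (A : Subgroup H) → g ∈ M := by
      intro x hx hx1 g hg
      have hco : ((MulAut.conj g • A : Sylow p H) : Subgroup H) =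
          (A : Subgroup H).map (MulAut.conj g).toMonoidHom := rfl
      have hne : ((A : Subgroup H) ⊓ ((MulAut.conj g • A : Sylow p H) : Subgroup H)) ≠ ⊥ := by
        intro hb
        have : g * x * g⁻¹ ∈ ((A : Subgroup H) ⊓ ((MulAut.conj g • A : Sylow p H) : Subgroup H)) :=
          ⟨hg, by rw [hco]; exact ⟨x, hx, by simp⟩⟩
        rw [hb, mem_bot] at this
        apply hx1
        simpa using this
      have hf := fusion h.2.1 hq hp2 hs _ A (MulAut.conj g • A) hne rfl
      rw [hco, DD_conj] at hf
      apply normalizer_of_conj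
      intro s hs
      rw [hf]
      exact ⟨s, hs, by simp⟩
    have hc := le_comm_of_control hperf A M hAM hM
    have hcM : ((A.subtype hAM : Sylow p M) : Subgroup M) ≤ commutator M := by
      intro x hx
      have hx' : (x : H) ∈ (A : Subgroup H) := hx
      have := hc hx'
      rw [← Subgroup.map_subtype_commutator] at this
      obtain ⟨y, hy, hyx⟩ := this
      have : y = x := Subtype.ext hyx
      rwa [← this]
    have hn := normal_of_le_comm hq (h.sub M) (A.subtype hAM) hcM
    intro x hx hx1 g hg
    have hgM := hM x hx hx1 g hg
    apply normalizer_of_conj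
    intro s hs
    have := hn.conj_mem ⟨s, hAM hs⟩ hs ⟨g, hgM⟩
    exact this
  · have hcyc := h.2.2 p hp hpq A A.2
    have hab : ∀ x ∈ (A : Subgroup H), ∀ y ∈ (A : Subgroup H), x * y = y * x := by
      intro x hx y hy
      have := hcyc.isMulCommutative.is_comm.comm (⟨x, hx⟩ : (A : Subgroup H)) ⟨y, hy⟩
      exact congrArg Subtype.val this
    -- the centralizer of a nontrivial element is A
    have hcen : ∀ x ∈ (A : Subgroup H), x ≠ 1 → ∀ g : H, g * x = x * g → g ∈ (A : Subgroup H) := by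
      intro x hx hx1 g hg
      have hz1 : zpowers x ≠ ⊥ := by simpa using hx1
      have hzA : zpowers x ≤ (A : Subgroup H) := by simpa using hx
      have hC := centralizer_pgroup h.2.1 hp hz1 (A.2.to_le hzA)
      have hAC : (A : Subgroup H) ≤ centralizer (zpowers x : Set H) := by
        intro y hy
        rw [mem_centralizer_iff]
        intro z hz
        exact hab z (hzA hz) y hy
      have := A.3 hC hAC
      rw [← this]
      rw [mem_centralizer_iff]
      rintro _ ⟨i, rfl⟩
      exact ((show Commute g x from hg).zpow_right i).symm
    intro x hx hx1 g hg
    apply normalizer_of_conj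
    intro s hs
    have hgx1 : g * x * g⁻¹ ≠ 1 := by simpa using hx1
    refine hcen _ hg hgx1 _ ?_
    have := hab s hs x hx
    calc g * s * g⁻¹ * (g * x * g⁻¹) = g * (s * x) * g⁻¹ := by group
      _ = g * (x * s) * g⁻¹ := by rw [this]
      _ = _ := by group

end
end EP

namespace EP
open Finset

/-- combinatorial data extracted from the character table -/
structure CD (ι I : Type*) [Fintype I] (L : ι → Type*) [∀ i, Group (L i)] [∀ i, Fintype (L i)] where
  bar : I → I
  one : I
  d : ∀ i, L i → I → ℤ
  e : ι → ℕ
  n : ι → ℕ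
  r : ∀ i, L i → L i → Prop
  T : ι → I → ℝ
  bar_bar : ∀ χ, bar (bar χ) = χ
  bar_one : bar one = one
  bar_fix : ∀ χ, bar χ = χ → χ = one
  d_triv : ∀ i χ, d i 1 χ = 0
  d_one : ∀ i φ, φ ≠ 1 → d i φ one = 1
  d_inv : ∀ i φ χ, d i φ⁻¹ χ = d i φ (bar χ)
  inner_r : ∀ i φ ψ, φ ≠ 1 → ψ ≠ 1 → r i φ ψ → ∑ χ, d i φ χ * d i ψ χ = e i + 1
  inner_nr : ∀ i φ ψ, φ ≠ 1 → ψ ≠ 1 → ¬ r i φ ψ → ∑ χ, d i φ χ * d i ψ χ = e i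
  cross : ∀ i j φ ψ, i ≠ j → ∑ χ, d i φ χ * d j ψ χ = 0
  r_refl : ∀ i φ, r i φ φ
  r_symm : ∀ i φ ψ, r i φ ψ → r i ψ φ
  r_trans : ∀ i φ ψ θ, r i φ ψ → r i ψ θ → r i φ θ
  r_one : ∀ i φ, r i φ 1 → φ = 1
  nr_inv : ∀ i φ, φ ≠ 1 → ¬ r i φ φ⁻¹
  orb : ∀ i φ, φ ≠ 1 → Nat.card {ψ // r i φ ψ} = e i
  e_ge : ∀ i, 3 ≤ e i
  nL : ∀ i, Nontrivial (L i)
  kn : ∀ i, Fintype.card (L i) ≤ n i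
  T_nonneg : ∀ i χ, 0 ≤ T i χ
  T_ge : ∀ i χ, ((Fintype.card (L i) : ℝ) * ∑ φ, (d i φ χ : ℝ) ^ 2 - (∑ φ, (d i φ χ : ℝ)) ^ 2) ≤
    T i χ * ((e i : ℝ) * Fintype.card (L i))
  k_far : ∀ i j, i ≠ j → Fintype.card (L i) ≤ Fintype.card (L j) →
    Fintype.card (L i) + 2 ≤ Fintype.card (L j)

namespace CD
variable {ι I : Type*} [Fintype I] {L : ι → Type*} [∀ i, Group (L i)]
  [∀ i, Fintype (L i)] (c : CD ι I L)

open Classical in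
theorem two_le {f : I → ℤ} {a b : I} (hab : a ≠ b) : f a ^ 2 + f b ^ 2 ≤ ∑ χ, f χ ^ 2 := by
  rw [← Finset.sum_pair (f := fun χ => f χ ^ 2) hab]
  exact Finset.sum_le_sum_of_subset_of_nonneg (subset_univ _) fun _ _ _ => sq_nonneg _

open Classical in
theorem three_le {f : I → ℤ} {a b x : I} (hab : a ≠ b) (hax : x ≠ a) (hbx : x ≠ b) :
    f x ^ 2 + (f a ^ 2 + f b ^ 2) ≤ ∑ χ, f χ ^ 2 := by
  rw [← Finset.sum_pair (f := fun χ => f χ ^ 2) hab,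
    ← Finset.sum_insert (s := {a, b}) (a := x) (f := fun χ => f χ ^ 2) (by simp [hax, hbx])]
  exact Finset.sum_le_sum_of_subset_of_nonneg (subset_univ _) fun _ _ _ => sq_nonneg _

/-- odd part -/
def v (i : ι) (φ : L i) (χ : I) : ℤ := c.d i φ χ - c.d i φ (c.bar χ)

theorem v_bar (i : ι) (φ : L i) (χ : I) : c.v i φ (c.bar χ) = - c.v i φ χ := by
  simp [v, c.bar_bar]

theorem v_eq (i : ι) (φ : L i) (χ : I) : c.v i φ χ = c.d i φ χ - c.d i φ⁻¹ χ := by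
  simp [v, c.d_inv]

theorem sum_v (i : ι) (φ : L i) (h : φ ≠ 1) : ∑ χ, c.v i φ χ ^ 2 = 2 := by
  have h' : φ⁻¹ ≠ 1 := inv_ne_one.2 h
  have h1 := c.inner_r i φ φ h h (c.r_refl _ _)
  have h2 := c.inner_nr i φ φ⁻¹ h h' (c.nr_inv i φ h)
  have h3 := c.inner_r i φ⁻¹ φ⁻¹ h' h' (c.r_refl _ _)
  have : ∀ χ, c.v i φ χ ^ 2 = c.d i φ χ * c.d i φ χ - 2 * (c.d i φ χ * c.d i φ⁻¹ χ) +
      c.d i φ⁻¹ χ * c.d i φ⁻¹ χ := fun χ => by rw [v_eq]; ring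
  simp only [this, sum_add_distrib, sum_sub_distrib, ← mul_sum, h1, h2, h3]
  ring

theorem v_pos_struct (i : ι) (φ : L i) (h : φ ≠ 1) (X : I) (hX : 0 < c.v i φ X) :
    c.v i φ X = 1 ∧ c.v i φ (c.bar X) = -1 ∧ c.bar X ≠ X ∧
      ∀ χ, χ ≠ X → χ ≠ c.bar X → c.v i φ χ = 0 := by
  have hs := c.sum_v i φ h
  have hb := c.v_bar i φ X
  have hne : c.bar X ≠ X := by
    intro hh
    rw [hh] at hb
    omega
  have h2 := two_le (f := c.v i φ) hne.symm
  rw [hs, hb] at h2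
  have h1 : c.v i φ X = 1 := by nlinarith
  refine ⟨h1, by rw [hb, h1], hne, fun χ h3 h4 => ?_⟩
  have h5 := three_le (f := c.v i φ) hne.symm h3 h4
  rw [hs, hb, h1] at h5
  have : c.v i φ χ ^ 2 = 0 := le_antisymm (by linarith) (sq_nonneg _)
  exact pow_eq_zero_iff (two_ne_zero) |>.1 this

theorem exX (i : ι) (φ : L i) (h : φ ≠ 1) : ∃ X, 0 < c.v i φ X := by
  by_contra hc
  push Not at hc
  have hs := c.sum_v i φ h
  have : ∀ χ, c.v i φ χ = 0 := by
    intro χ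
    have h1 := hc χ
    have h2 := hc (c.bar χ)
    rw [v_bar] at h2
    omega
  simp [this] at hs

open Classical in
/-- the exceptional character -/
noncomputable def X (i : ι) (φ : L i) : I := if h : φ ≠ 1 then (c.exX i φ h).choose else c.one

variable {i j : ι} {φ ψ : L i}

theorem X_pos (h : φ ≠ 1) : 0 < c.v i φ (c.X i φ) := by
  rw [X, dif_pos h]
  exact (c.exX i φ h).choose_spec

theorem vX (h : φ ≠ 1) : c.v i φ (c.X i φ) = 1 := (c.v_pos_struct i φ h _ (c.X_pos h)).1
theorem vXb (h : φ ≠ 1) : c.v i φ (c.bar (c.X i φ)) = -1 :=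
  (c.v_pos_struct i φ h _ (c.X_pos h)).2.1
theorem Xb_ne (h : φ ≠ 1) : c.bar (c.X i φ) ≠ c.X i φ :=
  (c.v_pos_struct i φ h _ (c.X_pos h)).2.2.1
theorem v_zero (h : φ ≠ 1) {χ : I} (h1 : χ ≠ c.X i φ) (h2 : χ ≠ c.bar (c.X i φ)) :
    c.v i φ χ = 0 := (c.v_pos_struct i φ h _ (c.X_pos h)).2.2.2 χ h1 h2

theorem X_inv (h : φ ≠ 1) : c.X i φ⁻¹ = c.bar (c.X i φ) := by
  have h' : φ⁻¹ ≠ 1 := inv_ne_one.2 h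
  have h1 := c.vX h'
  have h2 : c.v i φ⁻¹ (c.X i φ⁻¹) = - c.v i φ (c.X i φ⁻¹) := by
    rw [v_eq, v_eq, inv_inv]; ring
  by_contra hc
  by_cases h3 : c.X i φ⁻¹ = c.X i φ
  · rw [h3, c.vX h] at h2
    rw [h3] at h1
    omega
  · rw [c.v_zero h h3 hc] at h2
    omega

open Classical in
/-- pairing with the odd vector -/
theorem pair_v (h : φ ≠ 1) (f : I → ℤ) :
    ∑ χ, f χ * c.v i φ χ = f (c.X i φ) - f (c.bar (c.X i φ)) := by
  rw [← Finset.sum_subset (subset_univ ({c.X i φ, c.bar (c.X i φ)} : Finset I)),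
    sum_pair (c.Xb_ne h).symm, c.vX h, c.vXb h]
  · ring
  · intro χ _ hχ
    simp only [mem_insert, mem_singleton, not_or] at hχ
    rw [c.v_zero h hχ.1 hχ.2, mul_zero]

theorem X_ne_one (h : φ ≠ 1) : c.X i φ ≠ c.one := by
  intro hh
  have := c.Xb_ne h
  rw [hh, c.bar_one] at this
  exact this rfl

theorem X_eq_imp (h : φ ≠ 1) (h' : ψ ≠ 1) (he : c.X i φ = c.X i ψ) : c.r i φ ψ := by
  by_contra hr
  have h1 := c.pair_v h (c.v i ψ)
  rw [he, c.vX h', c.vXb h'] at h1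
  have hi := inv_ne_one.2 h
  have hi' := inv_ne_one.2 h'
  have e1 := c.inner_nr i φ ψ h h' hr
  have key : ∀ a b : L i, a ≠ 1 → b ≠ 1 → (c.e i : ℤ) ≤ ∑ χ, c.d i a χ * c.d i b χ ∧
      ∑ χ, c.d i a χ * c.d i b χ ≤ c.e i + 1 := by
    intro a b ha hb
    by_cases hab : c.r i a b
    · rw [c.inner_r i a b ha hb hab]; omega
    · rw [c.inner_nr i a b ha hb hab]; omega
  have : ∀ χ, c.v i ψ χ * c.v i φ χ = c.d i φ χ * c.d i ψ χ - c.d i φ χ * c.d i ψ⁻¹ χ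
      - c.d i φ⁻¹ χ * c.d i ψ χ + c.d i φ⁻¹ χ * c.d i ψ⁻¹ χ := fun χ => by rw [v_eq, v_eq]; ring
  simp only [this, sum_add_distrib, sum_sub_distrib, e1] at h1
  have k1 := key φ ψ⁻¹ h hi'
  have k2 := key φ⁻¹ ψ hi h'
  have k3 := key φ⁻¹ ψ⁻¹ hi hi'
  omega

theorem X_cross (hij : i ≠ j) {φ : L i} {ψ : L j} (h : φ ≠ 1) (h' : ψ ≠ 1) :
    c.X i φ ≠ c.X j ψ := by
  intro he
  have h1 := c.pair_v h (c.v j ψ)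
  rw [he, c.vX h', c.vXb h'] at h1
  have : ∀ χ, c.v j ψ χ * c.v i φ χ = c.d i φ χ * c.d j ψ χ - c.d i φ χ * c.d j ψ⁻¹ χ
      - c.d i φ⁻¹ χ * c.d j ψ χ + c.d i φ⁻¹ χ * c.d j ψ⁻¹ χ := fun χ => by rw [v_eq, v_eq]; ring
  simp only [this, sum_add_distrib, sum_sub_distrib, c.cross i j _ _ hij] at h1
  omega

theorem X_cross_bar (hij : i ≠ j) {φ : L i} {ψ : L j} (h : φ ≠ 1) (h' : ψ ≠ 1) :
    c.X i φ ≠ c.bar (c.X j ψ) := by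
  rw [← c.X_inv h']
  exact c.X_cross hij h (inv_ne_one.2 h')

/-- constancy on other families -/
theorem d_const (hij : i ≠ j) {ψ : L i} {φ φ' : L j} (h : ψ ≠ 1) (h1 : φ ≠ 1) (h2 : φ' ≠ 1) :
    c.d j φ (c.X i ψ) = c.d j φ' (c.X i ψ) := by
  by_contra hne
  have hi := inv_ne_one.2 h1
  set X := c.X i ψ with hX
  set w : I → ℤ := fun χ => c.d j φ χ - c.d j φ' χ with hw
  have hz : ∀ φ : L j, φ ≠ 1 → c.d j φ (c.bar X) = c.d j φ X := by
    intro φ hφ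
    have := c.v_zero hφ (c.X_cross hij h hφ) (c.X_cross_bar hij h hφ)
    rw [v] at this
    rw [← hX] at this
    omega
  have hwb : w (c.bar X) = w X := by simp only [hw]; rw [hz φ h1, hz φ' h2]
  have hwX : w X ≠ 0 := by simp only [hw]; omega
  have hw2 : ∑ χ, w χ ^ 2 ≤ 2 := by
    have : ∀ χ, w χ ^ 2 = c.d j φ χ * c.d j φ χ - 2 * (c.d j φ χ * c.d j φ' χ) +
      c.d j φ' χ * c.d j φ' χ := fun χ => by simp only [hw]; ring
    simp only [this, sum_add_distrib, sum_sub_distrib, ← mul_sum,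
      c.inner_r j φ φ h1 h1 (c.r_refl _ _), c.inner_r j φ' φ' h2 h2 (c.r_refl _ _)]
    by_cases hr : c.r j φ φ'
    · rw [c.inner_r j φ φ' h1 h2 hr]; omega
    · rw [c.inner_nr j φ φ' h1 h2 hr]; omega
  have hbX : c.bar X ≠ X := c.Xb_ne h
  have hwX2 : 1 ≤ w X ^ 2 := by
    have : 0 < w X ^ 2 := by positivity
    omega
  have hw0 : ∀ χ, χ ≠ X → χ ≠ c.bar X → w χ = 0 := by
    intro χ a b
    have h5 := three_le (f := w) hbX.symm a b
    rw [hwb] at h5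
    have : w χ ^ 2 = 0 := le_antisymm (by linarith) (sq_nonneg _)
    exact pow_eq_zero_iff (two_ne_zero) |>.1 this
  have hr : ¬ c.r j φ φ' := by
    intro hr
    have : ∑ χ, w χ ^ 2 = 0 := by
      have : ∀ χ, w χ ^ 2 = c.d j φ χ * c.d j φ χ - 2 * (c.d j φ χ * c.d j φ' χ) +
        c.d j φ' χ * c.d j φ' χ := fun χ => by simp only [hw]; ring
      simp only [this, sum_add_distrib, sum_sub_distrib, ← mul_sum,
        c.inner_r j φ φ h1 h1 (c.r_refl _ _), c.inner_r j φ' φ' h2 h2 (c.r_refl _ _),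
        c.inner_r j φ φ' h1 h2 hr]
      ring
    have h5 := two_le (f := w) hbX.symm
    have := sq_nonneg (w (c.bar X))
    linarith
  have hp := c.pair_v h1 w
  have hY := c.X_cross hij h h1
  have hY' := c.X_cross_bar hij h h1
  rw [← hX] at hY hY'
  have a1 : w (c.X j φ) = 0 := hw0 _ hY.symm (by
    intro hh; apply hY'; rw [hh, c.bar_bar])
  have a2 : w (c.bar (c.X j φ)) = 0 := hw0 _ hY'.symm (by
    intro hh; apply hY; rw [← c.bar_bar X, ← hh, c.bar_bar])
  rw [a1, a2] at hp
  have : ∀ χ, w χ * c.v j φ χ = c.d j φ χ * c.d j φ χ - c.d j φ χ * c.d j φ' χ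
      - c.d j φ χ * c.d j φ⁻¹ χ + c.d j φ' χ * c.d j φ⁻¹ χ := fun χ => by
    rw [v_eq]; simp only [hw]; ring
  simp only [this, sum_add_distrib, sum_sub_distrib, c.inner_r j φ φ h1 h1 (c.r_refl _ _),
    c.inner_nr j φ φ' h1 h2 hr, c.inner_nr j φ φ⁻¹ h1 hi (c.nr_inv j φ h1)] at hp
  by_cases hr' : c.r j φ' φ⁻¹
  · rw [c.inner_r j _ _ h2 hi hr'] at hp; omega
  · rw [c.inner_nr j _ _ h2 hi hr'] at hp; omega

open Classical in
theorem even_sum (f : I → ℤ) (hf : ∀ χ, f (c.bar χ) = f χ) :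
    ((∑ χ, f χ : ℤ) : ZMod 2) = (f c.one : ZMod 2) := by
  rw [← Finset.add_sum_erase _ _ (mem_univ c.one)]
  push_cast
  have : ∑ χ ∈ univ.erase c.one, ((f χ : ℤ) : ZMod 2) = 0 := by
    refine Finset.sum_involution (fun χ _ => c.bar χ) ?_ ?_ ?_ ?_
    · intro χ _
      rw [hf, CharTwo.add_self_eq_zero]
    · intro χ hχ _ hh
      exact (mem_erase.1 hχ).1 (c.bar_fix χ hh)
    · intro χ hχ
      refine mem_erase.2 ⟨?_, mem_univ _⟩
      intro hh
      apply (mem_erase.1 hχ).1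
      rw [← c.bar_bar χ, hh, c.bar_one]
    · intro χ _
      exact c.bar_bar χ
  rw [this, add_zero]

open Classical in
theorem parity (hij : i ≠ j) {ψ : L i} {φ : L j} (h : ψ ≠ 1) (h' : φ ≠ 1)
    (h0 : c.d j φ (c.X i ψ) = 0) : c.d i ψ (c.X j φ) ≠ 0 := by
  intro h1
  set X := c.X i ψ with hX
  set Y := c.X j φ with hY
  have hXY : X ≠ Y := c.X_cross hij h h'
  set a : I → ℤ := fun χ => c.d i ψ χ - if χ = X then 1 else 0 with ha
  set b : I → ℤ := fun χ => c.d j φ χ - if χ = Y then 1 else 0 with hb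
  have sym : ∀ (l : ι) (θ : L l), θ ≠ 1 → ∀ χ,
      (c.d l θ (c.bar χ) - if c.bar χ = c.X l θ then 1 else 0) =
      c.d l θ χ - if χ = c.X l θ then 1 else 0 := by
    intro l θ hθ χ
    have hne := c.Xb_ne hθ
    have hvx := c.vX hθ
    have hv0 := @c.v_zero _ _ _ _ _ _ _ _ hθ χ
    rw [v] at hvx hv0
    by_cases c1 : χ = c.X l θ
    · subst c1
      rw [if_neg hne, if_pos rfl]
      omega
    · by_cases c2 : c.bar χ = c.X l θ
      · rw [if_pos c2, if_neg c1]
        rw [← c2, c.bar_bar] at hvx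
        omega
      · rw [if_neg c1, if_neg c2]
        have := hv0 c1 (fun hh => c2 (by rw [hh, c.bar_bar]))
        omega
  have hab := c.even_sum (fun χ => a χ * b χ) (fun χ => by
    simp only [ha, hb]; rw [sym i ψ h, sym j φ h'])
  have hs := c.cross i j ψ φ hij
  have hexp : ∀ χ, c.d i ψ χ * c.d j φ χ = a χ * b χ + ((if χ = X then b χ else 0) +
      ((if χ = Y then a χ else 0))) := by
    intro χ
    simp only [ha, hb]
    by_cases c1 : χ = X
    · subst c1
      rw [if_pos rfl, if_neg hXY, if_pos rfl, if_neg hXY]; ring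
    · rw [if_neg c1, if_neg c1]
      split_ifs <;> ring
  simp only [hexp, sum_add_distrib, sum_ite_eq', mem_univ, if_true] at hs
  have hbX : b X = 0 := by simp only [hb]; rw [if_neg hXY, h0]; rfl
  have haY : a Y = 0 := by simp only [ha]; rw [if_neg hXY.symm, h1]; rfl
  rw [hbX, haY, add_zero, add_zero] at hs
  rw [hs] at hab
  have o1 : a c.one = 1 := by
    simp only [ha]; rw [c.d_one i ψ h, if_neg (c.X_ne_one h).symm]; rfl
  have o2 : b c.one = 1 := by
    simp only [hb]; rw [c.d_one j φ h', if_neg (c.X_ne_one h').symm]; rfl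
  rw [o1, o2] at hab
  exact absurd hab (by decide)

end CD
end EP

namespace EP
open Finset
namespace CD
variable {ι I : Type*} [Fintype I] {L : ι → Type*} [∀ i, Group (L i)]
  [∀ i, Fintype (L i)] (c : CD ι I L) {i j : ι} {φ ψ : L i}

theorem d_r (h : φ ≠ 1) (h' : ψ ≠ 1) (hr : c.r i φ ψ) (χ : I) : c.d i φ χ = c.d i ψ χ := by
  have : ∑ χ, (c.d i φ χ - c.d i ψ χ) ^ 2 = 0 := by
    have : ∀ χ, (c.d i φ χ - c.d i ψ χ) ^ 2 = c.d i φ χ * c.d i φ χ -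
        2 * (c.d i φ χ * c.d i ψ χ) + c.d i ψ χ * c.d i ψ χ := fun χ => by ring
    simp only [this, sum_add_distrib, sum_sub_distrib, ← mul_sum,
        c.inner_r i φ φ h h (c.r_refl _ _), c.inner_r i ψ ψ h' h' (c.r_refl _ _),
        c.inner_r i φ ψ h h' hr]
    ring
  rw [sum_eq_zero_iff_of_nonneg (fun _ _ => sq_nonneg _)] at this
  have := this χ (mem_univ _)
  have := pow_eq_zero_iff (two_ne_zero) |>.1 this
  omega

theorem pairs {α : Type*} [Fintype α] (f : α → ℤ) :
    ∑ x, ∑ y, (f x - f y) ^ 2 = 2 * (Fintype.card α * ∑ x, f x ^ 2 - (∑ x, f x) ^ 2) := by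
  have : ∀ x y, (f x - f y) ^ 2 = f x ^ 2 - 2 * (f x * f y) + f y ^ 2 := fun x y => by ring
  simp only [this, sum_add_distrib, sum_sub_distrib, ← mul_sum, sum_const, card_univ, nsmul_eq_mul,
    ← sum_mul]
  ring

open Classical in
theorem bound_t (h : ψ ≠ 1) :
    (c.e i : ℤ) * (Fintype.card (L i) - c.e i) ≤
      Fintype.card (L i) * ∑ φ, c.d i φ (c.X i ψ) ^ 2 - (∑ φ, c.d i φ (c.X i ψ)) ^ 2 ∧
      2 * c.e i + 1 ≤ Fintype.card (L i) := by
  have hi := inv_ne_one.2 h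
  set X := c.X i ψ with hX
  set O := univ.filter (c.r i ψ) with hO
  set O' := univ.filter (c.r i ψ⁻¹) with hO'
  have cO : #O = c.e i := by rw [← c.orb i ψ h, Nat.card_eq_fintype_card, Fintype.card_subtype]
  have cO' : #O' = c.e i := by
    rw [← c.orb i ψ⁻¹ hi, Nat.card_eq_fintype_card, Fintype.card_subtype]
  have hd : Disjoint O O' := by
    rw [Finset.disjoint_left]
    intro x h1 h2
    simp only [hO, hO', mem_filter, mem_univ, true_and] at h1 h2
    exact c.nr_inv i ψ h (c.r_trans _ _ _ _ h1 (c.r_symm _ _ _ h2))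
  have hn1 : ∀ x θ : L i, x ≠ 1 → c.r i x θ → θ ≠ 1 := by
    rintro x θ hx hr rfl
    exact hx (c.r_one _ _ hr)
  have vO : ∀ x ∈ O, c.d i x X = c.d i ψ X := by
    intro x hx
    simp only [hO, mem_filter, mem_univ, true_and] at hx
    exact (c.d_r h (hn1 _ _ h hx) hx X).symm
  have vO' : ∀ x ∈ O', c.d i x X = c.d i ψ X - 1 := by
    intro x hx
    simp only [hO', mem_filter, mem_univ, true_and] at hx
    have h1 := (c.d_r hi (hn1 _ _ hi hx) hx X).symm
    have h2 := c.vX h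
    rw [v_eq, ← hX] at h2
    rw [h1]
    omega
  have row : ∀ x : L i, (c.e i : ℤ) ≤ ∑ y ∈ O ∪ O', (c.d i x X - c.d i y X) ^ 2 := by
    intro x
    rw [sum_union hd, sum_congr rfl (fun y hy => by rw [vO y hy]),
      sum_congr (s₁ := O') rfl (fun y hy => by rw [vO' y hy]), sum_const, sum_const, cO, cO',
      ← nsmul_add, nsmul_eq_mul]
    set z := c.d i x X - c.d i ψ X with hz
    have : c.d i x X - (c.d i ψ X - 1) = z + 1 := by omega
    rw [this]
    have h1 : 1 ≤ z ^ 2 + (z + 1) ^ 2 := by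
      rcases le_or_gt 0 z with h | h <;> nlinarith
    have h2 : (0 : ℤ) ≤ c.e i := by positivity
    nlinarith
  have cU : #(O ∪ O') = 2 * c.e i := by rw [card_union_of_disjoint hd, cO, cO']; ring
  have cW : #(O ∪ O')ᶜ + 2 * c.e i = Fintype.card (L i) := by
    rw [← cU, add_comm, card_add_card_compl]
  have hle1 : 2 * c.e i + 1 ≤ Fintype.card (L i) := by
    rw [← cU]
    have : (1 : L i) ∉ O ∪ O' := by
      simp only [hO, hO', mem_union, mem_filter, mem_univ, true_and, not_or]
      exact ⟨fun hh => hn1 _ _ h hh rfl, fun hh => hn1 _ _ hi hh rfl⟩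
    rw [← card_insert_of_notMem this]
    exact card_le_univ _
  refine ⟨?_, hle1⟩
  have hp := pairs (fun φ => c.d i φ X)
  have hsplit : ∀ x : L i, ∑ y, (c.d i x X - c.d i y X) ^ 2 =
      ∑ y ∈ O ∪ O', (c.d i x X - c.d i y X) ^ 2 + ∑ y ∈ (O ∪ O')ᶜ, (c.d i x X - c.d i y X) ^ 2 :=
    fun x => (sum_add_sum_compl _ _).symm
  simp only [hsplit, sum_add_distrib] at hp
  have b1 : (Fintype.card (L i) : ℤ) * c.e i ≤ ∑ x : L i, ∑ y ∈ O ∪ O', (c.d i x X - c.d i y X) ^ 2 := by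
    calc _ = ∑ x : L i, (c.e i : ℤ) := by simp
      _ ≤ _ := sum_le_sum fun x _ => row x
  have b2 : (#(O ∪ O')ᶜ : ℤ) * c.e i ≤ ∑ x : L i, ∑ y ∈ (O ∪ O')ᶜ, (c.d i x X - c.d i y X) ^ 2 := by
    rw [sum_comm]
    calc _ = ∑ x ∈ (O ∪ O')ᶜ, (c.e i : ℤ) := by simp
      _ ≤ ∑ x ∈ (O ∪ O')ᶜ, ∑ y ∈ O ∪ O', (c.d i x X - c.d i y X) ^ 2 := sum_le_sum fun x _ => row x
      _ ≤ ∑ x ∈ (O ∪ O')ᶜ, ∑ y, (c.d i x X - c.d i y X) ^ 2 := by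
        refine sum_le_sum fun x _ => ?_
        exact sum_le_sum_of_subset_of_nonneg (subset_univ _) fun _ _ _ => sq_nonneg _
      _ = _ := by
        refine sum_congr rfl fun x _ => sum_congr rfl fun y _ => by ring
  have cW' : (#(O ∪ O')ᶜ : ℤ) = Fintype.card (L i) - 2 * c.e i := by
    have := congrArg (Nat.cast (R := ℤ)) cW
    push_cast at this
    linarith
  rw [cW'] at b2
  nlinarith

open Classical in
theorem bound_s {χ : I} {a : ℤ} (ha : a ≠ 0) (h : ∀ φ : L i, φ ≠ 1 → c.d i φ χ = a) :
    (Fintype.card (L i) : ℤ) - 1 ≤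
      Fintype.card (L i) * ∑ φ, c.d i φ χ ^ 2 - (∑ φ, c.d i φ χ) ^ 2 := by
  have hc : (#(univ.erase (1 : L i)) : ℤ) = Fintype.card (L i) - 1 := by
    rw [card_erase_of_mem (mem_univ _), card_univ]
    have := Fintype.card_pos (α := L i)
    push_cast [this]
    rfl
  have h1 : ∑ φ, c.d i φ χ ^ 2 = (Fintype.card (L i) - 1) * a ^ 2 := by
    rw [← add_sum_erase _ _ (mem_univ (1 : L i)), c.d_triv,
      sum_congr rfl (fun φ hφ => by rw [h φ (mem_erase.1 hφ).1]), sum_const, nsmul_eq_mul, hc]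
    ring
  have h2 : ∑ φ, c.d i φ χ = (Fintype.card (L i) - 1) * a := by
    rw [← add_sum_erase _ _ (mem_univ (1 : L i)), c.d_triv,
      sum_congr rfl (fun φ hφ => by rw [h φ (mem_erase.1 hφ).1]), sum_const, nsmul_eq_mul, hc]
    ring
  rw [h1, h2]
  have h3 : (1 : ℤ) ≤ Fintype.card (L i) := by exact_mod_cast Fintype.card_pos (α := L i)
  have h4 : 1 ≤ a ^ 2 := by
    have : 0 < a ^ 2 := by positivity
    omega
  nlinarith

open Classical in
theorem img_card (i : ι) : Fintype.card (L i) - 1 ≤ #((univ.erase (1 : L i)).image (c.X i)) * c.e i := by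
  rw [← card_univ, ← card_erase_of_mem (mem_univ (1 : L i))]
  rw [mul_comm]
  refine card_le_mul_card_image _ _ ?_
  intro b hb
  obtain ⟨φ, hφ, rfl⟩ := mem_image.1 hb
  have h := (mem_erase.1 hφ).1
  rw [← c.orb i φ h, Nat.card_eq_fintype_card, Fintype.card_subtype]
  refine card_le_card ?_
  intro ψ hψ
  simp only [mem_filter, mem_erase, mem_univ, true_and, and_true] at hψ ⊢
  exact c.X_eq_imp h hψ.1 hψ.2.symm

open Classical in
theorem count {t : ι} {ψ : L t} (h : ψ ≠ 1) (U : Finset ι) (hU : ∀ i ∈ U, i ≠ t ∧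
    ∃ φ : L i, φ ≠ 1 ∧ c.d i φ (c.X t ψ) = 0) :
    ∑ i ∈ U, (#((univ.erase (1 : L i)).image (c.X i)) : ℤ) ≤ c.e t - 1 := by
  set img := fun i : ι => (univ.erase (1 : L i)).image (c.X i) with himg
  have mem_img : ∀ i χ, χ ∈ img i → ∃ φ : L i, φ ≠ 1 ∧ c.X i φ = χ := by
    intro i χ hχ
    obtain ⟨φ, hφ, rfl⟩ := mem_image.1 hχ
    exact ⟨φ, (mem_erase.1 hφ).1, rfl⟩
  have hdis : (U : Set ι).PairwiseDisjoint img := by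
    intro a _ b _ hab
    rw [Function.onFun, Finset.disjoint_left]
    intro χ h1 h2
    obtain ⟨φ, hφ, rfl⟩ := mem_img _ _ h1
    obtain ⟨φ', hφ', h3⟩ := mem_img _ _ h2
    exact c.X_cross hab hφ hφ' h3.symm
  set Z := U.biUnion img with hZ
  have cZ : #Z = ∑ i ∈ U, #(img i) := card_biUnion hdis
  have memZ : ∀ χ ∈ Z, ∃ i, ∃ φ : L i, i ≠ t ∧ φ ≠ 1 ∧ c.X i φ = χ ∧ c.d t ψ χ ≠ 0 := by
    intro χ hχ
    obtain ⟨i, hi, hχi⟩ := mem_biUnion.1 hχ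
    obtain ⟨φ, hφ, rfl⟩ := mem_img _ _ hχi
    obtain ⟨hit, φ', hφ', h0⟩ := hU i hi
    refine ⟨i, φ, hit, hφ, rfl, ?_⟩
    rw [c.d_const hit.symm h hφ' hφ] at h0
    exact c.parity hit.symm h hφ h0
  have hone : c.one ∉ Z := by
    intro hh
    obtain ⟨i, φ, hit, hφ, he, -⟩ := memZ _ hh
    exact c.X_ne_one hφ he
  have hX : c.X t ψ ∉ Z := by
    intro hh
    obtain ⟨i, φ, hit, hφ, he, -⟩ := memZ _ hh
    exact c.X_cross hit hφ h he
  have hXb : c.bar (c.X t ψ) ∉ Z := by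
    intro hh
    obtain ⟨i, φ, hit, hφ, he, -⟩ := memZ _ hh
    exact c.X_cross_bar hit hφ h he
  have hx1 := c.X_ne_one h
  have hxb1 : c.bar (c.X t ψ) ≠ c.one := by
    rw [← c.X_inv h]; exact c.X_ne_one (inv_ne_one.2 h)
  have hs := c.inner_r t ψ ψ h h (c.r_refl _ _)
  have hle : ∑ χ ∈ insert c.one (insert (c.X t ψ) (insert (c.bar (c.X t ψ)) Z)),
      c.d t ψ χ * c.d t ψ χ ≤ c.e t + 1 := by
    rw [← hs]
    exact sum_le_sum_of_subset_of_nonneg (subset_univ _) fun _ _ _ => mul_self_nonneg _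
  rw [sum_insert (by simp only [mem_insert, not_or]; exact ⟨hx1.symm, hxb1.symm, hone⟩),
    sum_insert (by simp only [mem_insert, not_or]; exact ⟨(c.Xb_ne h).symm, hX⟩),
    sum_insert hXb, c.d_one t ψ h] at hle
  have hZ1 : (#Z : ℤ) ≤ ∑ χ ∈ Z, c.d t ψ χ * c.d t ψ χ := by
    rw [card_eq_sum_ones]
    push_cast
    refine sum_le_sum fun χ hχ => ?_
    obtain ⟨i, φ, -, -, -, h0⟩ := memZ _ hχ
    have : 0 < c.d t ψ χ * c.d t ψ χ := mul_self_pos.2 h0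
    omega
  have hv := c.vX h
  rw [v] at hv
  have h2 : 1 ≤ c.d t ψ (c.X t ψ) * c.d t ψ (c.X t ψ) +
      c.d t ψ (c.bar (c.X t ψ)) * c.d t ψ (c.bar (c.X t ψ)) := by
    set z := c.d t ψ (c.bar (c.X t ψ))
    have : c.d t ψ (c.X t ψ) = z + 1 := by omega
    rw [this]
    rcases le_or_gt 0 z with h | h <;> nlinarith
  rw [cZ] at hZ1
  push_cast at hZ1
  linarith

theorem arith {k e m : ℝ} (he : 3 ≤ e) (hm : 2 ≤ m) (hk : k = m * e + 1) :
    (m + e) / k + (e - 1) / (k + 2) + 1 / (3 * k) < 1 := by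
  have hk0 : 0 < k := by nlinarith
  have h : (m + e) / k + (e - 1) / (k + 2) + 1 / (3 * k) =
      (3 * (m + e) * (k + 2) + 3 * (e - 1) * k + (k + 2)) / (3 * k * (k + 2)) := by
    field_simp
  rw [h, div_lt_one (by positivity)]
  obtain ⟨a, rfl⟩ : ∃ a, m = 2 + a := ⟨m - 2, by ring⟩
  obtain ⟨b, rfl⟩ : ∃ b, e = 3 + b := ⟨e - 3, by ring⟩
  have ha : 0 ≤ a := by linarith
  have hb : 0 ≤ b := by linarith
  subst hk
  have hab := mul_nonneg ha hb
  have : 0 ≤ a * (a * b) := mul_nonneg ha hab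
  have : 0 ≤ b * (a * b) := mul_nonneg hb hab
  have : 0 ≤ (a * b) * (a * b) := mul_nonneg hab hab
  nlinarith [sq_nonneg a, sq_nonneg b]

open Classical in
theorem final [Fintype ι] (q : ι) (hq : ∀ i, i ≠ q → c.n i = Fintype.card (L i))
    (hsum : ∀ χ, 0 ≤ ∑ i, (((c.n i : ℝ) - 1) / (c.e i * c.n i) - c.T i χ)) : False := by
  obtain ⟨t, -, ht⟩ := Finset.exists_min_image univ (fun i => Fintype.card (L i)) ⟨q, mem_univ q⟩
  have hN := c.nL
  obtain ⟨ψ, hψ⟩ := exists_ne (1 : L t)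
  choose p hp using fun i => exists_ne (1 : L i)
  set X := c.X t ψ with hX
  set k : ι → ℝ := fun i => Fintype.card (L i) with hk
  have kpos : ∀ i, 0 < k i := fun i => by
    simp only [hk]; exact_mod_cast Fintype.card_pos
  have epos : ∀ i, (3 : ℝ) ≤ c.e i := fun i => by exact_mod_cast c.e_ge i
  have kn : ∀ i, k i ≤ c.n i := fun i => by simp only [hk]; exact_mod_cast c.kn i
  have npos : ∀ i, (0 : ℝ) < c.n i := fun i => (kpos i).trans_le (kn i)
  set δ : ι → ℝ := fun i => (1 / k i - 1 / c.n i) / c.e i with hδ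
  have wsplit : ∀ i, ((c.n i : ℝ) - 1) / (c.e i * c.n i) = (k i - 1) / c.e i / k i + δ i := by
    intro i
    have := kpos i
    have := npos i
    have := epos i
    have : (0 : ℝ) < c.e i := by linarith
    simp only [hδ]
    field_simp
    ring
  have hT : ∀ i χ (a : ℝ), a ≤ (Fintype.card (L i) : ℝ) * ∑ φ, (c.d i φ χ : ℝ) ^ 2 -
      (∑ φ, (c.d i φ χ : ℝ)) ^ 2 → a / (c.e i) / k i ≤ c.T i χ := by
    intro i χ a ha
    have h1 := ha.trans (c.T_ge i χ)
    have := kpos i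
    have := epos i
    have : (0 : ℝ) < c.e i := by linarith
    rw [div_div, div_le_iff₀ (by positivity)]
    exact h1
  -- family t
  have Dt : ((c.n t : ℝ) - 1) / (c.e t * c.n t) - c.T t X ≤
      (k t - 1) / c.e t / k t - (1 - c.e t / k t) + δ t := by
    rw [wsplit]
    have h1 := (c.bound_t hψ).1
    rw [← hX] at h1
    have h2 : (c.e t : ℝ) * (k t - c.e t) ≤ (Fintype.card (L t) : ℝ) * ∑ φ, (c.d t φ X : ℝ) ^ 2 -
      (∑ φ, (c.d t φ X : ℝ)) ^ 2 := by
      have := (Int.cast_le (R := ℝ)).2 h1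
      push_cast at this
      exact this
    have h3 := hT _ _ _ h2
    have : (c.e t : ℝ) * (k t - c.e t) / c.e t / k t = 1 - c.e t / k t := by
      have := kpos t
      have := epos t
      have : (0 : ℝ) < c.e t := by linarith
      field_simp
    rw [this] at h3
    linarith
  set U := (univ.erase t).filter (fun i => c.d i (p i) X = 0) with hU
  have hcount := c.count hψ U (by
    intro i hi
    simp only [hU, mem_filter, mem_erase, mem_univ, and_true] at hi
    exact ⟨hi.1, p i, hp i, hi.2⟩)
  have Di : ∀ i, i ≠ t → ((c.n i : ℝ) - 1) / (c.e i * c.n i) - c.T i X ≤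
      δ i + if c.d i (p i) X = 0 then
        (#((univ.erase (1 : L i)).image (c.X i)) : ℝ) / (k t + 2) else 0 := by
    intro i hi
    rw [wsplit]
    have h0 := kpos i
    have h1 := epos i
    have h2 : (0 : ℝ) < c.e i := by linarith
    split_ifs with hd
    · have h3 := c.img_card i
      have h4 : k i - 1 ≤ #((univ.erase (1 : L i)).image (c.X i)) * c.e i := by
        have : (Fintype.card (L i) : ℝ) ≤ #((univ.erase (1 : L i)).image (c.X i)) * c.e i + 1 := by
          exact_mod_cast (by omega)
        simp only [hk]
        linarith
      have h5 : k t + 2 ≤ k i := by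
        have := c.k_far t i hi.symm (ht i (mem_univ _))
        simp only [hk]
        exact_mod_cast this
      have h6 : (k i - 1) / c.e i ≤ #((univ.erase (1 : L i)).image (c.X i)) := by
        rw [div_le_iff₀ h2]; exact h4
      have h7 : (k i - 1) / c.e i / k i ≤
          (#((univ.erase (1 : L i)).image (c.X i)) : ℝ) / (k t + 2) := by
        have := kpos t
        gcongr
      have := c.T_nonneg i X
      linarith
    · have h3 := c.bound_s (χ := X) hd (fun φ hφ => c.d_const hi.symm hψ hφ (hp i))
      have h4 : (k i - 1) ≤ (Fintype.card (L i) : ℝ) * ∑ φ, (c.d i φ X : ℝ) ^ 2 -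
        (∑ φ, (c.d i φ X : ℝ)) ^ 2 := by
        have := (Int.cast_le (R := ℝ)).2 h3
        push_cast at this
        exact this
      have h5 := hT _ _ _ h4
      linarith
  have hδs : ∑ i, δ i ≤ 1 / (3 * k t) := by
    rw [Finset.sum_eq_single q]
    · have h1 : k t ≤ k q := by
        have := ht q (mem_univ _)
        simp only [hk]
        exact_mod_cast this
      have h2 := kpos t
      have h3 := epos q
      have h4 := npos q
      simp only [hδ]
      calc (1 / k q - 1 / c.n q) / c.e q ≤ (1 / k t) / 3 := by
            have : 1 / k q ≤ 1 / k t := by gcongr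
            have : 0 ≤ 1 / (c.n q : ℝ) := by positivity
            have : (0 : ℝ) ≤ 1 / k t := by positivity
            gcongr
            linarith
        _ = _ := by field_simp
    · intro i _ hi
      simp only [hδ, hq i hi, hk]
      simp
    · intro h; exact absurd (mem_univ _) h
  have hs := hsum X
  rw [← add_sum_erase _ _ (mem_univ t)] at hs
  have hs2 := sum_le_sum (s := univ.erase t) fun i hi => Di i (mem_erase.1 hi).1
  rw [sum_add_distrib, ← sum_filter, ← hU, ← sum_div] at hs2
  rw [← add_sum_erase _ _ (mem_univ t)] at hδs
  have hc2 : ∑ i ∈ U, (#((univ.erase (1 : L i)).image (c.X i)) : ℝ) ≤ c.e t - 1 := by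
    exact_mod_cast hcount
  have hkt := kpos t
  have hc3 : (∑ i ∈ U, (#((univ.erase (1 : L i)).image (c.X i)) : ℝ)) / (k t + 2) ≤
      (c.e t - 1) / (k t + 2) := by gcongr
  have he := epos t
  have he0 : (0 : ℝ) < c.e t := by linarith
  have hb2 : 2 * (c.e t : ℝ) + 1 ≤ k t := by
    have := (c.bound_t hψ).2
    simp only [hk]
    exact_mod_cast this
  have hfin := arith (k := k t) (e := c.e t) (m := (k t - 1) / c.e t) he
    (by rw [le_div_iff₀ he0]; linarith) (by field_simp; ring)
  rw [add_div] at hfin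
  linarith

end CD
end EP

namespace EP
universe u
open Finset Representation
open scoped ComplexOrder

/-- irreducible characters -/
def IsIrrChar {H : Type u} [Group H] (χ : H → ℂ) : Prop :=
  ∃ (V : Type u) (_ : AddCommGroup V) (_ : Module ℂ V) (_ : FiniteDimensional ℂ V)
    (ρ : Representation ℂ H V), ρ.IsIrreducible ∧ χ = ρ.character

section
variable {H : Type u} [Group H] [Fintype H]

theorem cardH_ne : (Nat.card H : ℂ) ≠ 0 := by
  exact_mod_cast Nat.card_pos.ne'

theorem op_zero (f : H → ℂ) (hf : ∀ x g, f (g * x * g⁻¹) = f x)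
    (h0 : ∀ χ : H → ℂ, IsIrrChar χ → ∑ x, f x * χ x⁻¹ = 0) (n : ℕ) :
    ∀ (V : Type u) [AddCommGroup V] [Module ℂ V] [FiniteDimensional ℂ V]
      (ρ : Representation ℂ H V), Module.finrank ℂ V = n → ∑ x, f x • ρ x⁻¹ = 0 := by
  induction n using Nat.strong_induction_on with
  | _ n ih =>
  intro V _ _ _ ρ hn
  by_cases hirr : ρ.IsIrreducible
  · set T : V →ₗ[ℂ] V := ∑ x, f x • ρ x⁻¹ with hT
    have hcomm : ∀ (g : H) (v : V), T (ρ g v) = ρ g (T v) := by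
      intro g v
      simp only [hT, LinearMap.sum_apply, LinearMap.smul_apply, map_sum, map_smul]
      refine Fintype.sum_equiv (MulAut.conj g⁻¹).toEquiv _ _ fun x => ?_
      have e1 : (MulAut.conj g⁻¹).toEquiv x = g⁻¹ * x * g := by simp [MulAut.conj_apply]
      rw [e1]
      have e2 : f (g⁻¹ * x * g) = f x := by
        have := hf x g⁻¹
        rwa [inv_inv] at this
      rw [e2, ← Module.End.mul_apply, ← Module.End.mul_apply, ← map_mul, ← map_mul]
      congr 3
      group
    obtain ⟨a, ha⟩ := (IsIrreducible.algebraMap_intertwiningMap_bijective_of_isAlgClosed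
      (ρ := ρ)).2
      (T.intertwiningMap_of_isIntertwiningMap ρ ρ hcomm)
    have hTa : T = a • LinearMap.id := by
      ext v
      have := congrArg (fun S : IntertwiningMap ρ ρ => S.toLinearMap v) ha
      exact this.symm
    have htr : LinearMap.trace ℂ V T = 0 := by
      rw [hT, map_sum]
      simp only [map_smul, smul_eq_mul]
      exact h0 _ ⟨V, _, _, inferInstance, ρ, hirr, rfl⟩
    rw [hTa, map_smul, LinearMap.trace_id, smul_eq_mul] at htr
    rcases mul_eq_zero.1 htr with h | h
    · rw [hTa, h, zero_smul]
    · have hz : Module.finrank ℂ V = 0 := by exact_mod_cast h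
      have := Module.finrank_zero_iff.1 hz
      exact Subsingleton.elim _ _
  · by_cases hsub : Subsingleton V
    · exact Subsingleton.elim _ _
    have hnt : Nontrivial V := not_subsingleton_iff_nontrivial.1 hsub
    have hnt' : Nontrivial (Subrepresentation ρ) := by
      refine ⟨⊥, ⊤, fun h => ?_⟩
      have h1 : (⊥ : Submodule ℂ V) = ⊤ := congrArg Subrepresentation.toSubmodule h
      exact bot_ne_top h1
    have : ∃ W : Subrepresentation ρ, W ≠ ⊥ ∧ W ≠ ⊤ := by
      by_contra hc
      push Not at hc
      exact hirr ⟨fun W => or_iff_not_imp_left.2 (hc W)⟩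
    obtain ⟨W, hW1, hW2⟩ := this
    have : NeZero (Nat.card H : ℂ) := ⟨cardH_ne⟩
    have hss : ComplementedLattice (Subrepresentation ρ) :=
      inferInstanceAs (IsSemisimpleRepresentation ρ)
    obtain ⟨W', hW'⟩ := exists_isCompl W
    have key : ∀ U : Subrepresentation ρ, U ≠ ⊤ → ∀ v ∈ U.toSubmodule, (∑ x, f x • ρ x⁻¹) v = 0 := by
      intro U hU v hv
      have hlt : Module.finrank ℂ U.toSubmodule < n := by
        rw [← hn]
        apply Submodule.finrank_lt
        intro h
        exact hU (Subrepresentation.toSubmodule_injective h)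
      have h1 := ih _ hlt U.toSubmodule U.toRepresentation rfl
      have h2 := congrArg (fun S => ((S ⟨v, hv⟩ : U.toSubmodule) : V)) h1
      simp only [LinearMap.sum_apply, LinearMap.smul_apply, LinearMap.zero_apply] at h2 ⊢
      rw [AddSubmonoidClass.coe_finsetSum] at h2
      exact h2
    have hW'2 : W' ≠ ⊤ := by
      rintro rfl
      apply hW1
      have := hW'.inf_eq_bot
      rwa [inf_top_eq] at this
    have hsup : W.toSubmodule ⊔ W'.toSubmodule = ⊤ := congrArg Subrepresentation.toSubmodule hW'.sup_eq_top
    ext v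
    have hv : v ∈ W.toSubmodule ⊔ W'.toSubmodule := by rw [hsup]; trivial
    obtain ⟨a, ha, b, hb, rfl⟩ := Submodule.mem_sup.1 hv
    rw [map_add, key W hW2 a ha, key W' hW'2 b hb]
    simp

theorem complete (f : H → ℂ) (hf : ∀ x g, f (g * x * g⁻¹) = f x)
    (h0 : ∀ χ : H → ℂ, IsIrrChar χ → ∑ x, f x * χ x⁻¹ = 0) : f = 0 := by
  let σ : Representation ℂ H (H → ℂ) :=
    { toFun := fun g => LinearMap.funLeft ℂ ℂ (fun x => g⁻¹ * x)
      map_one' := by ext; simp [LinearMap.funLeft]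
      map_mul' := fun a b => by
        apply LinearMap.ext; intro v; funext x
        simp [LinearMap.funLeft, mul_assoc] }
  have h := op_zero f hf h0 _ (H → ℂ) σ rfl
  funext y
  classical
  have h1 := congrFun (congrArg (fun S => (S (Pi.single 1 1) : H → ℂ)) h) y⁻¹
  have h2 : (∑ x, f x • σ x⁻¹) (Pi.single 1 1) y⁻¹ = ∑ x, f x * (if x = y then 1 else 0) := by
    simp only [LinearMap.sum_apply, Finset.sum_apply, LinearMap.smul_apply, Pi.smul_apply, smul_eq_mul]
    refine sum_congr rfl fun x _ => ?_
    congr 1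
    change (Pi.single (1 : H) (1 : ℂ) : H → ℂ) (x⁻¹⁻¹ * y⁻¹) = _
    rw [inv_inv, Pi.single_apply, mul_inv_eq_one]
  have h3 : (∑ x, f x • σ x⁻¹) (Pi.single 1 1) y⁻¹ = 0 := h1
  rw [h2] at h3
  simpa using h3

theorem irr_orth {χ χ' : H → ℂ} (h : IsIrrChar χ) (h' : IsIrrChar χ') [Decidable (χ = χ')] :
    ∑ x, χ x * χ' x⁻¹ = if χ = χ' then (Nat.card H : ℂ) else 0 := by
  classical
  obtain ⟨V, _, _, _, ρ, hρ, rfl⟩ := h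
  obtain ⟨V', _, _, _, ρ', hρ', rfl⟩ := h'
  have hi : Invertible (Nat.card H : ℂ) := invertibleOfNonzero cardH_ne
  have key := char_orthonormal ρ ρ'
  have key' := char_orthonormal ρ ρ
  rw [if_pos ⟨Representation.Equiv.refl ρ⟩] at key'
  rw [inv_mul_eq_iff_eq_mul₀ cardH_ne] at key key'
  by_cases he : ρ.character = ρ'.character
  · rw [if_pos he, ← he, key']; simp
  · rw [if_neg he, key, if_neg, mul_zero]
    rintro ⟨φ⟩
    exact he (char_iso φ).symm

theorem irr_finite : {χ : H → ℂ | IsIrrChar χ}.Finite := by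
  have : LinearIndependent ℂ (fun χ : {χ : H → ℂ | IsIrrChar χ} => (χ : H → ℂ)) := by
    classical
    rw [linearIndependent_iff']
    intro s g hs i hi
    have h1 : ∑ x, (∑ χ ∈ s, g χ • (χ : H → ℂ)) x * (i : H → ℂ) x⁻¹ = 0 := by
      rw [hs]; simp
    have h2 : ∑ x, (∑ χ ∈ s, g χ • (χ : H → ℂ)) x * (i : H → ℂ) x⁻¹ =
        ∑ χ ∈ s, g χ * ∑ x, (χ : H → ℂ) x * (i : H → ℂ) x⁻¹ := by
      simp only [Finset.sum_apply, sum_mul, mul_sum, Pi.smul_apply, smul_eq_mul]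
      rw [sum_comm]
      exact sum_congr rfl fun _ _ => sum_congr rfl fun _ _ => by ring
    rw [h2] at h1
    have h3 : ∀ χ ∈ s, g χ * ∑ x, (χ : H → ℂ) x * (i : H → ℂ) x⁻¹ =
        if χ = i then g χ * Nat.card H else 0 := by
      intro χ _
      rw [irr_orth χ.2 i.2]
      by_cases h : χ = i
      · rw [if_pos h, if_pos (congrArg _ h)]
      · rw [if_neg h, if_neg (fun hh => h (Subtype.ext hh)), mul_zero]
    rw [sum_congr rfl h3, sum_ite_eq' s i, if_pos hi] at h1
    exact (mul_eq_zero.1 h1).resolve_right cardH_ne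
  exact this.setFinite

theorem irr_conj {χ : H → ℂ} (h : IsIrrChar χ) (x g : H) : χ (g * x * g⁻¹) = χ x := by
  obtain ⟨V, _, _, _, ρ, hρ, rfl⟩ := h
  exact char_conj ρ x g

/-- a nonzero dimension -/
theorem irr_one {χ : H → ℂ} (h : IsIrrChar χ) : ∃ n : ℕ, 1 ≤ n ∧ χ 1 = n := by
  obtain ⟨V, _, _, _, ρ, hρ, rfl⟩ := h
  refine ⟨Module.finrank ℂ V, ?_, char_one ρ⟩
  have : Nontrivial V := by
    by_contra hc
    rw [not_nontrivial_iff_subsingleton] at hc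
    exact (bot_ne_top (α := Subrepresentation ρ)) (Subrepresentation.toSubmodule_injective
      (Subsingleton.elim _ _))
  exact Module.finrank_pos

theorem rep_inv {V : Type*} [AddCommGroup V] [Module ℂ V] [FiniteDimensional ℂ V]
    (ρ : Representation ℂ H V) (x : H) : ρ.character x⁻¹ = (starRingEnd ℂ) (ρ.character x) := by
  classical
  let b := Module.finBasis ℂ V
  let M : H → Matrix _ _ ℂ := fun g => LinearMap.toMatrix b b (ρ g)
  have hmul : ∀ g h, M (g * h) = M g * M h := fun g h => by
    simp only [M]; rw [map_mul, LinearMap.toMatrix_mul]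
  have h1 : M 1 = 1 := by simp only [M]; rw [map_one, LinearMap.toMatrix_one]
  have htr : ∀ g, ρ.character g = (M g).trace := fun g => by
    rw [character, LinearMap.trace_eq_matrix_trace ℂ b]
  set P := ∑ g, (M g).conjTranspose * M g with hP
  have hPd : P.PosDef := by
    rw [hP, ← add_sum_erase _ _ (mem_univ (1 : H))]
    refine Matrix.PosDef.add_posSemidef ?_ ?_
    · rw [h1]; simpa using Matrix.PosDef.one
    · exact Matrix.posSemidef_sum _ fun g _ => Matrix.posSemidef_conjTranspose_mul_self _
  have hinv : ∀ h, (M h).conjTranspose * P * M h = P := by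
    intro h
    rw [hP, mul_sum, sum_mul]
    refine Fintype.sum_equiv (Equiv.mulRight h) _ _ fun g => ?_
    simp only [Equiv.coe_mulRight, hmul, Matrix.conjTranspose_mul, Matrix.mul_assoc]
  have hu := hPd.isUnit
  have hd := (Matrix.isUnit_iff_isUnit_det P).1 hu
  rw [htr, htr]
  have e1 : P * M x⁻¹ = (M x).conjTranspose * P := by
    conv_lhs => rw [← hinv x]
    rw [Matrix.mul_assoc, ← hmul, mul_inv_cancel, h1, Matrix.mul_one]
  have e2 : M x⁻¹ = P⁻¹ * ((M x).conjTranspose * P) := by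
    rw [← e1, ← Matrix.mul_assoc, Matrix.nonsing_inv_mul _ hd, Matrix.one_mul]
  rw [e2, Matrix.trace_mul_comm, Matrix.mul_assoc, Matrix.mul_nonsing_inv _ hd, Matrix.mul_one,
    Matrix.trace_conjTranspose]
  rfl

theorem irr_inv {χ : H → ℂ} (h : IsIrrChar χ) (x : H) : χ x⁻¹ = (starRingEnd ℂ) (χ x) := by
  obtain ⟨V, _, _, _, ρ, hρ, rfl⟩ := h
  exact rep_inv ρ x

theorem irr_mult {χ : H → ℂ} (h : IsIrrChar χ) (A : Subgroup H) [Fintype A] (ψ : A →* ℂˣ) :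
    ∃ n : ℕ, ∑ a : A, χ a * (ψ a⁻¹ : ℂˣ) = Nat.card A * (n : ℂ) := by
  obtain ⟨V, _, _, _, ρ, hρ, rfl⟩ := h
  have hi : Invertible (Nat.card A : ℂ) := invertibleOfNonzero cardH_ne
  let σ : Representation ℂ A V :=
    { toFun := fun a => ((ψ a⁻¹ : ℂˣ) : ℂ) • ρ a
      map_one' := by simp
      map_mul' := fun a b => by
        rw [smul_mul_smul_comm, mul_inv_rev, map_mul ψ, mul_comm (ψ b⁻¹)]
        push_cast
        rw [map_mul] }
  refine ⟨Module.finrank ℂ (invariants σ), ?_⟩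
  rw [← card_inv_mul_sum_char_eq_finrank σ, mul_inv_cancel_left₀ cardH_ne]
  refine sum_congr rfl fun a _ => ?_
  change _ = LinearMap.trace ℂ V (((ψ a⁻¹ : ℂˣ) : ℂ) • ρ a)
  rw [map_smul, smul_eq_mul, mul_comm]
  rfl

theorem irr_triv : IsIrrChar (fun _ : H => (1 : ℂ)) := by
  refine ⟨ULift.{u} ℂ, inferInstance, inferInstance, inferInstance, 1, ?_, ?_⟩
  · have hf : Module.finrank ℂ (ULift.{u} ℂ) = 1 := by simp
    have hs : IsSimpleOrder (Submodule ℂ (ULift.{u} ℂ)) := by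
      have := isSimpleModule_iff_finrank_eq_one.2 hf
      exact (isSimpleModule_iff ℂ _).1 this
    have : Nontrivial (Subrepresentation (1 : Representation ℂ H (ULift.{u} ℂ))) := by
      refine ⟨⊥, ⊤, fun h => ?_⟩
      have h1 : (⊥ : Submodule ℂ (ULift.{u} ℂ)) = ⊤ := congrArg Subrepresentation.toSubmodule h
      exact bot_ne_top h1
    refine ⟨fun W => ?_⟩
    rcases hs.eq_bot_or_eq_top W.toSubmodule with h | h
    · exact Or.inl (Subrepresentation.toSubmodule_injective h)
    · exact Or.inr (Subrepresentation.toSubmodule_injective h)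
  · funext x
    simp [character]

end
end EP

namespace EP
universe u
open Finset Representation

section
variable {H : Type u} [Group H] [Fintype H]

theorem irr_prod {χ ψ : H → ℂ} (h : IsIrrChar χ) (h' : IsIrrChar ψ) :
    ∃ n : ℕ, ∑ x, χ x * ψ x = Nat.card H * (n : ℂ) := by
  obtain ⟨V, _, _, _, ρ, hρ, rfl⟩ := h
  obtain ⟨V', _, _, _, ρ', hρ', rfl⟩ := h'
  have hi : Invertible (Nat.card H : ℂ) := invertibleOfNonzero cardH_ne
  refine ⟨Module.finrank ℂ (invariants (tprod ρ ρ')), ?_⟩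
  rw [← card_inv_mul_sum_char_eq_finrank (tprod ρ ρ'), mul_inv_cancel_left₀ cardH_ne]
  refine sum_congr rfl fun a _ => ?_
  rw [char_tensor]
  rfl

theorem irr_bar {χ : H → ℂ} (h : IsIrrChar χ) : IsIrrChar (fun x => χ x⁻¹) := by
  classical
  by_cases hex : ∀ ψ : H → ℂ, IsIrrChar ψ → ∑ x, χ x⁻¹ * ψ x⁻¹ = 0
  · exfalso
    have h0 := complete (fun x => χ x⁻¹) (fun x g => by
      have := irr_conj h x⁻¹ g
      rw [← this]; congr 1; group) hex
    obtain ⟨n, hn, hn1⟩ := irr_one h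
    have := congrFun h0 1
    simp only [inv_one, hn1, Pi.zero_apply, Nat.cast_eq_zero] at this
    omega
  push Not at hex
  obtain ⟨ψ, hψ, hne⟩ := hex
  obtain ⟨c, hc⟩ := irr_prod h hψ
  have e1 : ∑ x, χ x⁻¹ * ψ x⁻¹ = ∑ x, χ x * ψ x :=
    Fintype.sum_equiv (Equiv.inv H) _ _ fun x => rfl
  rw [e1] at hne
  have hc1 : 1 ≤ c := by
    rcases Nat.eq_zero_or_pos c with h0 | h0
    · rw [hc, h0] at hne; simp at hne
    · exact h0
  have hs : ∑ x, (χ x⁻¹ - ψ x) * (χ x - ψ x⁻¹) = Nat.card H * (2 - 2 * (c : ℂ)) := by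
    have o1 := irr_orth h h
    have o2 := irr_orth hψ hψ
    rw [if_pos rfl] at o1 o2
    have : ∀ x, (χ x⁻¹ - ψ x) * (χ x - ψ x⁻¹) = χ x * χ x⁻¹ + ψ x * ψ x⁻¹ - χ x⁻¹ * ψ x⁻¹ - χ x * ψ x :=
      fun x => by ring
    simp only [this, sum_sub_distrib, sum_add_distrib]
    rw [o1, o2, e1, hc]; ring
  have hs2 : ∑ x, (χ x⁻¹ - ψ x) * (χ x - ψ x⁻¹) = ((∑ x, Complex.normSq (χ x⁻¹ - ψ x) : ℝ) : ℂ) := by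
    push_cast
    refine sum_congr rfl fun x _ => ?_
    rw [Complex.normSq_eq_conj_mul_self, map_sub, ← irr_inv h, ← irr_inv hψ, inv_inv, mul_comm]
  rw [hs2] at hs
  have hs3 : ∑ x, Complex.normSq (χ x⁻¹ - ψ x) = Nat.card H * (2 - 2 * (c : ℝ)) := by exact_mod_cast hs
  have hle : ∑ x, Complex.normSq (χ x⁻¹ - ψ x) ≤ 0 := by
    rw [hs3]
    have : (1 : ℝ) ≤ c := by exact_mod_cast hc1
    apply mul_nonpos_of_nonneg_of_nonpos (by positivity); linarith
  have h0 := (sum_eq_zero_iff_of_nonneg (fun x _ => Complex.normSq_nonneg (χ x⁻¹ - ψ x))).1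
    (le_antisymm hle (sum_nonneg fun x _ => Complex.normSq_nonneg _))
  have : (fun x => χ x⁻¹) = ψ := by
    funext x
    exact sub_eq_zero.1 (Complex.normSq_eq_zero.1 (h0 x (mem_univ _)))
  rw [this]; exact hψ

/-- the type of irreducible characters -/
abbrev Irr (H : Type u) [Group H] : Type u := {χ : H → ℂ // IsIrrChar χ}

noncomputable instance : Fintype (Irr H) := (irr_finite (H := H)).fintype

/-- column orthogonality -/
theorem col_orth (a b : H) : ∑ χ : Irr H, χ.1 a * χ.1 b⁻¹ = (Nat.card {g : H // g * b * g⁻¹ = a} : ℂ) := by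
  classical
  have hcard : ∀ a : H, (Nat.card {g : H // g * b * g⁻¹ = a} : ℂ) = ∑ g : H, if g * b * g⁻¹ = a then 1 else 0 := by
    intro a
    rw [Nat.card_eq_fintype_card, Fintype.card_subtype]
    simp
  have := complete (fun x => (Nat.card {g : H // g * b * g⁻¹ = x} : ℂ) - ∑ χ : Irr H, χ.1 x * χ.1 b⁻¹)
    (by
      intro x k
      congr 1
      · congr 1
        refine Nat.card_congr ((Equiv.mulLeft k⁻¹).subtypeEquiv fun g => ?_)
        simp only [Equiv.coe_mulLeft]
        constructor
        · intro h
          calc k⁻¹ * g * b * (k⁻¹ * g)⁻¹ = k⁻¹ * (g * b * g⁻¹) * k := by group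
            _ = x := by rw [h]; group
        · rintro rfl; group
      · exact sum_congr rfl fun χ _ => by rw [irr_conj χ.2])
    (by
      intro ψ hψ
      have e1 : ∑ x, (Nat.card {g : H // g * b * g⁻¹ = x} : ℂ) * ψ x⁻¹ = Nat.card H * ψ b⁻¹ := by
        simp only [hcard, sum_mul]
        rw [sum_comm]
        have : ∀ g : H, ∑ x, (if g * b * g⁻¹ = x then (1:ℂ) else 0) * ψ x⁻¹ = ψ b⁻¹ := by
          intro g
          simp only [ite_mul, one_mul, zero_mul, sum_ite_eq, mem_univ, if_true]
          have := irr_conj hψ b⁻¹ g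
          rw [← this]; congr 1; group
        rw [sum_congr rfl fun g _ => this g]; simp [Nat.card_eq_fintype_card]
      have e2 : ∑ x, (∑ χ : Irr H, χ.1 x * χ.1 b⁻¹) * ψ x⁻¹ = Nat.card H * ψ b⁻¹ := by
        simp only [sum_mul]
        rw [sum_comm]
        have : ∀ χ : Irr H, ∑ x, χ.1 x * χ.1 b⁻¹ * ψ x⁻¹ = if χ = ⟨ψ, hψ⟩ then (Nat.card H : ℂ) * ψ b⁻¹ else 0 := by
          intro χ
          have o := irr_orth χ.2 hψ
          have : ∑ x, χ.1 x * χ.1 b⁻¹ * ψ x⁻¹ = χ.1 b⁻¹ * ∑ x, χ.1 x * ψ x⁻¹ := by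
            rw [mul_sum]; exact sum_congr rfl fun _ _ => by ring
          rw [this, o]
          by_cases hc : χ.1 = ψ
          · rw [if_pos hc, if_pos (Subtype.ext hc), hc]; ring
          · rw [if_neg hc, if_neg (fun hh => hc (congrArg Subtype.val hh)), mul_zero]
        rw [sum_congr rfl fun g _ => this g]; simp
      simp only [sub_mul, sum_sub_distrib]
      rw [e1, e2, sub_self])
  have := congrFun this a
  exact (sub_eq_zero.1 this).symm

theorem odd_conj_inv (hodd : Odd (Nat.card H)) {g x : H} (h : g * x * g⁻¹ = x⁻¹) : x = 1 := by
  have hgo : Odd (orderOf g) := hodd.of_dvd_nat (orderOf_dvd_natCard g)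
  have hxo : Odd (orderOf x) := hodd.of_dvd_nat (orderOf_dvd_natCard x)
  have hsq : g ^ 2 * x = x * g ^ 2 := by
    have h1 : g * x = x⁻¹ * g := by rw [← h]; group
    have h2 : g * x⁻¹ = x * g := by
      have : g * x⁻¹ * g⁻¹ = x := by
        calc g * x⁻¹ * g⁻¹ = (g * x * g⁻¹)⁻¹ := by group
          _ = x := by rw [h, inv_inv]
      calc g * x⁻¹ = g * x⁻¹ * g⁻¹ * g := by group
        _ = x * g := by rw [this]
    rw [sq, mul_assoc, h1, ← mul_assoc, h2, mul_assoc]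
  have hc : Commute g x := by
    have hc2 : Commute (g ^ 2) x := hsq
    obtain ⟨k, hk⟩ := hgo
    have : g = (g ^ 2) ^ (k + 1) := by
      rw [← pow_mul, show 2 * (k+1) = orderOf g + 1 by omega, pow_succ, pow_orderOf_eq_one, one_mul]
    rw [this]
    exact hc2.pow_left _
  have hx2 : x ^ 2 = 1 := by
    have : g * x * g⁻¹ = x := by rw [hc.eq]; group
    rw [this] at h
    rw [sq]; nth_rewrite 2 [h]; group
  have := orderOf_dvd_of_pow_eq_one hx2
  rw [← orderOf_eq_one_iff]
  rcases (Nat.dvd_prime Nat.prime_two).1 this with h | h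
  · exact h
  · rw [h] at hxo; exact absurd hxo (by decide)

theorem real_triv (hodd : Odd (Nat.card H)) {χ : H → ℂ} (h : IsIrrChar χ) (hr : ∀ x, χ x⁻¹ = χ x) :
    χ = fun _ => 1 := by
  classical
  have e1 : ∑ x, ∑ χ : Irr H, χ.1 x * χ.1 x = (Nat.card H : ℂ) := by
    have : ∀ x : H, ∑ χ : Irr H, χ.1 x * χ.1 x = if x = 1 then (Nat.card H : ℂ) else 0 := by
      intro x
      have := col_orth x x⁻¹
      rw [inv_inv] at this
      rw [this]
      split_ifs with hx
      · subst hx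
        simp
      · have : IsEmpty {g : H // g * x⁻¹ * g⁻¹ = x} := by
          refine ⟨fun ⟨g, hg⟩ => hx ?_⟩
          have := odd_conj_inv hodd (g := g) (x := x⁻¹) (by rw [inv_inv]; exact hg)
          simpa using this
        simp
    simp [this]
  rw [sum_comm] at e1
  have e2 : ∀ χ : Irr H, ∑ x, χ.1 x * χ.1 x = if (∀ x, χ.1 x⁻¹ = χ.1 x) then (Nat.card H : ℂ) else 0 := by
    intro χ
    have := irr_orth χ.2 (irr_bar χ.2)
    simp only [inv_inv] at this
    rw [this]
    by_cases hc : χ.1 = fun x => χ.1 x⁻¹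
    · rw [if_pos hc, if_pos (fun x => (congrFun hc x).symm)]
    · rw [if_neg hc, if_neg (fun hh => hc (funext fun x => (hh x).symm))]
  simp only [e2] at e1
  rw [← sum_filter, sum_const, nsmul_eq_mul] at e1
  have e3 : (#{χ : Irr H | ∀ x, χ.1 x⁻¹ = χ.1 x} : ℂ) = 1 := by
    apply mul_right_cancel₀ (cardH_ne (H := H)); rw [e1, one_mul]
  have e4 : #{χ : Irr H | ∀ x, χ.1 x⁻¹ = χ.1 x} = 1 := by exact_mod_cast e3
  have := card_le_one.1 e4.le ⟨χ, h⟩ (by simpa using hr) ⟨_, irr_triv⟩ (by simp)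
  exact congrArg Subtype.val this

end
end EP

namespace EP
universe u
open Finset Subgroup

section
variable {H : Type u} [Group H] [Fintype H]

theorem lin_card (A : Type*) [Group A] [Finite A] :
    Nat.card (A →* ℂˣ) = Nat.card (Abelianization A) := by
  have : Finite (Abelianization A) := Quotient.finite _
  rw [Nat.card_congr (Abelianization.lift (G := A) (A := ℂˣ))]
  exact CommGroup.card_monoidHom_of_hasEnoughRootsOfUnity (Abelianization A) ℂ

instance lin_finite (A : Type*) [Group A] [Finite A] : Finite (A →* ℂˣ) := by
  have : Finite (Abelianization A) := Quotient.finite _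
  apply Nat.finite_of_card_ne_zero
  rw [lin_card]
  exact Nat.card_pos.ne'

noncomputable instance lin_fintype (A : Type*) [Group A] [Finite A] : Fintype (A →* ℂˣ) :=
  Fintype.ofFinite _

theorem lin_card_dvd (A : Type*) [Group A] [Finite A] : Nat.card (A →* ℂˣ) ∣ Nat.card A := by
  rw [lin_card]
  exact Subgroup.card_quotient_dvd_card _

theorem lin_card_comm (A : Type*) [Group A] [Finite A] (h : ∀ x y : A, x * y = y * x) :
    Nat.card (A →* ℂˣ) = Nat.card A := by
  let _ : CommGroup A := { (inferInstance : Group A) with mul_comm := h }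
  exact CommGroup.card_monoidHom_of_hasEnoughRootsOfUnity A ℂ

theorem lin_nontrivial {p : ℕ} [Fact p.Prime] (A : Type*) [Group A] [Finite A] [Nontrivial A]
    (h : IsPGroup p A) : Nontrivial (A →* ℂˣ) := by
  have hs : Group.IsSolvable A := solvable_of_pgroup Fact.out h
  have h1 := Group.IsSolvable.commutator_lt_top_of_nontrivial A
  rw [← Finite.one_lt_card_iff_nontrivial, lin_card, Finite.one_lt_card_iff_nontrivial]
  exact QuotientGroup.nontrivial_iff.2 h1.ne

theorem lin_sum {A : Type*} [Group A] [Fintype A] (φ : A →* ℂˣ) (h : φ ≠ 1) :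
    ∑ a : A, ((φ a : ℂˣ) : ℂ) = 0 := by
  refine sum_hom_units_eq_zero ((Units.coeHom ℂ).comp φ) fun h' => h ?_
  ext a
  have := DFunLike.congr_fun h' a
  simpa using this

theorem lin_sum_inv {A : Type*} [Group A] [Fintype A] (φ : A →* ℂˣ) (h : φ ≠ 1) :
    ∑ a : A, ((φ a⁻¹ : ℂˣ) : ℂ) = 0 := by
  rw [← lin_sum φ h]
  exact Fintype.sum_equiv (Equiv.inv A) _ _ fun x => rfl

theorem lin_orth {A : Type*} [Group A] [Fintype A] (φ ψ : A →* ℂˣ) [Decidable (φ = ψ)] :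
    ∑ a : A, ((φ a : ℂˣ) : ℂ) * ((ψ a⁻¹ : ℂˣ) : ℂ) = if φ = ψ then (Nat.card A : ℂ) else 0 := by
  have e : ∀ a, ((φ a : ℂˣ) : ℂ) * ((ψ a⁻¹ : ℂˣ) : ℂ) = (((φ * ψ⁻¹) a : ℂˣ) : ℂ) := fun a => by simp
  simp only [e]
  split_ifs with h
  · subst h; simp [Nat.card_eq_fintype_card]
  · exact lin_sum _ fun h' => h (mul_inv_eq_one.1 h')

theorem lin_conj {A : Type*} [Group A] [Finite A] (φ : A →* ℂˣ) (a : A) :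
    (starRingEnd ℂ) ((φ a : ℂˣ) : ℂ) = ((φ a⁻¹ : ℂˣ) : ℂ) := by
  have h1 : ((φ a : ℂˣ) : ℂ) ^ (Nat.card A) = 1 := by
    rw [← Units.val_pow_eq_pow_val, ← map_pow, pow_card_eq_one']; simp
  have h2 := Complex.norm_eq_one_of_pow_eq_one h1 Nat.card_pos.ne'
  rw [map_inv, Units.val_inv_eq_inv_val, Complex.inv_def, Complex.normSq_eq_norm_sq, h2]
  simp

/-- multiplicities -/
noncomputable def um (A : Subgroup H) (χ : Irr H) (φ : A →* ℂˣ) : ℕ :=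
  letI := Fintype.ofFinite A
  (irr_mult χ.2 A φ).choose

theorem um_spec (A : Subgroup H) [hF : Fintype A] (χ : Irr H) (φ : A →* ℂˣ) :
    ∑ a : A, χ.1 a * (φ a⁻¹ : ℂˣ) = Nat.card A * (um A χ φ : ℂ) := by
  have hi : hF = Fintype.ofFinite A := Subsingleton.elim _ _
  subst hi
  exact (@irr_mult H _ _ χ.1 χ.2 A (Fintype.ofFinite A) φ).choose_spec

/-- differences -/
noncomputable def dm (A : Subgroup H) (φ : A →* ℂˣ) (χ : Irr H) : ℤ := um A χ 1 - um A χ φ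

theorem dm_spec (A : Subgroup H) [Fintype A] (χ : Irr H) (φ : A →* ℂˣ) :
    (Nat.card A : ℂ) * (dm A φ χ : ℂ) = ∑ a : A, χ.1 a * (1 - (φ a⁻¹ : ℂˣ)) := by
  have h1 := um_spec A χ 1
  have h2 := um_spec A χ φ
  simp only [dm, Int.cast_sub, Int.cast_natCast, mul_sub, sum_sub_distrib]
  rw [← h1, ← h2]
  simp

/-- conjugate character -/
def barI (χ : Irr H) : Irr H := ⟨fun x => χ.1 x⁻¹, irr_bar χ.2⟩
/-- trivial character -/
def oneI : Irr H := ⟨fun _ => 1, irr_triv⟩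

theorem dm_one (A : Subgroup H) (φ : A →* ℂˣ) (h : φ ≠ 1) : dm A φ oneI = 1 := by
  have := Fintype.ofFinite A
  have h1 := dm_spec A oneI φ
  have h2 : ∑ a : A, (oneI (H := H)).1 a * (1 - ((φ a⁻¹ : ℂˣ) : ℂ)) = Nat.card A := by
    simp only [oneI, one_mul, sum_sub_distrib]
    rw [lin_sum_inv φ h]; simp [Nat.card_eq_fintype_card]
  rw [h2] at h1
  have h3 : ((dm A φ oneI : ℤ) : ℂ) = 1 := by
    apply mul_left_cancel₀ (cardH_ne (H := A)); rw [h1, mul_one]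
  exact_mod_cast h3

theorem dm_inv (A : Subgroup H) (φ : A →* ℂˣ) (χ : Irr H) : dm A φ⁻¹ χ = dm A φ (barI χ) := by
  have := Fintype.ofFinite A
  have h1 := dm_spec A χ φ⁻¹
  have h2 := dm_spec A (barI χ) φ
  have h3 : (Nat.card A : ℂ) * (dm A φ⁻¹ χ : ℂ) = (Nat.card A : ℂ) * (dm A φ (barI χ) : ℂ) := by
    rw [h1, h2]
    refine Fintype.sum_equiv (Equiv.inv A) _ _ fun x => ?_
    simp [barI]
  have := mul_left_cancel₀ (cardH_ne (H := A)) h3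
  exact_mod_cast this

open Classical in
theorem dm_inner (A B : Subgroup H) [Fintype A] [Fintype B] (φ : A →* ℂˣ) (ψ : B →* ℂˣ) :
    (Nat.card A : ℂ) * (Nat.card B : ℂ) * ((∑ χ, dm A φ χ * dm B ψ χ : ℤ) : ℂ) =
    ∑ g : H, ∑ b : B, ∑ a : A, if g * b * g⁻¹ = (a : H) then
      (1 - ((φ a⁻¹ : ℂˣ) : ℂ)) * (1 - ((ψ b : ℂˣ) : ℂ)) else 0 := by
  have e1 : ∀ χ : Irr H, (Nat.card A : ℂ) * (Nat.card B : ℂ) * ((dm A φ χ * dm B ψ χ : ℤ) : ℂ) =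
      ∑ b : B, ∑ a : A, (1 - ((φ a⁻¹ : ℂˣ) : ℂ)) * (1 - ((ψ b : ℂˣ) : ℂ)) * (χ.1 a * χ.1 (b : H)⁻¹) := by
    intro χ
    have h2 : (Nat.card B : ℂ) * (dm B ψ χ : ℂ) = ∑ b : B, χ.1 (b : H)⁻¹ * (1 - (ψ b : ℂˣ)) := by
      rw [dm_spec B χ ψ]
      refine Fintype.sum_equiv (Equiv.inv B) _ _ fun x => ?_
      simp
    have : (Nat.card A : ℂ) * (Nat.card B : ℂ) * ((dm A φ χ * dm B ψ χ : ℤ) : ℂ) =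
      ((Nat.card B : ℂ) * (dm B ψ χ : ℂ)) * ((Nat.card A : ℂ) * (dm A φ χ : ℂ)) := by push_cast; ring
    rw [this, h2, dm_spec A χ φ, sum_mul_sum]
    exact sum_congr rfl fun _ _ => sum_congr rfl fun _ _ => by ring
  rw [Int.cast_sum, mul_sum, sum_congr rfl fun χ _ => e1 χ, sum_comm]
  rw [sum_comm (s := univ (α := H))]
  refine sum_congr rfl fun b _ => ?_
  rw [sum_comm, sum_comm (s := univ (α := H))]
  refine sum_congr rfl fun a _ => ?_
  rw [← mul_sum, col_orth, Nat.card_eq_fintype_card, Fintype.card_subtype, ← sum_filter, sum_const,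
    nsmul_eq_mul, mul_comm]

theorem dm_cross (A B : Subgroup H) (φ : A →* ℂˣ) (ψ : B →* ℂˣ)
    (h : ∀ g : H, ∀ b ∈ B, g * b * g⁻¹ ∈ A → b = 1) : ∑ χ, dm A φ χ * dm B ψ χ = 0 := by
  classical
  have := Fintype.ofFinite A
  have := Fintype.ofFinite B
  have h1 := dm_inner A B φ ψ
  have h2 : (∑ g : H, ∑ b : B, ∑ a : A, if g * b * g⁻¹ = (a : H) then
      (1 - ((φ a⁻¹ : ℂˣ) : ℂ)) * (1 - ((ψ b : ℂˣ) : ℂ)) else 0) = 0 := by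
    refine sum_eq_zero fun g _ => sum_eq_zero fun b _ => sum_eq_zero fun a _ => ?_
    split_ifs with hg
    · have hb : b = 1 := Subtype.ext (h g b b.2 (hg ▸ a.2))
      rw [hb]; simp
    · rfl
  rw [h2] at h1
  rcases mul_eq_zero.1 h1 with h3 | h3
  · exact absurd h3 (mul_ne_zero (cardH_ne (H := A)) (cardH_ne (H := B)))
  · exact_mod_cast h3

end
end EP

namespace EP
universe u
open Finset Subgroup
set_option linter.unusedSectionVars false

section
variable {H : Type u} [Group H] [Fintype H]

/-- conjugation by elements of the normalizer -/
def tw (A : Subgroup H) (g : normalizer (A : Set H)) (φ : A →* ℂˣ) : A →* ℂˣ :=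
  φ.comp (A.normalizerMonoidHom g).toMonoidHom

theorem tw_apply (A : Subgroup H) (g : normalizer (A : Set H)) (φ : A →* ℂˣ) (b : A) :
    tw A g φ b = φ ⟨g * b * (g : H)⁻¹, (g.2 b).1 b.2⟩ := rfl

theorem tw_one (A : Subgroup H) (φ : A →* ℂˣ) : tw A 1 φ = φ := by
  ext b; rw [tw_apply]; simp

theorem tw_mul (A : Subgroup H) (g h : normalizer (A : Set H)) (φ : A →* ℂˣ) :
    tw A (g * h) φ = tw A h (tw A g φ) := by
  ext b; simp only [tw_apply]; congr 3; simp [mul_assoc]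

theorem tw_triv (A : Subgroup H) (g : normalizer (A : Set H)) : tw A g 1 = 1 := rfl

/-- conjugacy of linear characters -/
def rl (A : Subgroup H) (φ ψ : A →* ℂˣ) : Prop := ∃ g, tw A g φ = ψ

theorem rl_refl (A : Subgroup H) (φ : A →* ℂˣ) : rl A φ φ := ⟨1, tw_one A φ⟩
theorem rl_symm (A : Subgroup H) (φ ψ : A →* ℂˣ) (h : rl A φ ψ) : rl A ψ φ := by
  obtain ⟨g, rfl⟩ := h
  exact ⟨g⁻¹, by rw [← tw_mul, mul_inv_cancel, tw_one]⟩
theorem rl_trans (A : Subgroup H) (φ ψ θ : A →* ℂˣ) (h : rl A φ ψ) (h' : rl A ψ θ) : rl A φ θ := by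
  obtain ⟨g, rfl⟩ := h
  obtain ⟨k, rfl⟩ := h'
  exact ⟨g * k, tw_mul _ _ _ _⟩
theorem rl_one (A : Subgroup H) (φ : A →* ℂˣ) (h : rl A φ 1) : φ = 1 := by
  obtain ⟨g, rfl⟩ := rl_symm _ _ _ h
  rfl

theorem tw_of_mem (A : Subgroup H) (g : normalizer (A : Set H)) (hg : (g : H) ∈ A) (φ : A →* ℂˣ) :
    tw A g φ = φ := by
  ext b
  rw [tw_apply]
  have : (⟨g * b * (g : H)⁻¹, (g.2 b).1 b.2⟩ : A) = ⟨g, hg⟩ * b * ⟨g, hg⟩⁻¹ := rfl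
  rw [this, map_mul, map_mul, map_inv, mul_comm (φ ⟨g, hg⟩), mul_inv_cancel_right]

theorem mem_of_tw (A : Subgroup H)
    (cen : ∀ x ∈ A, x ≠ 1 → ∀ g : H, g * x = x * g → g ∈ A)
    (g : normalizer (A : Set H)) (φ : A →* ℂˣ) (h1 : φ ≠ 1) (h : tw A g φ = φ) : (g : H) ∈ A := by
  by_contra hg
  let f : A → A := fun b => (⟨g * b * (g : H)⁻¹, (g.2 b).1 b.2⟩ : A) * b⁻¹
  have hinj : Function.Injective f := by
    intro b c hbc
    have h2 : (g : H) * b * (g : H)⁻¹ * (b : H)⁻¹ = g * c * (g : H)⁻¹ * (c : H)⁻¹ := congrArg Subtype.val hbc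
    by_contra hne
    refine hg (cen (c⁻¹ * b : A) (c⁻¹ * b : A).2 (fun hh => hne ?_) g ?_)
    · have : c⁻¹ * b = 1 := Subtype.ext hh
      exact (inv_mul_eq_one.1 this).symm
    · push_cast
      have h3 : (g : H) * b * (g : H)⁻¹ = g * c * (g : H)⁻¹ * (c : H)⁻¹ * b := by
        rw [← h2]; group
      calc (g : H) * ((c : H)⁻¹ * b) = ((g : H) * c * (g : H)⁻¹)⁻¹ * (g * b * (g : H)⁻¹) * g := by group
        _ = ((g : H) * c * (g : H)⁻¹)⁻¹ * (g * c * (g : H)⁻¹ * (c : H)⁻¹ * b) * g := by rw [h3]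
        _ = (c : H)⁻¹ * b * g := by group
  have hsurj := Finite.surjective_of_injective hinj
  apply h1
  ext a
  obtain ⟨b, rfl⟩ := hsurj a
  have := DFunLike.congr_fun h b
  rw [tw_apply] at this
  simp only [f, map_mul, this, map_inv, mul_inv_cancel, MonoidHom.one_apply]

theorem nr_inv (hodd : Odd (Nat.card H)) (A : Subgroup H)
    (cen : ∀ x ∈ A, x ≠ 1 → ∀ g : H, g * x = x * g → g ∈ A)
    (φ : A →* ℂˣ) (h1 : φ ≠ 1) : ¬ rl A φ φ⁻¹ := by
  rintro ⟨g, hg⟩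
  have hinv : ∀ ψ : A →* ℂˣ, tw A g ψ⁻¹ = (tw A g ψ)⁻¹ := fun ψ => rfl
  have h2 : tw A (g * g) φ = φ := by rw [tw_mul, hg, hinv, hg]; ext a; simp
  have hm := mem_of_tw A cen _ φ h1 h2
  have hgA : (g : H) ∈ A := by
    have hgo : Odd (orderOf (g : H)) := hodd.of_dvd_nat (orderOf_dvd_natCard _)
    obtain ⟨k, hk⟩ := hgo
    have : (g : H) = ((g * g : normalizer (A : Set H)) : H) ^ (k + 1) := by
      push_cast
      rw [← sq, ← pow_mul, show 2 * (k+1) = orderOf (g : H) + 1 by omega, pow_succ, pow_orderOf_eq_one, one_mul]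
    rw [this]
    exact pow_mem hm _
  rw [tw_of_mem A g hgA] at hg
  apply h1
  ext a
  have h3 : φ a = (φ a)⁻¹ := DFunLike.congr_fun hg a
  have h4 : φ a ^ 2 = 1 := by rw [sq]; nth_rewrite 2 [h3]; rw [mul_inv_cancel]
  have hao : Odd (orderOf (a : H)) := hodd.of_dvd_nat (orderOf_dvd_natCard _)
  obtain ⟨k, hk⟩ := hao
  have ha : a ^ (2 * k + 1) = 1 := by rw [← hk]; exact Subtype.ext (by simp [pow_orderOf_eq_one])
  have h5 := congrArg φ ha
  rw [map_pow, map_one, pow_succ, pow_mul, h4, one_pow, one_mul] at h5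
  rw [h5]; rfl

theorem A_card (A : Subgroup H) : Nat.card {g : normalizer (A : Set H) // (g : H) ∈ A} = Nat.card A := by
  refine Nat.card_congr ⟨fun g => ⟨g.1.1, g.2⟩, fun a => ⟨⟨a.1, le_normalizer a.2⟩, a.2⟩, fun _ => rfl, fun _ => rfl⟩

theorem tw_card (A : Subgroup H)
    (cen : ∀ x ∈ A, x ≠ 1 → ∀ g : H, g * x = x * g → g ∈ A)
    (φ ψ : A →* ℂˣ) (h1 : φ ≠ 1) (h : rl A φ ψ) :
    Nat.card {g // tw A g φ = ψ} = Nat.card A := by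
  obtain ⟨k, rfl⟩ := h
  rw [← A_card A]
  refine Nat.card_congr ((Equiv.mulRight k⁻¹).subtypeEquiv fun g => ?_)
  simp only [Equiv.coe_mulRight]
  constructor
  · intro h
    apply mem_of_tw A cen _ φ h1
    rw [tw_mul, h, ← tw_mul, mul_inv_cancel, tw_one]
  · intro h
    have h2 := tw_of_mem A _ h φ
    calc tw A g φ = tw A (g * k⁻¹ * k) φ := by rw [inv_mul_cancel_right]
      _ = tw A k φ := by rw [tw_mul, h2]

/-- relative index -/
noncomputable def ee (A : Subgroup H) : ℕ := Nat.card (normalizer (A : Set H)) / Nat.card A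

theorem ee_mul (A : Subgroup H) : ee A * Nat.card A = Nat.card (normalizer (A : Set H)) :=
  Nat.div_mul_cancel (card_dvd_of_le le_normalizer)

theorem orb_card (A : Subgroup H)
    (cen : ∀ x ∈ A, x ≠ 1 → ∀ g : H, g * x = x * g → g ∈ A)
    (φ : A →* ℂˣ) (h1 : φ ≠ 1) : Nat.card {ψ // rl A φ ψ} = ee A := by
  have e : (Σ ψ : {ψ // rl A φ ψ}, {g // tw A g φ = ψ.1}) ≃ normalizer (A : Set H) :=
    ⟨fun x => x.2.1, fun g => ⟨⟨tw A g φ, g, rfl⟩, g, rfl⟩, by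
      rintro ⟨⟨ψ, hψ⟩, g, hg⟩
      change tw A g φ = ψ at hg
      subst hg
      rfl, fun _ => rfl⟩
  have h2 := Nat.card_congr e
  have := Fintype.ofFinite {ψ // rl A φ ψ}
  rw [Nat.card_sigma, sum_congr rfl fun ψ _ => tw_card A cen φ ψ.1 h1 ψ.2, sum_const, ← ee_mul,
    smul_eq_mul, card_univ, ← Nat.card_eq_fintype_card] at h2
  exact Nat.eq_of_mul_eq_mul_right Nat.card_pos h2

theorem ee_ge (hodd : Odd (Nat.card H)) (A : Subgroup H) (hne : normalizer (A : Set H) ≠ A) : 3 ≤ ee A := by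
  have h1 := ee_mul A
  have ho : Odd (ee A) := by
    have : Odd (Nat.card (normalizer (A : Set H))) := hodd.of_dvd_nat (card_subgroup_dvd_card _)
    exact this.of_dvd_nat ⟨_, h1.symm⟩
  have h3 : ee A ≠ 1 := by
    intro h
    rw [h, one_mul] at h1
    exact hne (eq_of_le_of_card_ge le_normalizer h1.ge).symm
  obtain ⟨k, hk⟩ := ho
  omega

open Classical in
theorem inner_same (A : Subgroup H)
    (ti : ∀ x ∈ A, x ≠ 1 → ∀ g : H, g * x * g⁻¹ ∈ A → g ∈ normalizer (A : Set H))
    (φ ψ : A →* ℂˣ) (hφ : φ ≠ 1) (hψ : ψ ≠ 1) :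
    (Nat.card A : ℤ) * ∑ χ, dm A φ χ * dm A ψ χ =
      Nat.card (normalizer (A : Set H)) + Nat.card {g // tw A g φ = ψ} := by
  have := Fintype.ofFinite A
  have := Fintype.ofFinite (normalizer (A : Set H))
  have h1 := dm_inner A A φ ψ
  have e1 : ∀ g : H, (∑ b : A, ∑ a : A, if g * b * g⁻¹ = (a : H) then
      (1 - ((φ a⁻¹ : ℂˣ) : ℂ)) * (1 - ((ψ b : ℂˣ) : ℂ)) else 0) =
      if hg : g ∈ normalizer (A : Set H) then
        (Nat.card A : ℂ) * (1 + if tw A ⟨g, hg⟩ φ = ψ then 1 else 0) else 0 := by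
    intro g
    by_cases hg : g ∈ normalizer (A : Set H)
    · rw [dif_pos hg]
      have e2 : ∀ b : A, (∑ a : A, if g * b * g⁻¹ = (a : H) then
          (1 - ((φ a⁻¹ : ℂˣ) : ℂ)) * (1 - ((ψ b : ℂˣ) : ℂ)) else 0) =
          1 - ((tw A ⟨g, hg⟩ φ b⁻¹ : ℂˣ) : ℂ) - ((ψ b : ℂˣ) : ℂ) +
            ((ψ b : ℂˣ) : ℂ) * ((tw A ⟨g, hg⟩ φ b⁻¹ : ℂˣ) : ℂ) := by
        intro b
        rw [sum_eq_single (⟨g * b * g⁻¹, (hg b).1 b.2⟩ : A), if_pos rfl]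
        · have : (⟨g * b * g⁻¹, (hg b).1 b.2⟩ : A)⁻¹ =
            ⟨g * (b⁻¹ : A) * g⁻¹, (hg (b⁻¹ : A)).1 (b⁻¹ : A).2⟩ := Subtype.ext (by push_cast; group)
          rw [this, tw_apply]; ring
        · intro a _ ha
          rw [if_neg]
          intro hh
          exact ha (Subtype.ext hh.symm)
        · intro hh; exact absurd (mem_univ _) hh
      have htw : tw A ⟨g, hg⟩ φ ≠ 1 := fun hh => hφ (rl_one A φ ⟨_, hh⟩)
      rw [sum_congr rfl fun b _ => e2 b, sum_add_distrib, sum_sub_distrib, sum_sub_distrib,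
        lin_sum _ hψ, lin_sum_inv _ htw, lin_orth]
      simp only [eq_comm (a := ψ)]
      split_ifs <;> simp [Nat.card_eq_fintype_card] <;> ring
    · rw [dif_neg hg]
      refine sum_eq_zero fun b _ => ?_
      refine sum_eq_zero fun a _ => ?_
      split_ifs with hh
      · have : b = 1 := by
          by_contra hb
          exact hg (ti b b.2 (fun h => hb (Subtype.ext h)) g (hh ▸ a.2))
        rw [this]; simp
      · rfl
  rw [sum_congr rfl fun g _ => e1 g] at h1
  have e3 : (∑ g : H, if hg : g ∈ normalizer (A : Set H) then
        (Nat.card A : ℂ) * (1 + if tw A ⟨g, hg⟩ φ = ψ then 1 else 0) else 0) =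
      ∑ g : normalizer (A : Set H), (Nat.card A : ℂ) * (1 + if tw A g φ = ψ then 1 else 0) := by
    rw [← sum_filter_of_ne (p := fun g => g ∈ normalizer (A : Set H)) (fun x _ hx => by
      by_contra hc
      exact hx (dif_neg hc)), sum_subtype _ (p := fun g => g ∈ normalizer (A : Set H)) (fun x => by simp)]
    exact sum_congr rfl fun g _ => dif_pos g.2
  rw [e3, ← mul_sum, mul_assoc] at h1
  have h2 := mul_left_cancel₀ (cardH_ne (H := A)) h1
  rw [sum_add_distrib, sum_boole] at h2
  have h3 : #{g | tw A g φ = ψ} = Nat.card {g // tw A g φ = ψ} := by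
    rw [Nat.card_eq_fintype_card, Fintype.card_subtype]
  rw [h3, sum_const, card_univ, ← Nat.card_eq_fintype_card] at h2
  simp only [nsmul_eq_mul, mul_one] at h2
  exact_mod_cast h2

theorem inner_r (A : Subgroup H)
    (ti : ∀ x ∈ A, x ≠ 1 → ∀ g : H, g * x * g⁻¹ ∈ A → g ∈ normalizer (A : Set H))
    (cen : ∀ x ∈ A, x ≠ 1 → ∀ g : H, g * x = x * g → g ∈ A)
    (φ ψ : A →* ℂˣ) (hφ : φ ≠ 1) (hψ : ψ ≠ 1) (h : rl A φ ψ) :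
    ∑ χ, dm A φ χ * dm A ψ χ = ee A + 1 := by
  have h1 := inner_same A ti φ ψ hφ hψ
  rw [tw_card A cen φ ψ hφ h, ← ee_mul A] at h1
  have h0 : (Nat.card A : ℤ) ≠ 0 := by exact_mod_cast Nat.card_pos.ne'
  apply mul_left_cancel₀ h0
  rw [h1]; push_cast; ring

theorem inner_nr (A : Subgroup H)
    (ti : ∀ x ∈ A, x ≠ 1 → ∀ g : H, g * x * g⁻¹ ∈ A → g ∈ normalizer (A : Set H))
    (φ ψ : A →* ℂˣ) (hφ : φ ≠ 1) (hψ : ψ ≠ 1) (h : ¬ rl A φ ψ) :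
    ∑ χ, dm A φ χ * dm A ψ χ = ee A := by
  have h1 := inner_same A ti φ ψ hφ hψ
  have : IsEmpty {g // tw A g φ = ψ} := ⟨fun g => h ⟨g.1, g.2⟩⟩
  rw [Nat.card_of_isEmpty (α := {g // tw A g φ = ψ}), ← ee_mul A] at h1
  have h0 : (Nat.card A : ℤ) ≠ 0 := by exact_mod_cast Nat.card_pos.ne'
  apply mul_left_cancel₀ h0
  rw [h1]; push_cast; ring

end
end EP

namespace EP
universe u
open Finset Subgroup
set_option linter.unusedSectionVars false

section
variable {H : Type u} [Group H] [Fintype H]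

theorem lin_pair {A : Type*} [Group A] [Fintype A] (F : A → ℂ) (v w : (A →* ℂˣ) → ℝ)
    (hv : ∀ φ : A →* ℂˣ, ∑ a, F a * (φ a⁻¹ : ℂˣ) = (Nat.card A : ℂ) * (v φ : ℂ)) :
    ∑ a, F a * (starRingEnd ℂ) (∑ φ : A →* ℂˣ, (w φ : ℂ) * (φ a : ℂˣ)) =
      (((Nat.card A : ℝ) * ∑ φ, w φ * v φ : ℝ) : ℂ) := by
  simp only [map_sum, map_mul, Complex.conj_ofReal, lin_conj, mul_sum]
  rw [sum_comm]
  push_cast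
  refine sum_congr rfl fun φ _ => ?_
  have : ∀ a, F a * ((w φ : ℂ) * ((φ a⁻¹ : ℂˣ) : ℂ)) = w φ * (F a * ((φ a⁻¹ : ℂˣ) : ℂ)) := fun a => by ring
  rw [sum_congr rfl fun a _ => this a, ← mul_sum, hv]
  ring

theorem lin_self {A : Type*} [Group A] [Fintype A] (w : (A →* ℂˣ) → ℝ) (φ : A →* ℂˣ) :
    ∑ a, (∑ ψ : A →* ℂˣ, (w ψ : ℂ) * (ψ a : ℂˣ)) * (φ a⁻¹ : ℂˣ) = (Nat.card A : ℂ) * (w φ : ℂ) := by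
  classical
  simp only [sum_mul]
  rw [sum_comm]
  have : ∀ ψ : A →* ℂˣ, ∑ a, (w ψ : ℂ) * ((ψ a : ℂˣ) : ℂ) * ((φ a⁻¹ : ℂˣ) : ℂ) =
      if ψ = φ then (Nat.card A : ℂ) * w φ else 0 := by
    intro ψ
    simp only [mul_assoc]
    rw [← mul_sum, lin_orth]
    split_ifs with h
    · rw [h]; ring
    · ring
  rw [sum_congr rfl fun a _ => this a]
  simp

open Classical in
/-- sum over nontrivial elements -/
noncomputable def Sh (A : Subgroup H) [Fintype A] (f : H → ℝ) : ℝ := ∑ a : A, if a = 1 then 0 else f a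

theorem bessel (A : Subgroup H) [Fintype A] (χ : Irr H) :
    (Nat.card A : ℝ) * ((Fintype.card (A →* ℂˣ) : ℝ) * ∑ φ, (um A χ φ : ℝ) ^ 2 - (∑ φ, (um A χ φ : ℝ)) ^ 2)
      ≤ Fintype.card (A →* ℂˣ) * Sh A (fun x => Complex.normSq (χ.1 x)) := by
  classical
  set k : ℝ := (Fintype.card (A →* ℂˣ) : ℝ) with hk
  have hk0 : 0 < k := by rw [hk]; exact_mod_cast Fintype.card_pos
  set u : (A →* ℂˣ) → ℝ := fun φ => um A χ φ with hu
  set m : ℝ := (∑ φ, u φ) / k with hm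
  have hkm : k * m = ∑ φ, u φ := by rw [hm]; field_simp
  set w : (A →* ℂˣ) → ℝ := fun φ => u φ - m with hw
  set h : A → ℂ := fun a => ∑ φ : A →* ℂˣ, (w φ : ℂ) * (φ a : ℂˣ) with hh
  have h1 : h 1 = 0 := by
    have : (∑ φ, w φ) = 0 := by
      simp only [hw, sum_sub_distrib, sum_const, nsmul_eq_mul, card_univ]
      rw [← hkm]; ring
    simp only [hh, map_one, Units.val_one, mul_one]
    exact_mod_cast this
  have p1 := lin_pair (fun a : A => χ.1 a) u w (fun φ => by rw [um_spec]; simp [hu])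
  have p2 := lin_pair h w w (fun φ => lin_self w φ)
  have r1 : ∑ a : A, (χ.1 a * (starRingEnd ℂ) (h a)).re = (Nat.card A : ℝ) * ∑ φ, w φ * u φ := by
    have := congrArg Complex.re p1
    rw [Complex.re_sum, Complex.ofReal_re] at this
    exact this
  have r2 : ∑ a, Complex.normSq (h a) = (Nat.card A : ℝ) * ∑ φ, w φ * w φ := by
    have := congrArg Complex.re p2
    rw [Complex.re_sum, Complex.ofReal_re] at this
    rw [← this]
    refine sum_congr rfl fun a _ => ?_
    rw [Complex.mul_conj, Complex.ofReal_re]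
  have hpos : 0 ≤ ∑ a : A, (if a = 1 then 0 else Complex.normSq (χ.1 a - h a)) :=
    sum_nonneg fun a _ => by split_ifs; exact le_rfl; exact Complex.normSq_nonneg _
  have hexp : ∑ a : A, (if a = 1 then 0 else Complex.normSq (χ.1 a - h a)) =
      Sh A (fun x => Complex.normSq (χ.1 x)) + ∑ a, Complex.normSq (h a) -
        2 * ∑ a : A, (χ.1 a * (starRingEnd ℂ) (h a)).re := by
    rw [Sh, mul_sum, ← sum_add_distrib, ← sum_sub_distrib]
    refine sum_congr rfl fun a _ => ?_
    split_ifs with ha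
    · rw [ha, h1]; simp
    · rw [Complex.normSq_sub]
  rw [hexp, r1, r2] at hpos
  have s1 : ∑ φ, w φ * u φ = ∑ φ, u φ ^ 2 - m * ∑ φ, u φ := by
    rw [mul_sum, ← sum_sub_distrib]; exact sum_congr rfl fun _ _ => by simp only [hw]; ring
  have s2 : ∑ φ, w φ * w φ = ∑ φ, u φ ^ 2 - m * ∑ φ, u φ := by
    have : ∑ φ, w φ * w φ = ∑ φ, u φ ^ 2 - 2 * m * ∑ φ, u φ + k * m ^ 2 := by
      rw [mul_sum, ← sum_sub_distrib, hk, ← nsmul_eq_mul, ← card_univ, ← sum_const, ← sum_add_distrib]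
      exact sum_congr rfl fun _ _ => by simp only [hw]; ring
    rw [this, ← hkm]; ring
  rw [s1, s2] at hpos
  have e5 : (∑ φ, u φ) ^ 2 = k * (m * ∑ φ, u φ) := by rw [← hkm]; ring
  rw [e5]
  nlinarith [mul_le_mul_of_nonneg_left hpos hk0.le]

/-- normalized partial norm -/
noncomputable def TT (A : Subgroup H) (χ : Irr H) : ℝ :=
  letI := Fintype.ofFinite A
  Sh A (fun x => Complex.normSq (χ.1 x)) / Nat.card (normalizer (A : Set H))

theorem Sh_nonneg (A : Subgroup H) [Fintype A] (f : H → ℝ) (hf : ∀ x, 0 ≤ f x) : 0 ≤ Sh A f :=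
  sum_nonneg fun a _ => by split_ifs; exact le_rfl; exact hf _

theorem TT_nonneg (A : Subgroup H) (χ : Irr H) : 0 ≤ TT A χ := by
  let _ := Fintype.ofFinite A
  exact div_nonneg (Sh_nonneg A _ fun x => Complex.normSq_nonneg _) (Nat.cast_nonneg _)

theorem TT_ge (A : Subgroup H) (χ : Irr H) :
    ((Fintype.card (A →* ℂˣ) : ℝ) * ∑ φ, (dm A φ χ : ℝ) ^ 2 - (∑ φ, (dm A φ χ : ℝ)) ^ 2) ≤
    TT A χ * ((ee A : ℝ) * Fintype.card (A →* ℂˣ)) := by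
  let _ := Fintype.ofFinite A
  have h1 := bessel A χ
  set k : ℝ := (Fintype.card (A →* ℂˣ) : ℝ) with hk
  have hA : (0 : ℝ) < Nat.card A := by exact_mod_cast Nat.card_pos
  have hN : (0 : ℝ) < Nat.card (normalizer (A : Set H)) := by exact_mod_cast Nat.card_pos
  have hee : (ee A : ℝ) * Nat.card A = Nat.card (normalizer (A : Set H)) := by exact_mod_cast ee_mul A
  have e1 : (k * ∑ φ, (dm A φ χ : ℝ) ^ 2 - (∑ φ, (dm A φ χ : ℝ)) ^ 2) =
      (k * ∑ φ, (um A χ φ : ℝ) ^ 2 - (∑ φ, (um A χ φ : ℝ)) ^ 2) := by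
    set c : ℝ := ((um A χ 1 : ℕ) : ℝ)
    have a1 : ∑ φ, (dm A φ χ : ℝ) = k * c - ∑ φ, (um A χ φ : ℝ) := by
      rw [hk, ← nsmul_eq_mul, ← card_univ, ← sum_const, ← sum_sub_distrib]
      exact sum_congr rfl fun _ _ => by simp [dm, c]
    have a2 : ∑ φ, (dm A φ χ : ℝ) ^ 2 = k * c ^ 2 - 2 * c * ∑ φ, (um A χ φ : ℝ) + ∑ φ, (um A χ φ : ℝ) ^ 2 := by
      rw [hk, ← nsmul_eq_mul, ← card_univ, ← sum_const, mul_sum, ← sum_sub_distrib, ← sum_add_distrib]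
      exact sum_congr rfl fun _ _ => by simp [dm, c]; ring
    rw [a1, a2]; ring
  rw [e1]
  have e2 : TT A χ * ((ee A : ℝ) * k) * Nat.card A = k * Sh A (fun x => Complex.normSq (χ.1 x)) := by
    calc TT A χ * ((ee A : ℝ) * k) * Nat.card A = TT A χ * (ee A * Nat.card A) * k := by ring
      _ = Sh A (fun x => Complex.normSq (χ.1 x)) / Nat.card (normalizer (A : Set H)) *
          Nat.card (normalizer (A : Set H)) * k := by rw [hee]; rfl
      _ = _ := by rw [div_mul_cancel₀ _ hN.ne']; ring
  rw [← e2] at h1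
  refine le_of_mul_le_mul_right ?_ hA
  linarith

open Classical in
theorem class_sum {p : ℕ} [Fact p.Prime] (A : Sylow p H) [Fintype (A : Subgroup H)]
    (ti : ∀ x ∈ (A : Subgroup H), x ≠ 1 → ∀ g : H, g * x * g⁻¹ ∈ (A : Subgroup H) →
      g ∈ normalizer ((A : Subgroup H) : Set H))
    (f : H → ℝ) (hf : ∀ x g, f (g * x * g⁻¹) = f x) :
    (Nat.card H : ℝ) * Sh (A : Subgroup H) f = Nat.card (normalizer ((A : Subgroup H) : Set H)) *
      ∑ x : H, if x ≠ 1 ∧ ∃ k, x ^ p ^ k = 1 then f x else 0 := by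
  have e1 : (Nat.card H : ℝ) * Sh (A : Subgroup H) f =
      ∑ g : H, ∑ a : (A : Subgroup H), ∑ x : H, if g * a * g⁻¹ = x ∧ a ≠ 1 then f x else 0 := by
    rw [Nat.card_eq_fintype_card, ← card_univ, ← nsmul_eq_mul, ← sum_const]
    refine sum_congr rfl fun g _ => ?_
    rw [Sh]
    refine sum_congr rfl fun a _ => ?_
    rw [sum_eq_single (g * a * g⁻¹)]
    · by_cases ha : a = 1
      · simp [ha]
      · rw [if_neg ha, if_pos ⟨rfl, ha⟩, hf]
    · intro x _ hx
      rw [if_neg fun h => hx h.1.symm]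
    · intro h; exact absurd (mem_univ _) h
  have e2 : ∀ x : H, ∑ g : H, ∑ a : (A : Subgroup H), (if g * a * g⁻¹ = x ∧ a ≠ 1 then f x else 0) =
      Nat.card (normalizer ((A : Subgroup H) : Set H)) *
        if x ≠ 1 ∧ ∃ k, x ^ p ^ k = 1 then f x else 0 := by
    intro x
    have e3 : ∀ g : H, ∑ a : (A : Subgroup H), (if g * a * g⁻¹ = x ∧ a ≠ 1 then f x else 0) =
        if x ≠ 1 ∧ g⁻¹ * x * g ∈ (A : Subgroup H) then f x else 0 := by
      intro g
      by_cases hx : x ≠ 1 ∧ g⁻¹ * x * g ∈ (A : Subgroup H)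
      · rw [if_pos hx, sum_eq_single ⟨g⁻¹ * x * g, hx.2⟩, if_pos]
        · refine ⟨by group, fun h => hx.1 ?_⟩
          have h2 : g⁻¹ * x * g = 1 := congrArg Subtype.val h
          calc x = g * (g⁻¹ * x * g) * g⁻¹ := by group
            _ = 1 := by rw [h2]; group
        · intro a _ ha
          rw [if_neg]
          rintro ⟨rfl, _⟩
          exact ha (Subtype.ext (by group))
        · intro h; exact absurd (mem_univ _) h
      · rw [if_neg hx]
        refine sum_eq_zero fun a _ => ?_
        rw [if_neg]
        rintro ⟨rfl, ha⟩
        refine hx ⟨fun h => ha ?_, ?_⟩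
        · exact Subtype.ext (conj_eq_one_iff.1 h)
        · have : g⁻¹ * (g * a * g⁻¹) * g = (a : H) := by group
          rw [this]; exact a.2
    rw [sum_congr rfl fun g _ => e3 g]
    by_cases hx : x ≠ 1 ∧ ∃ k, x ^ p ^ k = 1
    · rw [if_pos hx]
      obtain ⟨hx1, hxp⟩ := hx
      have : ∃ g0 : H, g0⁻¹ * x * g0 ∈ (A : Subgroup H) := by
        obtain ⟨k, hk⟩ := hxp
        have hz : IsPGroup p (zpowers x) := by
          rw [isPGroup_sub_iff]
          intro y hy
          obtain ⟨j, rfl⟩ := mem_zpowers_iff.1 hy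
          refine ⟨k, ?_⟩
          rw [← zpow_natCast, ← zpow_mul, mul_comm, zpow_mul, zpow_natCast, hk, one_zpow]
        obtain ⟨P, hP⟩ := hz.exists_le_sylow
        obtain ⟨g, hg⟩ := MulAction.exists_smul_eq H P A
        refine ⟨g⁻¹, ?_⟩
        rw [inv_inv, ← hg]
        have : x ∈ (P : Subgroup H) := hP (mem_zpowers x)
        exact Subgroup.smul_mem_pointwise_smul x (MulAut.conj g) (P : Subgroup H) this
      obtain ⟨g0, hg0⟩ := this
      have hiff : ∀ g, (x ≠ 1 ∧ g⁻¹ * x * g ∈ (A : Subgroup H)) ↔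
          g⁻¹ * g0 ∈ normalizer ((A : Subgroup H) : Set H) := by
        intro g
        have hy : g⁻¹ * x * g = (g⁻¹ * g0) * (g0⁻¹ * x * g0) * (g⁻¹ * g0)⁻¹ := by group
        rw [hy]
        constructor
        · rintro ⟨-, h⟩
          refine ti _ hg0 (fun h1 => hx1 ?_) _ h
          calc x = g0 * (g0⁻¹ * x * g0) * g0⁻¹ := by group
            _ = 1 := by rw [h1]; group
        · intro h
          exact ⟨hx1, (h _).1 hg0⟩
      simp only [hiff]
      rw [← sum_filter, sum_const, nsmul_eq_mul]
      congr 2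
      rw [← Fintype.card_subtype, ← Nat.card_eq_fintype_card]
      refine Nat.card_congr (((Equiv.inv H).trans (Equiv.mulRight g0)).subtypeEquiv fun g => ?_)
      simp
    · rw [if_neg hx, mul_zero]
      refine sum_eq_zero fun g _ => ?_
      rw [if_neg]
      rintro ⟨h1, h2⟩
      refine hx ⟨h1, ?_⟩
      obtain ⟨k, hk⟩ := isPGroup_sub_iff.1 A.2 _ h2
      refine ⟨k, ?_⟩
      have : g⁻¹ * x * g = g⁻¹ * x * g⁻¹⁻¹ := by group
      rw [this, conj_pow] at hk
      exact conj_eq_one_iff.1 hk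
  rw [e1, mul_sum]
  have e4 : ∀ g : H, ∑ a : (A : Subgroup H), ∑ x : H, (if g * a * g⁻¹ = x ∧ a ≠ 1 then f x else 0) =
    ∑ x : H, ∑ a : (A : Subgroup H), (if g * a * g⁻¹ = x ∧ a ≠ 1 then f x else 0) := fun g => sum_comm
  rw [sum_congr rfl fun g _ => e4 g, sum_comm]
  exact sum_congr rfl fun x _ => e2 x

end
end EP

namespace EP
universe u
open Finset Subgroup
open scoped commutatorElement
set_option linter.unusedSectionVars false

section
variable {H : Type u} [Group H] [Fintype H]

open Classical in
theorem tot_sum (hE : IsEPPOGroup H) (A : ∀ i : {p // p ∈ (Nat.card H).primeFactors}, Sylow i.1 H)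
    (loc : ∀ i, Loc H (A i)) (f : H → ℝ) (hf : ∀ x g, f (g * x * g⁻¹) = f x)
    [∀ i, Fintype (A i : Subgroup H)] :
    ∑ i, Sh (A i : Subgroup H) f / Nat.card (normalizer ((A i : Subgroup H) : Set H)) =
      (∑ x : H, if x ≠ 1 then f x else 0) / Nat.card H := by
  have hH : (0 : ℝ) < Nat.card H := by exact_mod_cast Nat.card_pos
  have e1 : ∀ i, Sh (A i : Subgroup H) f / Nat.card (normalizer ((A i : Subgroup H) : Set H)) =
      (∑ x : H, if x ≠ 1 ∧ ∃ k, x ^ i.1 ^ k = 1 then f x else 0) / Nat.card H := by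
    intro i
    have : Fact i.1.Prime := ⟨Nat.prime_of_mem_primeFactors i.2⟩
    have hN : (0 : ℝ) < Nat.card (normalizer ((A i : Subgroup H) : Set H)) := by
      exact_mod_cast Nat.card_pos
    have h1 := class_sum (A i) (loc i).ti f hf
    rw [div_eq_div_iff hN.ne' hH.ne', mul_comm, h1, mul_comm]
  rw [sum_congr rfl fun i _ => e1 i, ← sum_div, sum_comm]
  congr 1
  refine sum_congr rfl fun x _ => ?_
  by_cases hx : x = 1
  · simp [hx]
  · obtain ⟨p, n, hp, hn⟩ := hE x
    have hn0 : n ≠ 0 := by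
      rintro rfl
      rw [pow_zero, orderOf_eq_one_iff] at hn
      exact hx hn
    have hpm : p ∈ (Nat.card H).primeFactors := by
      rw [Nat.mem_primeFactors]
      exact ⟨hp, ((dvd_pow_self p hn0).trans (hn ▸ dvd_rfl)).trans (orderOf_dvd_natCard x), Nat.card_pos.ne'⟩
    have hxp : x ^ p ^ n = 1 := by rw [← hn, pow_orderOf_eq_one]
    rw [if_pos hx, sum_eq_single ⟨p, hpm⟩, if_pos ⟨hx, n, hxp⟩]
    · intro i _ hi
      rw [if_neg]
      rintro ⟨-, k, hk⟩
      exact hx (pp_one hp (Nat.prime_of_mem_primeFactors i.2) (fun h => hi (Subtype.ext h.symm)) hxp hk)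
    · intro h; exact absurd (mem_univ _) h

/-- prime divisors of the order -/
abbrev PF (H : Type u) [Group H] := {p // p ∈ (Nat.card H).primeFactors}

theorem PF.pr (i : PF H) : i.1.Prime := Nat.prime_of_mem_primeFactors i.2

theorem lin_pow (A : ∀ i : PF H, Sylow i.1 H) (hA : ∀ i, (A i : Subgroup H) ≠ ⊥) (i : PF H) :
    ∃ j, Fintype.card ((A i : Subgroup H) →* ℂˣ) = i.1 ^ (j + 1) := by
  have hF : Fact i.1.Prime := ⟨i.pr⟩
  have hnt : Nontrivial (A i : Subgroup H) := (nontrivial_iff_ne_bot _).2 (hA i)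
  have hL := lin_nontrivial (p := i.1) (A i : Subgroup H) (A i).2
  obtain ⟨m, hm⟩ := IsPGroup.iff_card.1 (A i).2
  have hd := lin_card_dvd (A i : Subgroup H)
  rw [hm] at hd
  obtain ⟨j, -, hj⟩ := (Nat.dvd_prime_pow i.pr).1 hd
  rw [← Nat.card_eq_fintype_card, hj]
  have : j ≠ 0 := by
    rintro rfl
    have := Finite.one_lt_card_iff_nontrivial.2 hL
    rw [hj, pow_zero] at this
    exact lt_irrefl _ this
  exact ⟨j - 1, by congr 1; omega⟩

theorem lin_odd (hodd : Odd (Nat.card H)) (A : ∀ i : PF H, Sylow i.1 H) (i : PF H) :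
    Odd (Fintype.card ((A i : Subgroup H) →* ℂˣ)) := by
  rw [← Nat.card_eq_fintype_card]
  exact hodd.of_dvd_nat ((lin_card_dvd _).trans (card_subgroup_dvd_card _))

theorem lin_far (hodd : Odd (Nat.card H)) (A : ∀ i : PF H, Sylow i.1 H)
    (hA : ∀ i, (A i : Subgroup H) ≠ ⊥) (i j : PF H) (hij : i ≠ j)
    (hle : Fintype.card ((A i : Subgroup H) →* ℂˣ) ≤ Fintype.card ((A j : Subgroup H) →* ℂˣ)) :
    Fintype.card ((A i : Subgroup H) →* ℂˣ) + 2 ≤ Fintype.card ((A j : Subgroup H) →* ℂˣ) := by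
  have hne : Fintype.card ((A i : Subgroup H) →* ℂˣ) ≠ Fintype.card ((A j : Subgroup H) →* ℂˣ) := by
    intro he
    obtain ⟨a, ha⟩ := lin_pow A hA i
    obtain ⟨b, hb⟩ := lin_pow A hA j
    rw [ha, hb] at he
    have hd : i.1 ∣ j.1 ^ (b + 1) := he ▸ dvd_pow_self _ (Nat.succ_ne_zero _)
    exact hij (Subtype.ext ((Nat.prime_dvd_prime_iff_eq i.pr j.pr).1 (i.pr.dvd_of_dvd_pow hd)))
  obtain ⟨a, ha⟩ := lin_odd hodd A i
  obtain ⟨b, hb⟩ := lin_odd hodd A j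
  omega

theorem inner_r' {p : ℕ} (A : Sylow p H) (loc : Loc H A) (φ ψ : (A : Subgroup H) →* ℂˣ) (hφ : φ ≠ 1)
    (hψ : ψ ≠ 1) (hr : rl (A : Subgroup H) φ ψ) :
    ∑ χ, dm (A : Subgroup H) φ χ * dm (A : Subgroup H) ψ χ = ee (A : Subgroup H) + 1 :=
  inner_r (A : Subgroup H) loc.ti loc.cen φ ψ hφ hψ hr

theorem inner_nr' {p : ℕ} (A : Sylow p H) (loc : Loc H A) (φ ψ : (A : Subgroup H) →* ℂˣ) (hφ : φ ≠ 1)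
    (hψ : ψ ≠ 1) (hr : ¬ rl (A : Subgroup H) φ ψ) :
    ∑ χ, dm (A : Subgroup H) φ χ * dm (A : Subgroup H) ψ χ = ee (A : Subgroup H) :=
  inner_nr (A : Subgroup H) loc.ti φ ψ hφ hψ hr

set_option maxHeartbeats 1000000 in
/-- the character data -/
noncomputable def mkCD (hodd : Odd (Nat.card H)) (A : ∀ i : PF H, Sylow i.1 H)
    (hA : ∀ i, (A i : Subgroup H) ≠ ⊥) (loc : ∀ i, Loc H (A i)) :
    CD (PF H) (Irr H) (fun i => (A i : Subgroup H) →* ℂˣ) :=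
  { bar := barI
    one := oneI
    d := fun i φ χ => dm (A i : Subgroup H) φ χ
    e := fun i => ee (A i : Subgroup H)
    n := fun i => Nat.card (A i : Subgroup H)
    r := fun i φ ψ => rl (A i : Subgroup H) φ ψ
    T := fun i χ => TT (A i : Subgroup H) χ
    bar_bar := fun χ => Subtype.ext (funext fun x => by simp [barI])
    bar_one := rfl
    bar_fix := fun χ hχ => Subtype.ext (real_triv hodd χ.2 fun x => congrFun (congrArg Subtype.val hχ) x)
    d_triv := fun i χ => by simp [dm]
    d_one := fun i φ hφ => by
      have h1 : dm (A i : Subgroup H) φ oneI = 1 := dm_one (A i : Subgroup H) φ (by exact hφ)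
      exact h1
    d_inv := fun i φ χ => by
      have h1 := dm_inv (A i : Subgroup H) φ χ
      exact h1
    inner_r := fun i φ ψ hφ hψ hr => by
      have h1 : φ ≠ 1 := hφ
      have h2 : ψ ≠ 1 := hψ
      have h3 : rl (A i : Subgroup H) φ ψ := hr
      have h := inner_r' (A i) (loc i) φ ψ h1 h2 h3
      exact h
    inner_nr := fun i φ ψ hφ hψ hr => by
      have h1 : φ ≠ 1 := hφ
      have h2 : ψ ≠ 1 := hψ
      have h3 : ¬ rl (A i : Subgroup H) φ ψ := hr
      have h := inner_nr' (A i) (loc i) φ ψ h1 h2 h3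
      exact h
    cross := fun i j φ ψ hij => by
      refine dm_cross (A i : Subgroup H) (A j : Subgroup H) φ ψ fun g b hb hgb => ?_
      obtain ⟨k, hk⟩ := isPGroup_sub_iff.1 (A i).2 _ hgb
      obtain ⟨l, hl⟩ := isPGroup_sub_iff.1 (A j).2 _ hb
      rw [conj_pow] at hk
      exact pp_one i.pr j.pr (fun h => hij (Subtype.ext h)) (conj_eq_one_iff.1 hk) hl
    r_refl := fun i => rl_refl (A i : Subgroup H)
    r_symm := fun i => rl_symm (A i : Subgroup H)
    r_trans := fun i => rl_trans (A i : Subgroup H)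
    r_one := fun i => rl_one (A i : Subgroup H)
    nr_inv := fun i φ hφ => by
      have h := nr_inv hodd (A i : Subgroup H) (loc i).cen φ hφ
      exact h
    orb := fun i φ hφ => by
      have h := orb_card (A i : Subgroup H) (loc i).cen φ hφ
      exact h
    e_ge := fun i => by
      have h := ee_ge hodd (A i : Subgroup H) (loc i).ne
      exact h
    nL := fun i => by
      have hF : Fact i.1.Prime := ⟨i.pr⟩
      have hnt : Nontrivial (A i : Subgroup H) := (nontrivial_iff_ne_bot _).2 (hA i)
      exact lin_nontrivial (p := i.1) (A i : Subgroup H) (A i).2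
    kn := fun i => by
      rw [← Nat.card_eq_fintype_card]
      exact Nat.le_of_dvd Nat.card_pos (lin_card_dvd _)
    T_nonneg := fun i χ => by
      have h := TT_nonneg (A i : Subgroup H) χ
      exact h
    T_ge := fun i χ => by
      have h := TT_ge (A i : Subgroup H) χ
      exact h
    k_far := fun i j hij hle => lin_far hodd A hA i j hij hle }

theorem mk_sum (hodd : Odd (Nat.card H)) (hE : IsEPPOGroup H) (A : ∀ i : PF H, Sylow i.1 H)
    (loc : ∀ i, Loc H (A i)) (χ : Irr H) :
    0 ≤ ∑ i, (((Nat.card (A i : Subgroup H) : ℝ) - 1) / (ee (A i : Subgroup H) * Nat.card (A i : Subgroup H))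
      - TT (A i : Subgroup H) χ) := by
    classical
    let _ : ∀ i, Fintype (A i : Subgroup H) := fun i => Fintype.ofFinite _
    have hH : (0 : ℝ) < Nat.card H := by exact_mod_cast Nat.card_pos
    have t1 := tot_sum hE A loc (fun _ => 1) (fun _ _ => rfl)
    have t2 := tot_sum hE A loc (fun x => Complex.normSq (χ.1 x)) (fun x g => by rw [irr_conj χ.2])
    have e1 : ∀ i, ((Nat.card (A i : Subgroup H) : ℝ) - 1) / (ee (A i : Subgroup H) * Nat.card (A i : Subgroup H)) - TT (A i : Subgroup H) χ =
        Sh (A i : Subgroup H) (fun _ => 1) / Nat.card (normalizer ((A i : Subgroup H) : Set H)) -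
        Sh (A i : Subgroup H) (fun x => Complex.normSq (χ.1 x)) /
          Nat.card (normalizer ((A i : Subgroup H) : Set H)) := by
      intro i
      have a1 : ((ee (A i : Subgroup H) : ℕ) : ℝ) * Nat.card (A i : Subgroup H) = Nat.card (normalizer ((A i : Subgroup H) : Set H)) := by
        exact_mod_cast ee_mul (A i : Subgroup H)
      have a2 : Sh (A i : Subgroup H) (fun _ => 1) = (Nat.card (A i : Subgroup H) : ℝ) - 1 := by
        have : ∀ a : (A i : Subgroup H), (if a = 1 then (0:ℝ) else 1) = 1 - if a = 1 then 1 else 0 :=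
          fun a => by split_ifs <;> simp
        rw [Sh, sum_congr rfl fun a _ => this a, sum_sub_distrib]
        simp [Nat.card_eq_fintype_card]
      rw [a1, a2]
      rfl
    rw [sum_congr rfl fun i _ => e1 i, sum_sub_distrib]
    rw [t1, t2, ← sub_div]
    refine div_nonneg ?_ hH.le
    have b : ∀ f : H → ℝ, (∑ x : H, if x ≠ 1 then f x else 0) = ∑ x, f x - f 1 := by
      intro f
      have : ∀ x : H, (if x ≠ 1 then f x else 0) = f x - if x = 1 then f x else 0 :=
        fun x => by by_cases hx : x = 1 <;> simp [hx]
      rw [sum_congr rfl fun a _ => this a, sum_sub_distrib]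
      simp
    rw [b, b]
    have o : ∑ x, Complex.normSq (χ.1 x) = Nat.card H := by
      have := irr_orth χ.2 χ.2
      rw [if_pos rfl] at this
      have h2 : ∑ x, χ.1 x * χ.1 x⁻¹ = ((∑ x, Complex.normSq (χ.1 x) : ℝ) : ℂ) := by
        push_cast
        exact sum_congr rfl fun x _ => by rw [irr_inv χ.2, Complex.mul_conj]
      rw [h2] at this
      exact_mod_cast this
    obtain ⟨n, hn, hn1⟩ := irr_one χ.2
    rw [o, hn1, Complex.normSq_natCast]
    have hn' : (1 : ℝ) ≤ n := by exact_mod_cast hn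
    simp only [sum_const, card_univ, nsmul_eq_mul, mul_one, Nat.card_eq_fintype_card]
    nlinarith
theorem min_false {q : ℕ} (h : Hyp q H) (hq : q.Prime) (hperf : commutator H = ⊤)
    (hprop : ∀ K : Subgroup H, K ≠ ⊤ → Group.IsSolvable K)
    (hsimple : ∀ K : Subgroup H, K.Normal → K = ⊥ ∨ K = ⊤) (hns : ¬ Group.IsSolvable H) : False := by
  classical
  obtain ⟨hodd, hE, hcyc⟩ := id h
  have hpr : ∀ i : PF H, i.1.Prime := fun i => Nat.prime_of_mem_primeFactors i.2
  have hF : ∀ i : PF H, Fact i.1.Prime := fun i => ⟨hpr i⟩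
  have hA' : ∀ i : PF H, ∃ A : Sylow i.1 H, (A : Subgroup H) ≠ ⊥ := fun i => by
    obtain ⟨A⟩ := (inferInstance : Nonempty (Sylow i.1 H))
    exact ⟨A, A.ne_bot_of_dvd_card (Nat.dvd_of_mem_primeFactors i.2)⟩
  choose A hA using hA'
  have loc : ∀ i, Loc H (A i) := fun i => loc_all h hq hperf hprop hsimple hns (A i) (hA i)
  have hcomm : ∀ i : PF H, i.1 ≠ q → Nat.card (A i : Subgroup H) = Fintype.card ((A i : Subgroup H) →* ℂˣ) := by
    intro i hi
    have hc := hcyc i.1 (hpr i) hi (A i : Subgroup H) (A i).2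
    rw [← Nat.card_eq_fintype_card]
    refine (lin_card_comm _ fun x y => ?_).symm
    let _ := hc.commGroup
    exact mul_comm x y
  have hex : ∃ i0 : PF H, ∀ i : PF H, i ≠ i0 → i.1 ≠ q := by
    by_cases hqm : q ∈ (Nat.card H).primeFactors
    · exact ⟨⟨q, hqm⟩, fun i hi h => hi (Subtype.ext h)⟩
    · have hne : Nat.card H ≠ 1 := by
        intro h1
        have := (Nat.card_eq_one_iff_unique.1 h1).1
        exact hns inferInstance
      obtain ⟨p, hp, hpd⟩ := Nat.exists_prime_and_dvd hne
      refine ⟨⟨p, Nat.mem_primeFactors.2 ⟨hp, hpd, Nat.card_pos.ne'⟩⟩, fun i _ h => hqm ?_⟩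
      rw [← h]; exact i.2
  obtain ⟨i0, hi0⟩ := hex
  exact (mkCD hodd A hA loc).final i0 (fun i hi => hcomm i (hi0 i hi)) (mk_sum hodd hE A loc)

end

theorem thm_odd (q : ℕ) (hq : q.Prime) (n : ℕ) : ∀ (H : Type u) [Group H] [Finite H],
    Nat.card H = n → Hyp q H → Group.IsSolvable H := by
  induction n using Nat.strong_induction_on with
  | _ n ih =>
  intro H _ _ hn h
  by_contra hns
  have hprop : ∀ K : Subgroup H, K ≠ ⊤ → Group.IsSolvable K := by
    intro K hK
    have hlt : Nat.card K < n := by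
      rw [← hn]
      refine lt_of_le_of_ne (Nat.le_of_dvd Nat.card_pos (card_subgroup_dvd_card K)) fun he => hK ?_
      exact Subgroup.eq_top_of_card_eq K he
    exact ih _ hlt K rfl (h.sub K)
  have hsimple : ∀ K : Subgroup H, K.Normal → K = ⊥ ∨ K = ⊤ := by
    intro K hKn
    by_contra hc
    push Not at hc
    have h1 := hprop K hc.2
    have hlt : Nat.card (H ⧸ K) < n := by
      rw [← hn, K.card_eq_card_quotient_mul_card_subgroup]
      have : 1 < Nat.card K := (one_lt_card_iff_ne_bot K).2 hc.1
      have h3 : 0 < Nat.card (H ⧸ K) := Nat.card_pos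
      nlinarith
    have h2 := ih _ hlt (H ⧸ K) rfl (h.quot K)
    exact hns ((Group.isSolvable_iff_subgroup_quotient K).2 ⟨h1, h2⟩)
  have hperf : commutator H = ⊤ := by
    rcases hsimple (commutator H) inferInstance with h0 | h0
    · exfalso
      apply hns
      exact Group.isSolvable_of_comm fun a b => by
        have : ⁅a, b⁆ ∈ commutator H := commutator_mem_commutator (mem_top a) (mem_top b)
        rw [h0, mem_bot] at this
        exact commutatorElement_eq_one_iff_mul_comm.1 this
    · exact h0
  have := Fintype.ofFinite H
  exact min_false h hq hperf hprop hsimple hns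

end EP


theorem EPPO_abelian_sylow_two_normal_qSubgroup_solvable {G : Type*} [Group G] [Finite G]
    (hG : IsEPPOGroup G)
    (habel : ∀ P : Sylow 2 G, ∀ x y : (P : Subgroup G), x * y = y * x)
    {q : ℕ} (hq : q.Prime) (Q : Subgroup G) [Q.Normal] (hQ : Q ≠ ⊥)
    (hQq : IsPGroup q Q) : IsSolvable G := by
  exact EP.main_red (fun q hq H _ _ h => EP.thm_odd q hq _ H rfl h) hG habel hq Q hQ hQq
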